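/- Let Ω be a bounded Lipschitz domain in ℝ^N (N ≥ 2), x₀ ∈ Ω, a > 0 and V ∈ 𝒱(Ω,a). Given y ∈ ∂Ω and a pseudo-normal ν_y at y for Ω, the following are equivalent: (i) K̃_y^V = 0 (i.e. y ∈ Sing_V(Ω)); (ii) limsup_{t↓0} K_y^V(y+tν_y)/K_y(y+tν_y) = +∞; (iii) lim_{t↓0} K_y^V(y+tν_y)/K_y(y+tν_y) = +∞; (iv) lim_{Ω∋x→y} g_{x₀}^V(x)/g_{x₀}^0(x) = 0. -/

import Mathlib

open MeasureTheory Metric Set Filter Topology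
open scoped ENNReal NNReal

noncomputable section

namespace Anc

abbrev ES (N : ℕ) := EuclideanSpace ℝ (Fin N)

/-- `δ_Ω(x)`: the distance from `x` to the complement of `Ω`. -/
def dista {N : ℕ} (Ω : Set (ES N)) (x : ES N) : ℝ := infDist x Ωᶜ

/-- Pointwise Laplacian (junk values where the derivatives do not exist). -/
def lap {N : ℕ} (u : ES N → ℝ) (x : ES N) : ℝ :=
  ∑ i : Fin N,
    fderiv ℝ (fun y => fderiv ℝ u y (EuclideanSpace.single i 1)) x (EuclideanSpace.single i 1)

/-- Smooth compactly supported test functions in `Ω`. -/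
def IsTestFun {N : ℕ} (Ω : Set (ES N)) (φ : ES N → ℝ) : Prop :=
  ContDiff ℝ (⊤ : ℕ∞) φ ∧ IsCompact (tsupport φ) ∧ tsupport φ ⊆ Ω

/-- `u` is a continuous weak solution of `Δu - V·u = 0` in `Ω` (i.e. `L_V`-harmonic). -/
def LVHarmonic {N : ℕ} (Ω : Set (ES N)) (V u : ES N → ℝ) : Prop :=
  ContinuousOn u Ω ∧ LocallyIntegrableOn u Ω ∧
    LocallyIntegrableOn (fun x => V x * u x) Ω ∧
    ∀ φ, IsTestFun Ω φ → ∫ x in Ω, u x * lap φ x = ∫ x in Ω, V x * u x * φ x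

/-- `s` is `L_V`-superharmonic in `Ω` (weakly, `Δs - V·s ≤ 0`, `s` l.s.c.). -/
def LVSuperharmonic {N : ℕ} (Ω : Set (ES N)) (V s : ES N → ℝ) : Prop :=
  LowerSemicontinuousOn s Ω ∧ LocallyIntegrableOn s Ω ∧
    LocallyIntegrableOn (fun x => V x * s x) Ω ∧
    ∀ φ, IsTestFun Ω φ → (∀ x, 0 ≤ φ x) →
      ∫ x in Ω, s x * lap φ x ≤ ∫ x in Ω, V x * s x * φ x

/-- The class `𝒱(Ω,a)` of nonnegative Borel potentials with `V(x) ≤ a/δ_Ω(x)²`. -/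
def VClass {N : ℕ} (Ω : Set (ES N)) (a : ℝ) (V : ES N → ℝ) : Prop :=
  Measurable V ∧ ∀ x ∈ Ω, 0 ≤ V x ∧ V x * dista Ω x ^ 2 ≤ a

/-- Lipschitz domain: open, connected, and near every boundary point, after an
orthogonal change of coordinates, the domain is the region above the graph of a
Lipschitz function. -/
def IsLipschitzDomain {N : ℕ} (Ω : Set (ES N)) : Prop :=
  IsOpen Ω ∧ IsConnected Ω ∧
    ∀ z ∈ frontier Ω, ∃ (g : ES N ≃ₗᵢ[ℝ] ES N) (i : Fin N) (f : ES N → ℝ)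
      (L : ℝ≥0) (ε : ℝ), 0 < ε ∧ LipschitzWith L f ∧
      (∀ x w : ES N, (∀ j, j ≠ i → x j = w j) → f x = f w) ∧
      ∀ x ∈ ball z ε, (x ∈ Ω ↔ f (g x) < g x i)

/-- `Ω` has a `C^{1,α}` boundary near `y`. -/
def IsC1AlphaNear {N : ℕ} (Ω : Set (ES N)) (α : ℝ) (y : ES N) : Prop :=
  ∃ (g : ES N ≃ₗᵢ[ℝ] ES N) (i : Fin N) (f : ES N → ℝ) (C : ℝ≥0) (ε : ℝ),
    0 < ε ∧ ContDiff ℝ 1 f ∧ HolderWith C α.toNNReal (fderiv ℝ f) ∧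
    (∀ x w : ES N, (∀ j, j ≠ i → x j = w j) → f x = f w) ∧
    ∀ x ∈ ball y ε, (x ∈ Ω ↔ f (g x) < g x i)

/-- `K` is the `L_V`-Martin kernel of `Ω` with pole `y ∈ ∂Ω`, normalized at `x₀`:
the unique positive `L_V`-harmonic function vanishing on `∂Ω ∖ {y}` with `K x₀ = 1`. -/
def IsMartinKernel {N : ℕ} (Ω : Set (ES N)) (V : ES N → ℝ) (x₀ y : ES N)
    (K : ES N → ℝ) : Prop :=
  LVHarmonic Ω V K ∧ (∀ x ∈ Ω, 0 < K x) ∧ K x₀ = 1 ∧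
    ∀ z ∈ frontier Ω, z ≠ y → Tendsto K (𝓝[Ω] z) (𝓝 0)

/-- `G` is the `L_V`-Green function of `Ω` with pole `y ∈ Ω`:
positive, vanishing at the boundary, and `L_V G = -δ_y` weakly. -/
def IsGreenFunction {N : ℕ} (Ω : Set (ES N)) (V : ES N → ℝ) (y : ES N)
    (G : ES N → ℝ) : Prop :=
  ContinuousOn G (Ω \ {y}) ∧ (∀ x ∈ Ω \ {y}, 0 < G x) ∧ LocallyIntegrableOn G Ω ∧
    (∀ z ∈ frontier Ω, Tendsto G (𝓝[Ω \ {y}] z) (𝓝 0)) ∧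
    ∀ φ, IsTestFun Ω φ → ∫ x in Ω, G x * (lap φ x - V x * φ x) = -φ y

/-- `y ∈ ∂Ω` is finely regular w.r.t. `V`, `Ky` being the classical Martin kernel at
`y`: the greatest `L_V`-harmonic minorant of `Ky` is positive, equivalently `Ky`
admits a positive `L_V`-harmonic minorant. -/
def FinelyRegular {N : ℕ} (Ω : Set (ES N)) (V Ky : ES N → ℝ) : Prop :=
  ∃ h, LVHarmonic Ω V h ∧ (∀ x ∈ Ω, 0 < h x) ∧ ∀ x ∈ Ω, h x ≤ Ky x

/-- `h` is the greatest nonnegative `L_V`-harmonic minorant of `w` in `Ω`. -/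
def IsGreatestLVHarmMinorant {N : ℕ} (Ω : Set (ES N)) (V w h : ES N → ℝ) : Prop :=
  LVHarmonic Ω V h ∧ (∀ x ∈ Ω, 0 ≤ h x ∧ h x ≤ w x) ∧
    ∀ g, LVHarmonic Ω V g → (∀ x ∈ Ω, 0 ≤ g x ∧ g x ≤ w x) → ∀ x ∈ Ω, g x ≤ h x

/-- Classical superharmonicity via the sub-mean value property. -/
def IsSuperharmonicOn {N : ℕ} (W : Set (ES N)) (s : ES N → ℝ) : Prop :=
  LowerSemicontinuousOn s W ∧ LocallyIntegrableOn s W ∧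
    ∀ x ∈ W, ∀ t > (0:ℝ), closedBall x t ⊆ W → ⨍ z in ball x t, s z ≤ s x

/-- The réduite of `w` over `A` in `W`: infimum of the nonnegative superharmonic
functions in `W` dominating `w` on `A`. -/
def reduite {N : ℕ} (W : Set (ES N)) (w : ES N → ℝ) (A : Set (ES N)) (x : ES N) : ℝ :=
  sInf {v | ∃ s : ES N → ℝ, IsSuperharmonicOn W s ∧ (∀ z ∈ W, 0 ≤ s z) ∧
    (∀ z ∈ A, w z ≤ s z) ∧ v = s x}

/-- The lower semicontinuous regularization `R̂` of the réduite. -/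
def reduiteReg {N : ℕ} (W : Set (ES N)) (w : ES N → ℝ) (A : Set (ES N)) (x : ES N) : ℝ :=
  liminf (reduite W w A) (𝓝[W] x)

/-- Nontangential approach region at `y` with aperture `κ`. -/
def ntRegion {N : ℕ} (Ω : Set (ES N)) (y : ES N) (κ : ℝ) : Set (ES N) :=
  {x | x ∈ Ω ∧ dist x y ≤ κ * dista Ω x}

/-- `g` tends to `l` nontangentially at `y`. -/
def TendstoNT {N : ℕ} (Ω : Set (ES N)) (g : ES N → ℝ) (y : ES N) (l : Filter ℝ) : Prop :=
  ∀ κ > (0:ℝ), Tendsto g (𝓝[ntRegion Ω y κ] y) l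

/-- Truncated cone `{y + t(ν+v) : 0 < t ≤ η, ‖v‖ ≤ η}` with vertex `y`. -/
def truncCone {N : ℕ} (y ν : ES N) (η : ℝ) : Set (ES N) :=
  {x | ∃ (t : ℝ) (v : ES N), 0 < t ∧ t ≤ η ∧ ‖v‖ ≤ η ∧ x = y + t • (ν + v)}

/-- Last coordinate of a point of `ℝ^{n+1}`. -/
def lastC {n : ℕ} (x : ES (n + 1)) : ℝ := x (Fin.last n)

/-- First `n` coordinates of a point of `ℝ^{n+1}`. -/
def firstC {n : ℕ} (x : ES (n + 1)) : ES n :=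
  (EuclideanSpace.equiv (Fin n) ℝ).symm fun i => x i.castSucc

/-- The region `U_f(r,ρ) = {(x',x_N) : |x'| < r, f(x') < x_N < ρ}`. -/
def Ucyl {n : ℕ} (f : ES n → ℝ) (r ρ : ℝ) : Set (ES (n + 1)) :=
  {x | ‖firstC x‖ < r ∧ f (firstC x) < lastC x ∧ lastC x < ρ}

/-- The cylinder `T(t) = B_{N-1}(0,tr) × (-tρ, tρ)`. -/
def Tcyl (n : ℕ) (r ρ t : ℝ) : Set (ES (n + 1)) :=
  {x | ‖firstC x‖ < t * r ∧ |lastC x| < t * ρ}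

/-- The graph part `∂_#U` of the boundary of `U_f(r,ρ)`. -/
def graphBdry {n : ℕ} (f : ES n → ℝ) (r ρ : ℝ) : Set (ES (n + 1)) :=
  frontier (Ucyl f r ρ) ∩ {x | ‖firstC x‖ < r ∧ lastC x = f (firstC x)}

section

/-- unit coordinate vector -/
def ev {N : ℕ} (i : Fin N) : ES N := EuclideanSpace.single i (1:ℝ)

/-- squared norm of the gradient -/
def gradsq {N : ℕ} (u : ES N → ℝ) (x : ES N) : ℝ := ∑ i : Fin N, (fderiv ℝ u x (ev i)) ^ 2

lemma gradsq_nonneg {N : ℕ} (u : ES N → ℝ) (x : ES N) : 0 ≤ gradsq u x :=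
  Finset.sum_nonneg fun _ _ => sq_nonneg _

lemma lap_def {N : ℕ} (u : ES N → ℝ) (x : ES N) :
    lap u x = ∑ i : Fin N, fderiv ℝ (fun y => fderiv ℝ u y (ev i)) x (ev i) := rfl

lemma contDiff_pd {N : ℕ} {u : ES N → ℝ} (hu : ContDiff ℝ 2 u) (v : ES N) :
    ContDiff ℝ 1 (fun y => fderiv ℝ u y v) :=
  (hu.fderiv_right (m := 1) (by norm_num)).clm_apply contDiff_const

lemma lap_congr {N : ℕ} {u w : ES N → ℝ} {x : ES N} (h : u =ᶠ[𝓝 x] w) : lap u x = lap w x := by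
  rw [lap_def, lap_def]
  refine Finset.sum_congr rfl fun i _ => ?_
  have : (fun y => fderiv ℝ u y (ev i)) =ᶠ[𝓝 x] (fun y => fderiv ℝ w y (ev i)) := by
    filter_upwards [h.fderiv (𝕜 := ℝ)] with y hy
    rw [hy]
  rw [this.fderiv_eq]

lemma lap_zero_fun {N : ℕ} (x : ES N) : lap (fun _ : ES N => (0:ℝ)) x = 0 := by
  simp [lap]

lemma lap_const {N : ℕ} (c : ℝ) (x : ES N) : lap (fun _ : ES N => c) x = 0 := by
  simp [lap]

lemma lap_eq_zero {N : ℕ} {u : ES N → ℝ} {x : ES N} (h : x ∉ tsupport u) : lap u x = 0 := by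
  rw [lap_congr (w := fun _ => 0) (notMem_tsupport_iff_eventuallyEq.1 h), lap_zero_fun]

lemma lap_continuous {N : ℕ} {u : ES N → ℝ} (hu : ContDiff ℝ 2 u) : Continuous (lap u) := by
  unfold lap
  refine continuous_finsetSum _ fun i _ => ?_
  have h := (contDiff_pd hu (ev i)).continuous_fderiv (by norm_num)
  exact h.clm_apply continuous_const

lemma lap_add {N : ℕ} {u w : ES N → ℝ} (hu : ContDiff ℝ 2 u) (hw : ContDiff ℝ 2 w) (x : ES N) :
    lap (fun y => u y + w y) x = lap u x + lap w x := by
  simp only [lap_def]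
  rw [← Finset.sum_add_distrib]
  refine Finset.sum_congr rfl fun i _ => ?_
  have : (fun y => fderiv ℝ (fun y => u y + w y) y (ev i)) =
      fun y => fderiv ℝ u y (ev i) + fderiv ℝ w y (ev i) := by
    ext y
    rw [fderiv_fun_add (hu.differentiable (by norm_num) y) (hw.differentiable (by norm_num) y)]
    rfl
  rw [this, fderiv_fun_add ((contDiff_pd hu _).differentiable (by norm_num) x)
    ((contDiff_pd hw _).differentiable (by norm_num) x)]
  rfl

lemma lap_const_mul {N : ℕ} {u : ES N → ℝ} (c : ℝ) (hu : ContDiff ℝ 2 u) (x : ES N) :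
    lap (fun y => c * u y) x = c * lap u x := by
  simp only [lap_def]
  rw [Finset.mul_sum]
  refine Finset.sum_congr rfl fun i _ => ?_
  have : (fun y => fderiv ℝ (fun y => c * u y) y (ev i)) = fun y => c * fderiv ℝ u y (ev i) := by
    ext y
    rw [fderiv_const_mul (hu.differentiable (by norm_num) y)]
    rfl
  rw [this, fderiv_const_mul ((contDiff_pd hu _).differentiable (by norm_num) x)]
  rfl

lemma lap_sub {N : ℕ} {u w : ES N → ℝ} (hu : ContDiff ℝ 2 u) (hw : ContDiff ℝ 2 w) (x : ES N) :
    lap (fun y => u y - w y) x = lap u x - lap w x := by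
  have h := lap_add hu (w := fun y => (-1) * w y) (by fun_prop) x
  rw [lap_const_mul _ hw] at h
  rw [show (fun y => u y - w y) = fun y => u y + (-1) * w y by ext; ring, h]
  ring

lemma lap_comp {N : ℕ} {u : ES N → ℝ} {T : ℝ → ℝ} (hu : ContDiff ℝ 2 u) (hT : ContDiff ℝ 2 T)
    (x : ES N) :
    lap (fun y => T (u y)) x = deriv (deriv T) (u x) * gradsq u x + deriv T (u x) * lap u x := by
  simp only [lap_def, gradsq]
  rw [Finset.mul_sum, Finset.mul_sum, ← Finset.sum_add_distrib]
  refine Finset.sum_congr rfl fun i _ => ?_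
  have hd : ∀ y, HasFDerivAt u (fderiv ℝ u y) y := fun y =>
    (hu.differentiable (by norm_num) y).hasFDerivAt
  have hT1 : ContDiff ℝ 1 (deriv T) := by
    have := hT.iterate_deriv' 1 1
    simpa using this
  have : (fun y => fderiv ℝ (fun y => T (u y)) y (ev i)) =
      fun y => deriv T (u y) * fderiv ℝ u y (ev i) := by
    ext y
    have h1 : HasDerivAt T (deriv T (u y)) (u y) :=
      (hT.differentiable (by norm_num) (u y)).hasDerivAt
    have h2 := h1.comp_hasFDerivAt y (hd y)
    have h3 : fderiv ℝ (fun y => T (u y)) y = deriv T (u y) • fderiv ℝ u y := h2.fderiv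
    rw [h3]; rfl
  rw [this]
  have h1 : HasDerivAt (deriv T) (deriv (deriv T) (u x)) (u x) :=
    (hT1.differentiable (by norm_num) (u x)).hasDerivAt
  have h2 := h1.comp_hasFDerivAt x (hd x)
  have h3 : HasFDerivAt (fun y => fderiv ℝ u y (ev i)) _ x :=
    ((contDiff_pd hu (ev i)).differentiable (by norm_num) x).hasFDerivAt
  have h4 := (h2.mul h3).fderiv
  have h5 : fderiv ℝ (fun y => deriv T (u y) * fderiv ℝ u y (ev i)) x = _ := h4
  rw [h5]
  simp
  ring

lemma contDiff_nsq {N : ℕ} {n : WithTop ℕ∞} (c : ES N) (k : ℝ) :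
    ContDiff ℝ n (fun x : ES N => ‖x - c‖ ^ 2 * k) := by
  have : ContDiff ℝ n (fun x : ES N => ‖x - c‖ ^ 2) := (contDiff_id.sub contDiff_const).norm_sq ℝ
  exact this.mul contDiff_const

lemma fderiv_nsq {N : ℕ} (c : ES N) (k : ℝ) (x : ES N) (i : Fin N) :
    fderiv ℝ (fun x : ES N => ‖x - c‖ ^ 2 * k) x (ev i) = 2 * k * (x i - c i) := by
  have h1 : HasFDerivAt (fun x : ES N => x - c) (ContinuousLinearMap.id ℝ (ES N)) x :=
    (hasFDerivAt_id x).sub_const c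
  have h2 := (h1.norm_sq).mul_const k
  rw [h2.fderiv]
  simp [ev, EuclideanSpace.inner_single_right]
  ring

lemma gradsq_nsq {N : ℕ} (c : ES N) (k : ℝ) (x : ES N) :
    gradsq (fun x : ES N => ‖x - c‖ ^ 2 * k) x = 4 * k ^ 2 * ‖x - c‖ ^ 2 := by
  unfold gradsq
  simp_rw [fderiv_nsq]
  rw [EuclideanSpace.norm_sq_eq, Finset.mul_sum]
  refine Finset.sum_congr rfl fun i _ => ?_
  simp
  ring

lemma lap_nsq {N : ℕ} (c : ES N) (k : ℝ) (x : ES N) :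
    lap (fun x : ES N => ‖x - c‖ ^ 2 * k) x = 2 * N * k := by
  rw [lap_def]
  simp_rw [fderiv_nsq]
  have : ∀ i : Fin N, fderiv ℝ (fun y : ES N => 2 * k * (y i - c i)) x (ev i) = 2 * k := by
    intro i
    have h1 : HasFDerivAt (fun y : ES N => y i) (EuclideanSpace.proj i : ES N →L[ℝ] ℝ) x :=
      (EuclideanSpace.proj i : ES N →L[ℝ] ℝ).hasFDerivAt
    have h2 := (h1.sub_const (c i)).const_mul (2 * k)
    rw [h2.fderiv]
    simp [ev]
  simp_rw [this]
  simp
  ring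

/-- Laplacian of radial functions -/
lemma lap_radial {N : ℕ} {T : ℝ → ℝ} (hT : ContDiff ℝ 2 T) (c : ES N) (k : ℝ) (x : ES N) :
    lap (fun x : ES N => T (‖x - c‖ ^ 2 * k)) x =
      4 * k ^ 2 * ‖x - c‖ ^ 2 * deriv (deriv T) (‖x - c‖ ^ 2 * k)
        + 2 * N * k * deriv T (‖x - c‖ ^ 2 * k) := by
  rw [lap_comp (contDiff_nsq c k) hT, gradsq_nsq, lap_nsq]
  ring

lemma integral_pd {N : ℕ} {f φ : ES N → ℝ} (hf : ContDiff ℝ 1 f) (hφ : ContDiff ℝ 1 φ)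
    (hc : HasCompactSupport φ) (v : ES N) :
    ∫ x, f x * fderiv ℝ φ x v = - ∫ x, fderiv ℝ f x v * φ x := by
  have hfd : Continuous (fun x => fderiv ℝ f x v) :=
    (hf.continuous_fderiv (by norm_num)).clm_apply continuous_const
  have hφd : Continuous (fun x => fderiv ℝ φ x v) :=
    (hφ.continuous_fderiv (by norm_num)).clm_apply continuous_const
  have hcd : HasCompactSupport (fun x => fderiv ℝ φ x v) := hc.fderiv_apply (𝕜 := ℝ) v
  refine integral_mul_fderiv_eq_neg_fderiv_mul_of_integrable ?_ ?_ ?_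
    (fun x _ => hf.differentiable (by norm_num) x) (fun x _ => hφ.differentiable (by norm_num) x)
  · exact (hfd.mul hφ.continuous).integrable_of_hasCompactSupport hc.mul_left
  · exact (hf.continuous.mul hφd).integrable_of_hasCompactSupport hcd.mul_left
  · exact (hf.continuous.mul hφ.continuous).integrable_of_hasCompactSupport hc.mul_left

/-- Green's identity -/
lemma integral_lap {N : ℕ} {f φ : ES N → ℝ} (hf : ContDiff ℝ 2 f) (hφ : ContDiff ℝ 2 φ)
    (hc : HasCompactSupport φ) :
    ∫ x, f x * lap φ x = ∫ x, lap f x * φ x := by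
  simp only [lap_def, Finset.mul_sum, Finset.sum_mul]
  have i1 : ∀ i : Fin N, Integrable
      (fun x => f x * fderiv ℝ (fun y => fderiv ℝ φ y (ev i)) x (ev i)) := by
    intro i
    refine Continuous.integrable_of_hasCompactSupport ?_ ?_
    · exact hf.continuous.mul (((contDiff_pd hφ (ev i)).continuous_fderiv
        (by norm_num)).clm_apply continuous_const)
    · exact ((hc.fderiv_apply (𝕜 := ℝ) (ev i)).fderiv_apply (𝕜 := ℝ) (ev i)).mul_left
  have i2 : ∀ i : Fin N, Integrable
      (fun x => fderiv ℝ (fun y => fderiv ℝ f y (ev i)) x (ev i) * φ x) := by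
    intro i
    refine Continuous.integrable_of_hasCompactSupport ?_ ?_
    · exact (((contDiff_pd hf (ev i)).continuous_fderiv
        (by norm_num)).clm_apply continuous_const).mul hφ.continuous
    · exact hc.mul_left
  rw [integral_finsetSum _ fun i _ => i1 i, integral_finsetSum _ fun i _ => i2 i]
  refine Finset.sum_congr rfl fun i _ => ?_
  rw [integral_pd (hf.of_le (by norm_num)) (contDiff_pd hφ (ev i))
    (hc.fderiv_apply (𝕜 := ℝ) (ev i)), 
    integral_pd (f := fun x => fderiv ℝ f x (ev i)) (contDiff_pd hf (ev i)) (hφ.of_le (by norm_num)) hc]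
  simp

end

section

/-- profile `exp(-k/(1-s))` for `s < 1`, zero for `s ≥ 1` -/
def Fk (k s : ℝ) : ℝ := expNegInvGlue ((1 - s) * k⁻¹)

lemma Fk_contDiff {n : ℕ∞} (k : ℝ) : ContDiff ℝ n (Fk k) :=
  expNegInvGlue.contDiff.comp ((contDiff_const.sub contDiff_id).mul contDiff_const)

lemma Fk_nonneg (k s : ℝ) : 0 ≤ Fk k s := expNegInvGlue.nonneg _

lemma Fk_zero {k s : ℝ} (hk : 0 < k) (hs : 1 ≤ s) : Fk k s = 0 :=
  expNegInvGlue.zero_of_nonpos (mul_nonpos_of_nonpos_of_nonneg (by linarith) (by positivity))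

lemma Fk_eq {k s : ℝ} (hk : 0 < k) (hs : s < 1) : Fk k s = Real.exp (-(k / (1 - s))) := by
  have : ¬ ((1 - s) * k⁻¹ ≤ 0) := not_le.2 (mul_pos (by linarith) (by positivity))
  rw [Fk, expNegInvGlue, if_neg this]
  congr 2
  field_simp

lemma Fk_pos {k s : ℝ} (hk : 0 < k) (hs : s < 1) : 0 < Fk k s := by
  rw [Fk_eq hk hs]; positivity

lemma Fk_le_one {k s : ℝ} (hk : 0 < k) : Fk k s ≤ 1 := by
  rcases lt_or_ge s 1 with h | h
  · rw [Fk_eq hk h, Real.exp_le_one_iff]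
    have : 0 ≤ k / (1 - s) := div_nonneg hk.le (by linarith)
    linarith
  · rw [Fk_zero hk h]; norm_num

lemma Fk_hasDerivAt {k s : ℝ} (hk : 0 < k) (hs : s < 1) :
    HasDerivAt (Fk k) (-(k / (1 - s) ^ 2) * Fk k s) s := by
  have h0 : (1 - s) ≠ 0 := by linarith
  have h1 : HasDerivAt (fun s : ℝ => -(k / (1 - s))) (-(k / (1 - s) ^ 2)) s := by
    have h2 : HasDerivAt (fun s : ℝ => 1 - s) (-1) s := by
      simpa using (hasDerivAt_id s).const_sub 1
    have h3 : HasDerivAt (fun s : ℝ => -(k * (1 - s)⁻¹)) (-(k * (-(-1) / (1 - s) ^ 2))) s :=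
      ((h2.inv h0).const_mul k).neg
    simp only [div_eq_mul_inv]
    refine h3.congr_deriv ?_
    field_simp
  have h4 := h1.exp
  have h5 : Fk k =ᶠ[𝓝 s] fun s => Real.exp (-(k / (1 - s))) := by
    filter_upwards [Iio_mem_nhds hs] with t ht using Fk_eq hk ht
  refine (h4.congr_of_eventuallyEq h5).congr_deriv ?_
  rw [Fk_eq hk hs]; ring

lemma Fk_deriv {k s : ℝ} (hk : 0 < k) (hs : s < 1) :
    deriv (Fk k) s = -(k / (1 - s) ^ 2) * Fk k s := (Fk_hasDerivAt hk hs).deriv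

lemma Fk_deriv2 {k s : ℝ} (hk : 0 < k) (hs : s < 1) :
    deriv (deriv (Fk k)) s = (k ^ 2 / (1 - s) ^ 4 - 2 * k / (1 - s) ^ 3) * Fk k s := by
  have h0 : (1 - s) ≠ 0 := by linarith
  have h5 : deriv (Fk k) =ᶠ[𝓝 s] fun s => -(k / (1 - s) ^ 2) * Fk k s := by
    filter_upwards [Iio_mem_nhds hs] with t ht using Fk_deriv hk ht
  rw [h5.deriv_eq]
  have h2 : HasDerivAt (fun s : ℝ => (1 - s) ^ 2) (2 * (1 - s) * (-1)) s := by
    have h2 : HasDerivAt (fun s : ℝ => 1 - s) (-1) s := by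
      simpa using (hasDerivAt_id s).const_sub 1
    have h7 : HasDerivAt (fun s : ℝ => (1 - s) ^ 2) _ s := h2.fun_pow 2
    refine h7.congr_deriv ?_
    norm_num
  have h3 := (((h2.inv (pow_ne_zero 2 h0)).const_mul k).neg).mul (Fk_hasDerivAt hk hs)
  have h6 : HasDerivAt (fun s => -(k / (1 - s) ^ 2) * Fk k s) _ s := h3
  rw [h6.deriv]
  simp
  field_simp
  ring

lemma Fk_deriv_zero {k s : ℝ} (hk : 0 < k) (hs : 1 < s) : deriv (Fk k) s = 0 := by
  have h5 : Fk k =ᶠ[𝓝 s] fun _ => 0 := by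
    filter_upwards [Ioi_mem_nhds hs] with t ht using Fk_zero hk (le_of_lt ht)
  rw [h5.deriv_eq]; simp

lemma Fk_deriv2_zero {k s : ℝ} (hk : 0 < k) (hs : 1 < s) : deriv (deriv (Fk k)) s = 0 := by
  have h5 : deriv (Fk k) =ᶠ[𝓝 s] fun _ => 0 := by
    filter_upwards [Ioi_mem_nhds hs] with t ht using Fk_deriv_zero hk ht
  rw [h5.deriv_eq]; simp

lemma Fk_deriv_contDiff (k : ℝ) : ContDiff ℝ 2 (deriv (Fk k)) := by
  have := (Fk_contDiff (n := 3) k).iterate_deriv' 2 1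
  simpa using this

lemma Fk_le_deriv {s : ℝ} (hs : 0 ≤ s) : Fk 1 s ≤ - deriv (Fk 1) s := by
  have key : ∀ t ∈ Ico (0:ℝ) 1, Fk 1 t ≤ - deriv (Fk 1) t := by
    rintro t ⟨h0, h1⟩
    rw [Fk_deriv one_pos h1]
    have hp := Fk_pos one_pos h1
    have : 1 ≤ 1 / (1 - t) ^ 2 := by
      rw [le_div_iff₀ (by have : 0 < 1 - t := by linarith
                          positivity)]
      nlinarith
    nlinarith
  rcases lt_trichotomy s 1 with h | h | h
  · exact key s ⟨hs, h⟩
  · subst h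
    have c1 : ContinuousOn (Fk 1) (closure (Ico (0:ℝ) 1)) :=
      (Fk_contDiff (n := 0) 1).continuous.continuousOn
    have c2 : ContinuousOn (fun t => - deriv (Fk 1) t) (closure (Ico (0:ℝ) 1)) :=
      ((Fk_deriv_contDiff 1).continuous.neg).continuousOn
    have := le_on_closure key c1 c2
    exact this (by rw [closure_Ico (by norm_num)]; simp)
  · rw [Fk_zero one_pos h.le, Fk_deriv_zero one_pos h]; simp

/-- mean value weight -/
def psi (s : ℝ) : ℝ := -2 * deriv (Fk 1) s

lemma psi_continuous : Continuous psi := continuous_const.mul (Fk_deriv_contDiff 1).continuous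

lemma psi_ge {s : ℝ} (hs : 0 ≤ s) : 2 * Fk 1 s ≤ psi s := by
  have := Fk_le_deriv hs
  unfold psi; linarith

lemma psi_nonneg {s : ℝ} (hs : 0 ≤ s) : 0 ≤ psi s :=
  le_trans (by have := Fk_nonneg 1 s; linarith) (psi_ge hs)

lemma psi_zero {s : ℝ} (hs : 1 < s) : psi s = 0 := by
  unfold psi; rw [Fk_deriv_zero one_pos hs]; simp

lemma psi_pos {s : ℝ} (hs : 0 ≤ s) (h1 : s < 1) : 0 < psi s :=
  lt_of_lt_of_le (by have := Fk_pos one_pos h1; linarith) (psi_ge hs)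

/-- the radial test function of radius `ρ` around `x` -/
def phi {N : ℕ} (k : ℝ) (x : ES N) (ρ : ℝ) (z : ES N) : ℝ := Fk k (‖z - x‖ ^ 2 * (ρ ^ 2)⁻¹)

lemma phi_contDiff {N : ℕ} {n : ℕ∞} (k : ℝ) (x : ES N) (ρ : ℝ) : ContDiff ℝ n (phi k x ρ) :=
  (Fk_contDiff k).comp (contDiff_nsq x _)

lemma phi_tsupport {N : ℕ} {k : ℝ} (hk : 0 < k) (x : ES N) {ρ : ℝ} (hρ : 0 < ρ) :
    tsupport (phi k x ρ) ⊆ closedBall x ρ := by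
  refine closure_minimal ?_ isClosed_closedBall
  intro z hz
  by_contra h
  apply hz
  rw [mem_closedBall, dist_eq_norm, not_le] at h
  refine Fk_zero hk ?_
  rw [← div_eq_mul_inv, le_div_iff₀ (by positivity)]
  nlinarith [norm_nonneg (z - x)]

lemma phi_test {N : ℕ} {k : ℝ} (hk : 0 < k) (x : ES N) {ρ : ℝ} (hρ : 0 < ρ) {U : Set (ES N)}
    (h : closedBall x ρ ⊆ U) : IsTestFun U (phi k x ρ) :=
  ⟨phi_contDiff k x ρ, (isCompact_closedBall x ρ).of_isClosed_subset (isClosed_tsupport _)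
    (phi_tsupport hk x hρ), (phi_tsupport hk x hρ).trans h⟩

lemma phi_nonneg {N : ℕ} (k : ℝ) (x : ES N) (ρ : ℝ) (z : ES N) : 0 ≤ phi k x ρ z := Fk_nonneg _ _

lemma lap_phi {N : ℕ} (k : ℝ) (x : ES N) (ρ : ℝ) (z : ES N) :
    lap (phi k x ρ) z = 4 * (ρ ^ 2)⁻¹ ^ 2 * ‖z - x‖ ^ 2 *
        deriv (deriv (Fk k)) (‖z - x‖ ^ 2 * (ρ ^ 2)⁻¹)
        + 2 * N * (ρ ^ 2)⁻¹ * deriv (Fk k) (‖z - x‖ ^ 2 * (ρ ^ 2)⁻¹) :=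
  lap_radial (Fk_contDiff (n := 2) k) x _ z

/-- mean value kernel -/
def ker {N : ℕ} (x : ES N) (ρ : ℝ) (z : ES N) : ℝ :=
  (ρ ^ N)⁻¹ * psi (‖z - x‖ ^ 2 * (ρ ^ 2)⁻¹)

lemma ker_nonneg {N : ℕ} (x : ES N) {ρ : ℝ} (hρ : 0 < ρ) (z : ES N) : 0 ≤ ker x ρ z :=
  mul_nonneg (by positivity) (psi_nonneg (by positivity))

lemma ker_continuous {N : ℕ} (x : ES N) (ρ : ℝ) : Continuous (ker x ρ) :=
  continuous_const.mul (psi_continuous.comp (by fun_prop))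

lemma ker_zero {N : ℕ} (x : ES N) {ρ : ℝ} (hρ : 0 < ρ) {z : ES N} (hz : z ∉ closedBall x ρ) :
    ker x ρ z = 0 := by
  rw [mem_closedBall, dist_eq_norm, not_le] at hz
  rw [ker, psi_zero, mul_zero]
  rw [← div_eq_mul_inv, lt_div_iff₀ (by positivity)]
  nlinarith [norm_nonneg (z - x)]

lemma ker_pos {N : ℕ} (x : ES N) {ρ : ℝ} (hρ : 0 < ρ) {z : ES N} (hz : z ∈ ball x ρ) :
    0 < ker x ρ z := by
  rw [mem_ball, dist_eq_norm] at hz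
  refine mul_pos (by positivity) (psi_pos (by positivity) ?_)
  rw [← div_eq_mul_inv, div_lt_iff₀ (by positivity)]
  nlinarith [norm_nonneg (z - x)]

lemma ker_support {N : ℕ} (x : ES N) {ρ : ℝ} (hρ : 0 < ρ) : HasCompactSupport (ker x ρ) :=
  HasCompactSupport.intro (isCompact_closedBall x ρ) fun _ hz => ker_zero x hρ hz

/-- the total mass of the kernel -/
def cpsi (N : ℕ) : ℝ := ∫ z : ES N, psi (‖z‖ ^ 2)

lemma ker_integral {N : ℕ} (x : ES N) {ρ : ℝ} (hρ : 0 < ρ) : ∫ z, ker x ρ z = cpsi N := by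
  unfold ker cpsi
  rw [integral_sub_right_eq_self (fun z : ES N => (ρ ^ N)⁻¹ * psi (‖z‖ ^ 2 * (ρ ^ 2)⁻¹)) x,
    integral_const_mul]
  have h := Measure.integral_comp_inv_smul_of_nonneg (volume : Measure (ES N))
    (fun z : ES N => psi (‖z‖ ^ 2)) (R := ρ) hρ.le
  have h2 : ∀ z : ES N, ‖ρ⁻¹ • z‖ ^ 2 = ‖z‖ ^ 2 * (ρ ^ 2)⁻¹ := by
    intro z
    rw [norm_smul, norm_inv, Real.norm_eq_abs, abs_of_pos hρ, mul_pow, inv_pow, mul_comm]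
  simp_rw [h2] at h
  rw [h]
  simp
  field_simp

lemma cpsi_pos (N : ℕ) : 0 < cpsi N := by
  rw [← ker_integral (0 : ES N) one_pos]
  exact (ker_continuous 0 1).integral_pos_of_hasCompactSupport_nonneg_nonzero
    (ker_support 0 one_pos) (fun z => ker_nonneg 0 one_pos z)
    (ker_pos (0 : ES N) one_pos (mem_ball_self one_pos)).ne'

lemma ker_hasDerivAt {N : ℕ} (x z : ES N) {ρ : ℝ} (hρ : 0 < ρ) :
    HasDerivAt (fun ρ => ker x ρ z) (ρ * (ρ ^ N)⁻¹ * lap (phi 1 x ρ) z) ρ := by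
  have h1 : HasDerivAt (fun ρ : ℝ => (ρ ^ N)⁻¹) (-(N * ρ ^ (N - 1)) / (ρ ^ N) ^ 2) ρ :=
    (hasDerivAt_pow N ρ).inv (by positivity)
  have h2 : HasDerivAt (fun ρ : ℝ => ‖z - x‖ ^ 2 * (ρ ^ 2)⁻¹)
      (‖z - x‖ ^ 2 * (-(2 * ρ) / (ρ ^ 2) ^ 2)) ρ := by
    have := ((hasDerivAt_pow 2 ρ).inv (by positivity)).const_mul (‖z - x‖ ^ 2)
    simpa using this
  have h3 : HasDerivAt psi (-2 * deriv (deriv (Fk 1)) (‖z - x‖ ^ 2 * (ρ ^ 2)⁻¹))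
      (‖z - x‖ ^ 2 * (ρ ^ 2)⁻¹) :=
    (((Fk_deriv_contDiff 1).differentiable (by norm_num) _).hasDerivAt).const_mul (-2)
  have h4 := h1.mul (h3.comp ρ h2)
  refine h4.congr_deriv ?_
  rw [lap_phi]
  simp only [Function.comp, psi]
  have hN : (N:ℝ) * ρ ^ (N - 1) * ρ = N * ρ ^ N := by
    cases N with
    | zero => simp
    | succ n => simp [pow_succ]; ring
  have hN' : (N:ℝ) * ρ ^ (N - 1) = N * ρ ^ N / ρ := by
    rw [← hN]; field_simp
  rw [hN']
  field_simp
  ring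

lemma lap_phi_bound (N : ℕ) : ∃ C : ℝ, 0 ≤ C ∧ ∀ (x z : ES N) (ρ : ℝ), 0 < ρ →
    |lap (phi 1 x ρ) z| ≤ C * (ρ ^ 2)⁻¹ := by
  have hcont : Continuous fun s : ℝ => 4 * s * deriv (deriv (Fk 1)) s + 2 * N * deriv (Fk 1) s := by
    have h1 : Continuous (deriv (deriv (Fk 1))) := 
      (Fk_deriv_contDiff 1).continuous_deriv (by norm_num)
    have h2 := (Fk_deriv_contDiff 1).continuous
    fun_prop
  obtain ⟨C, hC⟩ := (isCompact_Icc (a := (0:ℝ)) (b := 1)).exists_bound_of_continuousOn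
    hcont.continuousOn
  refine ⟨max C 0, le_max_right _ _, fun x z ρ hρ => ?_⟩
  rw [lap_phi]
  set s := ‖z - x‖ ^ 2 * (ρ ^ 2)⁻¹ with hs
  have hs0 : 0 ≤ s := by positivity
  have e : 4 * (ρ ^ 2)⁻¹ ^ 2 * ‖z - x‖ ^ 2 * deriv (deriv (Fk 1)) s
      + 2 * N * (ρ ^ 2)⁻¹ * deriv (Fk 1) s
      = (4 * s * deriv (deriv (Fk 1)) s + 2 * N * deriv (Fk 1) s) * (ρ ^ 2)⁻¹ := by
    rw [hs]; ring
  rw [e, abs_mul, abs_of_pos (a := (ρ ^ 2)⁻¹) (by positivity)]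
  refine mul_le_mul_of_nonneg_right ?_ (by positivity)
  rcases le_or_gt s 1 with h | h
  · exact (hC s ⟨hs0, h⟩).trans (le_max_left _ _)
  · rw [Fk_deriv_zero one_pos h, Fk_deriv2_zero one_pos h]; simp

lemma mean_hasDerivAt {N : ℕ} (x : ES N) {u : ES N → ℝ} (hu : Integrable u) {ρ : ℝ} (hρ : 0 < ρ) :
    HasDerivAt (fun ρ => ∫ z, u z * ker x ρ z)
      (ρ * (ρ ^ N)⁻¹ * ∫ z, u z * lap (phi 1 x ρ) z) ρ := by
  obtain ⟨C, hC0, hC⟩ := lap_phi_bound N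
  have hlc : ∀ r, Continuous (lap (phi 1 x r)) := fun r => lap_continuous (phi_contDiff (n := 2) 1 x r)
  have hmeas : ∀ r, AEStronglyMeasurable (fun z => u z * ker x r z) volume := fun r =>
    hu.aestronglyMeasurable.mul (ker_continuous x r).aestronglyMeasurable
  have hbd : ∃ B, ∀ z, ‖ker x ρ z‖ ≤ B := (ker_support x hρ).exists_bound_of_continuous
    (ker_continuous x ρ)
  obtain ⟨B, hB⟩ := hbd
  set M := (2 * ρ) * ((ρ / 2) ^ N)⁻¹ * (C * ((ρ / 2) ^ 2)⁻¹) with hM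
  have h := hasDerivAt_integral_of_dominated_loc_of_deriv_le (μ := (volume : Measure (ES N)))
    (F := fun ρ z => u z * ker x ρ z)
    (F' := fun ρ z => u z * (ρ * (ρ ^ N)⁻¹ * lap (phi 1 x ρ) z))
    (s := Ioo (ρ / 2) (2 * ρ)) (x₀ := ρ)
    (bound := fun z => ‖u z‖ * M) (Ioo_mem_nhds (by linarith) (by linarith))
    (Eventually.of_forall hmeas)
    (hu.mul_bdd (c := B) (ker_continuous x ρ).aestronglyMeasurable (Eventually.of_forall hB))
    (hu.aestronglyMeasurable.mul (continuous_const.mul (hlc ρ)).aestronglyMeasurable)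
    (Eventually.of_forall fun z r hr => by
      have hr0 : 0 < r := by linarith [hr.1]
      rw [norm_mul]
      refine mul_le_mul_of_nonneg_left ?_ (norm_nonneg _)
      rw [norm_mul, Real.norm_eq_abs, Real.norm_eq_abs, abs_of_pos (by positivity)]
      have h1 := hC x z r hr0
      have h2 : (r ^ N)⁻¹ ≤ ((ρ / 2) ^ N)⁻¹ := by
        have := hr.1.le
        gcongr
      have h3 : (r ^ 2)⁻¹ ≤ ((ρ / 2) ^ 2)⁻¹ := by
        have := hr.1.le
        gcongr
      have h4 := hr.2.le
      calc r * (r ^ N)⁻¹ * |lap (phi 1 x r) z| ≤ r * (r ^ N)⁻¹ * (C * (r ^ 2)⁻¹) := by gcongr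
        _ ≤ M := by rw [hM]; gcongr)
    (hu.norm.mul_const M)
    (Eventually.of_forall fun z r hr => by
      have hr0 : 0 < r := by linarith [hr.1]
      exact (ker_hasDerivAt x z hr0).const_mul (u z))
  refine h.2.congr_deriv ?_
  rw [← integral_const_mul]
  congr 1; ext z; ring

end

section

/-- weak subharmonicity -/
def WSub {N : ℕ} (U : Set (ES N)) (w : ES N → ℝ) : Prop :=
  ContinuousOn w U ∧ ∀ φ, IsTestFun U φ → (∀ x, 0 ≤ φ x) → 0 ≤ ∫ x, w x * lap φ x

/-- weak supersolutions of `Δ - V` -/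
def WSup {N : ℕ} (U : Set (ES N)) (V w : ES N → ℝ) : Prop :=
  ContinuousOn w U ∧ ∀ φ, IsTestFun U φ → (∀ x, 0 ≤ φ x) →
    ∫ x, w x * lap φ x ≤ ∫ x, V x * w x * φ x

/-- weak solutions of `Δ - V` -/
def WSol {N : ℕ} (U : Set (ES N)) (V w : ES N → ℝ) : Prop :=
  ContinuousOn w U ∧ ∀ φ, IsTestFun U φ → ∫ x, w x * lap φ x = ∫ x, V x * w x * φ x

lemma IsTestFun.mono {N : ℕ} {U U' : Set (ES N)} {φ : ES N → ℝ} (h : IsTestFun U φ) (hU : U ⊆ U') :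
    IsTestFun U' φ := ⟨h.1, h.2.1, h.2.2.trans hU⟩

lemma WSol.mono {N : ℕ} {U U' : Set (ES N)} {V w : ES N → ℝ} (h : WSol U V w) (hU : U' ⊆ U) :
    WSol U' V w := ⟨h.1.mono hU, fun φ hφ => h.2 φ (hφ.mono hU)⟩

lemma WSub.mono {N : ℕ} {U U' : Set (ES N)} {w : ES N → ℝ} (h : WSub U w) (hU : U' ⊆ U) :
    WSub U' w := ⟨h.1.mono hU, fun φ hφ => h.2 φ (hφ.mono hU)⟩

lemma WSup.mono {N : ℕ} {U U' : Set (ES N)} {V w : ES N → ℝ} (h : WSup U V w) (hU : U' ⊆ U) :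
    WSup U' V w := ⟨h.1.mono hU, fun φ hφ => h.2 φ (hφ.mono hU)⟩

lemma WSol.sup {N : ℕ} {U : Set (ES N)} {V w : ES N → ℝ} (h : WSol U V w) : WSup U V w :=
  ⟨h.1, fun φ hφ _ => (h.2 φ hφ).le⟩

lemma IsTestFun.zero_out {N : ℕ} {U : Set (ES N)} {φ : ES N → ℝ} (h : IsTestFun U φ) {x : ES N}
    (hx : x ∉ U) : φ x = 0 := image_eq_zero_of_notMem_tsupport fun h' => hx (h.2.2 h')

lemma IsTestFun.lap_out {N : ℕ} {U : Set (ES N)} {φ : ES N → ℝ} (h : IsTestFun U φ) {x : ES N}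
    (hx : x ∉ U) : lap φ x = 0 := lap_eq_zero fun h' => hx (h.2.2 h')

lemma WSol.sub {N : ℕ} {U : Set (ES N)} {V w : ES N → ℝ} (h : WSol U V w)
    (hV : ∀ x ∈ U, 0 ≤ V x) (hw : ∀ x ∈ U, 0 ≤ w x) : WSub U w :=
  ⟨h.1, fun φ hφ h0 => by
    rw [h.2 φ hφ]
    refine integral_nonneg fun x => ?_
    by_cases hx : x ∈ U
    · exact mul_nonneg (mul_nonneg (hV x hx) (hw x hx)) (h0 x)
    · simp [hφ.zero_out hx]⟩

lemma mean_tendsto {N : ℕ} {x : ES N} {u : ES N → ℝ} (hu : Integrable u) (hc : ContinuousAt u x) :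
    Tendsto (fun ρ => ∫ z, u z * ker x ρ z) (𝓝[>] 0) (𝓝 (cpsi N * u x)) := by
  rw [Metric.tendsto_nhds]
  intro ε hε
  have hcp := cpsi_pos N
  obtain ⟨d, hd, hd'⟩ := Metric.continuousAt_iff.1 hc (ε / (2 * cpsi N)) (by positivity)
  filter_upwards [Ioo_mem_nhdsGT hd] with ρ hρ
  have hρ0 : 0 < ρ := hρ.1
  have hki : Integrable (ker x ρ) := (ker_continuous x ρ).integrable_of_hasCompactSupport
    (ker_support x hρ0)
  obtain ⟨B, hB⟩ := (ker_support x hρ0).exists_bound_of_continuous (ker_continuous x ρ)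
  have hui : Integrable (fun z => u z * ker x ρ z) :=
    hu.mul_bdd (c := B) (ker_continuous x ρ).aestronglyMeasurable (Eventually.of_forall hB)
  rw [Real.dist_eq, ← ker_integral x hρ0, mul_comm, ← integral_const_mul, ← integral_sub hui
    (hki.const_mul _)]
  have h1 : ∀ z, ‖u z * ker x ρ z - u x * ker x ρ z‖ ≤ (ε / (2 * cpsi N)) * ker x ρ z := by
    intro z
    rw [← sub_mul, norm_mul, Real.norm_eq_abs (ker x ρ z), abs_of_nonneg (ker_nonneg x hρ0 z)]
    by_cases hz : z ∈ closedBall x ρ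
    · refine mul_le_mul_of_nonneg_right ?_ (ker_nonneg x hρ0 z)
      exact (hd' (lt_of_le_of_lt hz hρ.2)).le
    · simp [ker_zero x hρ0 hz]
  have h2 := norm_integral_le_of_norm_le (hki.const_mul (ε / (2 * cpsi N)))
    (Eventually.of_forall h1)
  rw [integral_const_mul, ker_integral x hρ0, Real.norm_eq_abs] at h2
  refine lt_of_le_of_lt h2 ?_
  field_simp
  norm_num

lemma integral_indicator_mul {N : ℕ} {S : Set (ES N)} {u f : ES N → ℝ}
    (hf : ∀ z, z ∉ S → f z = 0) : ∫ z, (S.indicator u z) * f z = ∫ z, u z * f z := by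
  congr 1; ext z
  by_cases hz : z ∈ S
  · simp [hz]
  · simp [hz, hf z hz]

lemma lap_phi_zero {N : ℕ} {k : ℝ} (hk : 0 < k) (x : ES N) {ρ : ℝ} (hρ : 0 < ρ) {z : ES N}
    (hz : z ∉ closedBall x ρ) : lap (phi k x ρ) z = 0 :=
  lap_eq_zero fun h => hz (phi_tsupport hk x hρ h)

lemma phi_zero {N : ℕ} {k : ℝ} (hk : 0 < k) (x : ES N) {ρ : ℝ} (hρ : 0 < ρ) {z : ES N}
    (hz : z ∉ closedBall x ρ) : phi k x ρ z = 0 :=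
  image_eq_zero_of_notMem_tsupport fun h => hz (phi_tsupport hk x hρ h)

section mv
variable {N : ℕ} {x : ES N} {R : ℝ} {u : ES N → ℝ}

lemma indicator_integrable (hu : ContinuousOn u (closedBall x R)) :
    Integrable ((closedBall x R).indicator u) :=
  (hu.integrableOn_compact (isCompact_closedBall x R)).integrable_indicator
    isClosed_closedBall.measurableSet

lemma indicator_continuousAt (hR : 0 < R) (hu : ContinuousOn u (closedBall x R)) :
    ContinuousAt ((closedBall x R).indicator u) x := by
  refine ((hu.continuousAt (closedBall_mem_nhds x hR))).congr ?_
  filter_upwards [closedBall_mem_nhds x hR] with z hz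
  simp only [indicator_of_mem hz]

lemma ker_eq_indicator {ρ : ℝ} (hρ : 0 < ρ) (hρR : ρ ≤ R) :
    ∫ z, (closedBall x R).indicator u z * ker x ρ z = ∫ z, u z * ker x ρ z :=
  integral_indicator_mul fun _ hz => ker_zero x hρ fun h => hz (closedBall_subset_closedBall hρR h)

lemma mean_hasDerivAt' (hu : ContinuousOn u (closedBall x R)) {ρ : ℝ} (hρ : 0 < ρ) (hρR : ρ ≤ R) :
    HasDerivAt (fun ρ => ∫ z, (closedBall x R).indicator u z * ker x ρ z)
      (ρ * (ρ ^ N)⁻¹ * ∫ z, u z * lap (phi 1 x ρ) z) ρ := by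
  have := mean_hasDerivAt x (indicator_integrable hu) hρ
  rwa [integral_indicator_mul fun _ hz =>
    lap_phi_zero one_pos x hρ fun h => hz (closedBall_subset_closedBall hρR h)] at this

/-- Sub mean value property -/
lemma subMean (hR : 0 < R) {U : Set (ES N)} (hU : closedBall x R ⊆ U) (hu : WSub U u) :
    cpsi N * u x ≤ ∫ z, u z * ker x R z := by
  have hc := hu.1.mono hU
  set A : ℝ → ℝ := fun ρ => ∫ z, (closedBall x R).indicator u z * ker x ρ z with hA
  have hmono : MonotoneOn A (Ioc 0 R) := by
    refine monotoneOn_of_deriv_nonneg (convex_Ioc 0 R) ?_ ?_ ?_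
    · intro ρ hρ
      exact (mean_hasDerivAt' hc hρ.1 hρ.2).continuousAt.continuousWithinAt
    · intro ρ hρ
      rw [interior_Ioc] at hρ
      exact (mean_hasDerivAt' hc hρ.1 hρ.2.le).differentiableAt.differentiableWithinAt
    · intro ρ hρ
      rw [interior_Ioc] at hρ
      rw [(mean_hasDerivAt' hc hρ.1 hρ.2.le).deriv]
      have h0 := hρ.1
      refine mul_nonneg (by positivity) (hu.2 _ (phi_test one_pos x h0
        ((closedBall_subset_closedBall hρ.2.le).trans hU)) (phi_nonneg 1 x ρ))
  have ht := mean_tendsto (indicator_integrable hc) (indicator_continuousAt hR hc)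
  rw [indicator_of_mem (mem_closedBall_self hR.le)] at ht
  rw [← ker_eq_indicator hR le_rfl]
  refine le_of_tendsto ht ?_
  filter_upwards [Ioc_mem_nhdsGT hR] with ρ hρ
  exact hmono hρ ⟨hR, le_rfl⟩ hρ.2

/-- weak Harnack inequality, integral form -/
lemma supMean (hR : 0 < R) {U : Set (ES N)} (hU : closedBall x R ⊆ U) {V : ES N → ℝ}
    (hu : WSup U V u) (hu0 : ∀ z ∈ closedBall x R, 0 ≤ u z) {A : ℝ}
    (hV : ∀ z ∈ closedBall x R, 0 ≤ V z ∧ V z * R ^ 2 ≤ A) :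
    ∫ z, u z * ker x R z ≤ Real.exp (A / 4) * (cpsi N * u x) := by
  have hc := hu.1.mono hU
  have hA0 : 0 ≤ A := by
    have := hV x (mem_closedBall_self hR.le)
    have h2 := this.1
    have : 0 ≤ V x * R ^ 2 := by positivity
    linarith [(hV x (mem_closedBall_self hR.le)).2]
  set F : ℝ → ℝ := fun ρ => ∫ z, (closedBall x R).indicator u z * ker x ρ z with hF
  set E : ℝ → ℝ := fun ρ => Real.exp (-(A / (4 * R ^ 2) * ρ ^ 2)) with hE
  have hEd : ∀ ρ, HasDerivAt E (-(A / (2 * R ^ 2) * ρ) * E ρ) ρ := by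
    intro ρ
    have h1 : HasDerivAt (fun ρ : ℝ => -(A / (4 * R ^ 2) * ρ ^ 2)) _ ρ :=
      ((hasDerivAt_pow 2 ρ).const_mul (A / (4 * R ^ 2))).neg
    refine h1.exp.congr_deriv ?_
    simp only [hE]
    field_simp
    ring
  have hGd : ∀ ρ, 0 < ρ → ρ ≤ R → HasDerivAt (fun ρ => E ρ * F ρ)
      (-(A / (2 * R ^ 2) * ρ) * E ρ * F ρ + E ρ * (ρ * (ρ ^ N)⁻¹ * ∫ z, u z * lap (phi 1 x ρ) z)) ρ :=
    fun ρ h1 h2 => (hEd ρ).mul (mean_hasDerivAt' hc h1 h2)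
  have hanti : AntitoneOn (fun ρ => E ρ * F ρ) (Ioc 0 R) := by
    refine antitoneOn_of_deriv_nonpos (convex_Ioc 0 R) ?_ ?_ ?_
    · intro ρ hρ
      exact (hGd ρ hρ.1 hρ.2).continuousAt.continuousWithinAt
    · intro ρ hρ
      rw [interior_Ioc] at hρ
      exact (hGd ρ hρ.1 hρ.2.le).differentiableAt.differentiableWithinAt
    · intro ρ hρ
      rw [interior_Ioc] at hρ
      rw [(hGd ρ hρ.1 hρ.2.le).deriv]
      have h0 : 0 < ρ := hρ.1
      have hsub : closedBall x ρ ⊆ closedBall x R := closedBall_subset_closedBall hρ.2.le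
      have hkey : (ρ ^ N)⁻¹ * ∫ z, u z * lap (phi 1 x ρ) z ≤ A / (2 * R ^ 2) * F ρ := by
        have h1 := hu.2 _ (phi_test one_pos x h0 (hsub.trans hU)) (phi_nonneg 1 x ρ)
        have hintg : Integrable fun z => (closedBall x R).indicator u z * ker x ρ z := by
          obtain ⟨B, hB⟩ := (ker_support x h0).exists_bound_of_continuous (ker_continuous x ρ)
          exact (indicator_integrable hc).mul_bdd (c := B) (ker_continuous x ρ).aestronglyMeasurable
            (Eventually.of_forall hB)
        have h2 : ∫ z, V z * u z * phi 1 x ρ z ≤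
            ∫ z, (ρ ^ N * (A / (2 * R ^ 2))) * ((closedBall x R).indicator u z * ker x ρ z) := by
          refine integral_mono_of_nonneg (Eventually.of_forall fun z => ?_)
            (hintg.const_mul _) (Eventually.of_forall fun z => ?_)
          · by_cases hz : z ∈ closedBall x ρ
            · exact mul_nonneg (mul_nonneg (hV z (hsub hz)).1 (hu0 z (hsub hz))) (phi_nonneg 1 x ρ z)
            · simp [phi_zero one_pos x h0 hz]
          · by_cases hz : z ∈ closedBall x ρ
            · simp only [indicator_of_mem (hsub hz)]
              have hv := hV z (hsub hz)
              have hu := hu0 z (hsub hz)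
              have hp := phi_nonneg 1 x ρ z
              have hpk : 2 * phi 1 x ρ z ≤ ρ ^ N * ker x ρ z := by
                have := psi_ge (s := ‖z - x‖ ^ 2 * (ρ ^ 2)⁻¹) (by positivity)
                rw [ker, ← mul_assoc, mul_inv_cancel₀ (by positivity), one_mul]
                exact this
              have hv2 : V z ≤ A / R ^ 2 := by
                rw [le_div_iff₀ (by positivity)]; exact hv.2
              calc V z * u z * phi 1 x ρ z ≤ A / R ^ 2 * u z * phi 1 x ρ z := by gcongr
                _ = A / (2 * R ^ 2) * u z * (2 * phi 1 x ρ z) := by field_simp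
                _ ≤ A / (2 * R ^ 2) * u z * (ρ ^ N * ker x ρ z) := by gcongr
                _ = _ := by ring
            · simp [phi_zero one_pos x h0 hz, ker_zero x h0 hz]
        rw [integral_const_mul] at h2
        calc (ρ ^ N)⁻¹ * ∫ z, u z * lap (phi 1 x ρ) z
            ≤ (ρ ^ N)⁻¹ * ((ρ ^ N * (A / (2 * R ^ 2))) * F ρ) := by
              refine mul_le_mul_of_nonneg_left (h1.trans h2) (by positivity)
          _ = _ := by field_simp
      have hEp : 0 < E ρ := Real.exp_pos _
      have := mul_le_mul_of_nonneg_left hkey (mul_pos hEp h0).le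
      nlinarith
  have ht := mean_tendsto (indicator_integrable hc) (indicator_continuousAt hR hc)
  rw [indicator_of_mem (mem_closedBall_self hR.le)] at ht
  have hE0 : Tendsto E (𝓝[>] 0) (𝓝 1) := by
    have : Tendsto E (𝓝 0) (𝓝 (E 0)) := (hEd 0).continuousAt
    have e0 : E 0 = 1 := by simp [hE]
    rw [e0] at this
    exact this.mono_left nhdsWithin_le_nhds
  have hEF := hE0.mul ht
  rw [one_mul] at hEF
  have hle : E R * F R ≤ cpsi N * u x := by
    refine ge_of_tendsto hEF ?_
    filter_upwards [Ioc_mem_nhdsGT hR] with ρ hρ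
    exact hanti hρ ⟨hR, le_rfl⟩ hρ.2
  rw [← ker_eq_indicator hR le_rfl]
  have hER : E R = Real.exp (-(A / 4)) := by
    simp only [hE]; congr 2; field_simp
  rw [hER, Real.exp_neg, inv_mul_le_iff₀ (Real.exp_pos _)] at hle
  exact hle

end mv

end

section

lemma psi_bdd : ∃ B : ℝ, 0 < B ∧ ∀ s, 0 ≤ s → psi s ≤ B := by
  obtain ⟨C, hC⟩ := (isCompact_Icc (a := (0:ℝ)) (b := 1)).exists_bound_of_continuousOn
    psi_continuous.continuousOn
  refine ⟨max C 1, by positivity, fun s hs => ?_⟩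
  rcases le_or_gt s 1 with h | h
  · exact ((le_abs_self _).trans (hC s ⟨hs, h⟩)).trans (le_max_left _ _)
  · rw [psi_zero h]; positivity

lemma psi_lower : ∃ b : ℝ, 0 < b ∧ ∀ s, 0 ≤ s → s ≤ 9 / 16 → b ≤ psi s := by
  obtain ⟨s, hs, hm⟩ := (isCompact_Icc (a := (0:ℝ)) (b := 9 / 16)).exists_isMinOn
    ⟨0, by norm_num⟩ psi_continuous.continuousOn
  exact ⟨psi s, psi_pos hs.1 (by linarith [hs.2]), fun t h0 h1 => hm ⟨h0, h1⟩⟩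

lemma ker_upper : ∃ B : ℝ, 0 < B ∧ ∀ (N : ℕ) (x z : ES N) (R : ℝ), 0 < R →
    ker x R z ≤ (R ^ N)⁻¹ * B := by
  obtain ⟨B, hB, h⟩ := psi_bdd
  refine ⟨B, hB, fun N x z R hR => ?_⟩
  exact mul_le_mul_of_nonneg_left (h _ (by positivity)) (by positivity)

lemma ker_lower : ∃ b : ℝ, 0 < b ∧ ∀ (N : ℕ) (x z : ES N) (R : ℝ), 0 < R →
    z ∈ closedBall x (3 / 4 * R) → (R ^ N)⁻¹ * b ≤ ker x R z := by
  obtain ⟨B, hB, h⟩ := psi_lower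
  refine ⟨B, hB, fun N x z R hR hz => ?_⟩
  refine mul_le_mul_of_nonneg_left (h _ (by positivity) ?_) (by positivity)
  rw [mem_closedBall, dist_eq_norm] at hz
  rw [← div_eq_mul_inv, div_le_iff₀ (by positivity)]
  nlinarith [norm_nonneg (z - x)]

lemma integrable_ker {N : ℕ} {x : ES N} {R : ℝ} {u : ES N → ℝ} (hR : 0 < R)
    (hc : ContinuousOn u (closedBall x R)) : Integrable fun z => u z * ker x R z := by
  obtain ⟨B, hB⟩ := (ker_support x hR).exists_bound_of_continuous (ker_continuous x R)
  have := (indicator_integrable hc).mul_bdd (c := B) (ker_continuous x R).aestronglyMeasurable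
            (Eventually.of_forall hB)
  refine this.congr (Eventually.of_forall fun z => ?_)
  by_cases hz : z ∈ closedBall x R
  · simp [hz]
  · simp [hz, ker_zero x hR hz]

lemma weakHarnack (N : ℕ) (A τ : ℝ) (hτ : 0 < τ) : ∃ c : ℝ, 0 < c ∧ c ≤ 1 ∧
    ∀ (U : Set (ES N)) (V u : ES N → ℝ) (x x' : ES N) (R M : ℝ), 0 < R → closedBall x R ⊆ U →
      WSup U V u → (∀ z ∈ closedBall x R, 0 ≤ u z) →
      (∀ z ∈ closedBall x R, 0 ≤ V z ∧ V z * R ^ 2 ≤ A) →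
      ball x' (τ * R) ⊆ ball x (R / 2) → 0 ≤ M → (∀ z ∈ ball x' (τ * R), M ≤ u z) →
      c * M ≤ u x := by
  obtain ⟨b, hb, hker⟩ := ker_lower
  have hcp := cpsi_pos N
  set v := volume.real (ball (0 : ES N) 1) with hv
  have hv0 : 0 < v := by
    rw [hv, measureReal_def]
    exact ENNReal.toReal_pos (measure_ball_pos volume _ one_pos).ne' measure_ball_lt_top.ne
  refine ⟨min 1 (b * τ ^ N * v / (Real.exp (A / 4) * cpsi N)), by positivity, min_le_left _ _, ?_⟩
  intro U V u x x' R M hR hU hu hu0 hV hsub hM hMu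
  have hmain := supMean hR hU hu hu0 hV
  have hc := hu.1.mono hU
  have hτR : 0 < τ * R := by positivity
  have hvol : volume.real (ball x' (τ * R)) = (τ * R) ^ N * v := by
    rw [hv, measureReal_def, measureReal_def, Measure.addHaar_ball_of_pos _ _ hτR,
      ENNReal.toReal_mul, ENNReal.toReal_ofReal (by positivity)]
    simp
  have hlow : (R ^ N)⁻¹ * b * M * ((τ * R) ^ N * v) ≤ ∫ z, u z * ker x R z := by
    have h1 : ∫ z, (ball x' (τ * R)).indicator (fun _ => (R ^ N)⁻¹ * b * M) z
        = (R ^ N)⁻¹ * b * M * ((τ * R) ^ N * v) := by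
      rw [integral_indicator isOpen_ball.measurableSet, setIntegral_const, smul_eq_mul, hvol]
      ring
    rw [← h1]
    refine integral_mono_of_nonneg (Eventually.of_forall fun z => ?_) (integrable_ker hR hc)
      (Eventually.of_forall fun z => ?_)
    · exact indicator_nonneg (fun _ _ => by positivity) z
    · by_cases hz : z ∈ ball x' (τ * R)
      · simp only [indicator_of_mem hz]
        have hz2 := hsub hz
        have hk := hker N x z R hR (by
          rw [mem_ball] at hz2; rw [mem_closedBall]; linarith)
        have h3 := hMu z hz
        calc (R ^ N)⁻¹ * b * M ≤ ker x R z * u z := by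
              have := ker_nonneg x hR z
              gcongr
          _ = _ := by ring
      · simp only [indicator_of_notMem hz]
        by_cases hz' : z ∈ closedBall x R
        · exact mul_nonneg (hu0 z hz') (ker_nonneg x hR z)
        · simp [ker_zero x hR hz']
  have hall := hlow.trans hmain
  have hE := Real.exp_pos (A / 4)
  calc min 1 (b * τ ^ N * v / (Real.exp (A / 4) * cpsi N)) * M
      ≤ (b * τ ^ N * v / (Real.exp (A / 4) * cpsi N)) * M := by
        gcongr; exact min_le_right _ _
    _ = ((R ^ N)⁻¹ * b * M * ((τ * R) ^ N * v)) / (Real.exp (A / 4) * cpsi N) := by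
        rw [mul_pow]; field_simp
    _ ≤ u x := by
        rw [div_le_iff₀ (by positivity)]; linarith

lemma harnackBall (N : ℕ) (A : ℝ) : ∃ C : ℝ, 1 ≤ C ∧
    ∀ (U : Set (ES N)) (V u : ES N → ℝ) (x x' : ES N) (R : ℝ), 0 < R → closedBall x R ⊆ U →
      WSup U V u → WSub U u → (∀ z ∈ closedBall x R, 0 ≤ u z) →
      (∀ z ∈ closedBall x R, 0 ≤ V z ∧ V z * R ^ 2 ≤ A) →
      x' ∈ closedBall x (R / 4) → u x' ≤ C * u x := by
  obtain ⟨b, hb, hker⟩ := ker_lower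
  obtain ⟨B, hB, hkerB⟩ := ker_upper
  have hcp := cpsi_pos N
  have hE := Real.exp_pos (A / 4)
  refine ⟨max 1 (2 ^ N * B / b * Real.exp (A / 4)), le_max_left _ _, ?_⟩
  intro U V u x x' R hR hU hu hus hu0 hV hx'
  have hmain := supMean hR hU hu hu0 hV
  have hc := hu.1.mono hU
  have hux := hu0 x (mem_closedBall_self hR.le)
  have hsub2 : closedBall x' (R / 2) ⊆ closedBall x (3 / 4 * R) := by
    refine closedBall_subset_closedBall' ?_
    rw [mem_closedBall] at hx'; linarith
  have hsub : closedBall x' (R / 2) ⊆ closedBall x R := by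
    refine hsub2.trans (closedBall_subset_closedBall (by linarith))
  have h1 := subMean (half_pos hR) (hsub.trans hU) hus
  have h2 : ∫ z, u z * ker x' (R / 2) z ≤ ∫ z, (2 ^ N * B / b) * (u z * ker x R z) := by
    refine integral_mono (integrable_ker (half_pos hR) (hc.mono hsub))
      ((integrable_ker hR hc).const_mul _) fun z => ?_
    simp only
    by_cases hz : z ∈ closedBall x' (R / 2)
    · have k1 := hkerB N x' z (R / 2) (half_pos hR)
      have k2 := hker N x z R hR (hsub2 hz)
      have k3 := hu0 z (hsub hz)
      have k4 : ((R / 2) ^ N)⁻¹ * B = (2 ^ N * B / b) * ((R ^ N)⁻¹ * b) := by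
        rw [div_pow]; field_simp
      calc u z * ker x' (R / 2) z ≤ u z * ((2 ^ N * B / b) * ker x R z) := by
            refine mul_le_mul_of_nonneg_left ?_ k3
            rw [k4] at k1
            exact k1.trans (by gcongr)
        _ = _ := by ring
    · rw [ker_zero x' (half_pos hR) hz]
      by_cases hz' : z ∈ closedBall x R
      · have := mul_nonneg (hu0 z hz') (ker_nonneg x hR z)
        simp only [mul_zero]; positivity
      · simp [ker_zero x hR hz']
  rw [integral_const_mul] at h2
  have h3 : cpsi N * u x' ≤ cpsi N * ((2 ^ N * B / b * Real.exp (A / 4)) * u x) := by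
    calc cpsi N * u x' ≤ (2 ^ N * B / b) * ∫ z, u z * ker x R z := h1.trans h2
      _ ≤ (2 ^ N * B / b) * (Real.exp (A / 4) * (cpsi N * u x)) := by gcongr
      _ = _ := by ring
  have h4 := le_of_mul_le_mul_left h3 hcp
  exact h4.trans (by gcongr; exact le_max_right _ _)

end

section

lemma compact_superlevel {N : ℕ} {U : Set (ES N)} (hUo : IsOpen U) (hUb : Bornology.IsBounded U)
    {w : ES N → ℝ} (hw : ContinuousOn w U) {m : ℝ}
    (hfr : ∀ ζ ∈ frontier U, ∀ᶠ x in 𝓝[U] ζ, w x < m) : IsCompact {x ∈ U | m ≤ w x} := by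
  refine Metric.isCompact_of_isClosed_isBounded ?_ (hUb.subset fun x hx => hx.1)
  refine isClosed_of_closure_subset fun ζ hζ => ?_
  have hζU : ζ ∈ closure U := closure_mono (fun x hx => hx.1) hζ
  have hfreq : ∃ᶠ x in 𝓝 ζ, x ∈ {x ∈ U | m ≤ w x} := mem_closure_iff_frequently.1 hζ
  by_cases hU : ζ ∈ U
  · refine ⟨hU, ?_⟩
    by_contra h
    have h1 : ∀ᶠ x in 𝓝 ζ, w x < m :=
      (hw.continuousAt (hUo.mem_nhds hU)).eventually_lt_const (not_le.1 h)
    obtain ⟨x, hx, hx'⟩ := (hfreq.and_eventually h1).exists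
    exact absurd hx.2 (not_le.2 hx')
  · exfalso
    have h1 := hfr ζ ⟨hζU, by rwa [hUo.interior_eq]⟩
    rw [eventually_nhdsWithin_iff] at h1
    obtain ⟨x, hx, hx'⟩ := (hfreq.and_eventually h1).exists
    exact absurd hx.2 (not_le.2 (hx' hx.1))

lemma exists_max {N : ℕ} {U : Set (ES N)} (hUo : IsOpen U) (hUb : Bornology.IsBounded U)
    {w : ES N → ℝ} (hw : ContinuousOn w U) {x₁ : ES N} (hx₁ : x₁ ∈ U)
    (hfr : ∀ ζ ∈ frontier U, ∀ᶠ x in 𝓝[U] ζ, w x < w x₁) :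
    ∃ x₂ ∈ U, ∀ x ∈ U, w x ≤ w x₂ := by
  have hc := compact_superlevel hUo hUb hw hfr
  obtain ⟨x₂, hx₂, hm⟩ := hc.exists_isMaxOn ⟨x₁, hx₁, le_rfl⟩ (hw.mono fun x hx => hx.1)
  refine ⟨x₂, hx₂.1, fun x hx => ?_⟩
  rcases le_or_gt (w x₁) (w x) with h | h
  · exact hm ⟨hx, h⟩
  · exact h.le.trans hx₂.2

/-- maximum principle -/
lemma maxPrinciple {N : ℕ} (hN : 0 < N) {U : Set (ES N)} (hUo : IsOpen U)
    (hUb : Bornology.IsBounded U) {w : ES N → ℝ} (hw : ContinuousOn w U)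
    (hsub : WSub (U ∩ {x | 0 < w x}) w)
    (hfr : ∀ ζ ∈ frontier U, ∀ ε > 0, ∀ᶠ x in 𝓝[U] ζ, w x < ε) : ∀ x ∈ U, w x ≤ 0 := by
  intro x₁ hx₁
  by_contra! hpos
  obtain ⟨x₂, hx₂, hmax⟩ := exists_max hUo hUb hw hx₁ fun ζ hζ => hfr ζ hζ _ hpos
  have hM : 0 < w x₂ := hpos.trans_le (hmax x₁ hx₁)
  have hc := compact_superlevel hUo hUb hw fun ζ hζ => hfr ζ hζ _ hM
  let i : Fin N := ⟨0, hN⟩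
  obtain ⟨z, hz, hzm⟩ := hc.exists_isMaxOn (f := fun x : ES N => x i) ⟨x₂, hx₂, le_rfl⟩
    (by fun_prop)
  have hwz : w z = w x₂ := le_antisymm (hmax z hz.1) hz.2
  have hnh : U ∩ {x | 0 < w x} ∈ 𝓝 z := by
    refine inter_mem (hUo.mem_nhds hz.1) ?_
    exact (hw.continuousAt (hUo.mem_nhds hz.1)).eventually_const_lt (by rw [hwz]; exact hM)
  obtain ⟨R, hR, hRs⟩ := Metric.nhds_basis_closedBall.mem_iff.1 hnh
  have hRU : closedBall z R ⊆ U := hRs.trans inter_subset_left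
  have h1 := subMean hR hRs hsub
  have hi1 := integrable_ker hR (hw.mono hRU)
  have hi2 : Integrable fun x => w z * ker z R x := integrable_ker hR continuousOn_const
  rw [mul_comm, ← ker_integral z hR, ← integral_const_mul] at h1
  have h2 : ∫ x, (w z * ker z R x - w x * ker z R x) ≤ 0 := by
    rw [integral_sub hi2 hi1]; linarith
  have hnn : ∀ x, 0 ≤ w z * ker z R x - w x * ker z R x := by
    intro x
    by_cases hx : x ∈ closedBall z R
    · rw [← sub_mul]
      refine mul_nonneg ?_ (ker_nonneg z hR x)
      rw [hwz]; linarith [hmax x (hRU hx)]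
    · simp [ker_zero z hR hx]
  refine absurd h2 (not_le.2 ?_)
  rw [integral_pos_iff_support_of_nonneg hnn (hi2.sub hi1)]
  set S : Set (ES N) := ball z R ∩ {x | z i < x i} with hS
  have hSo : IsOpen S := isOpen_ball.inter (isOpen_lt continuous_const (by fun_prop))
  have hSne : S.Nonempty := by
    refine ⟨z + (R / 2) • EuclideanSpace.single i (1:ℝ), ?_, ?_⟩
    · rw [mem_ball, dist_eq_norm]
      simp [norm_smul, abs_of_pos hR]
      linarith
    · simp; linarith
  refine (hSo.measure_pos volume hSne).trans_le (measure_mono ?_)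
  intro x hx
  rw [Function.mem_support, ← sub_mul]
  refine (mul_pos ?_ (ker_pos z hR hx.1)).ne'
  have hxU : x ∈ U := hRU (ball_subset_closedBall hx.1)
  by_contra h
  have : x i ≤ z i := hzm ⟨hxU, by rw [← hwz]; linarith⟩
  exact absurd hx.2 (not_lt.2 this)

lemma integrable_mul_compact {N : ℕ} {K : Set (ES N)} (hK : IsCompact K) {w f : ES N → ℝ}
    (hw : ContinuousOn w K) (hf : ContinuousOn f K) (h0 : ∀ x, x ∉ K → f x = 0) :
    Integrable fun x => w x * f x := by
  have h1 : IntegrableOn (fun x => w x * f x) K := (hw.mul hf).integrableOn_compact hK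
  rwa [integrableOn_iff_integrable_of_support_subset] at h1
  intro x hx
  by_contra h
  exact hx (by simp [h0 x h])

lemma IsTestFun.c2 {N : ℕ} {U : Set (ES N)} {φ : ES N → ℝ} (h : IsTestFun U φ) :
    ContDiff ℝ 2 φ := contDiff_infty.1 h.1 2

lemma IsTestFun.integrable_lap {N : ℕ} {U : Set (ES N)} {φ w : ES N → ℝ} (h : IsTestFun U φ)
    (hw : ContinuousOn w U) : Integrable fun x => w x * lap φ x :=
  integrable_mul_compact h.2.1 (hw.mono h.2.2)
    (lap_continuous h.c2).continuousOn fun _ hx => lap_eq_zero hx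

lemma WSub.sub_smooth {N : ℕ} {U : Set (ES N)} {w b : ES N → ℝ} (hw : WSub U w)
    (hb : ContDiff ℝ 2 b) (hlb : ∀ x ∈ U, lap b x ≤ 0) : WSub U (fun x => w x - b x) := by
  refine ⟨hw.1.sub hb.continuous.continuousOn, fun φ hφ h0 => ?_⟩
  have h1 := hw.2 φ hφ h0
  have h2 : ∫ x, b x * lap φ x = ∫ x, lap b x * φ x :=
    integral_lap hb hφ.c2 hφ.2.1
  have h3 : ∫ x, lap b x * φ x ≤ 0 := by
    refine integral_nonpos fun x => ?_
    by_cases hx : x ∈ U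
    · exact mul_nonpos_of_nonpos_of_nonneg (hlb x hx) (h0 x)
    · simp [hφ.zero_out hx]
  simp only [sub_mul]
  rw [integral_sub (hφ.integrable_lap hw.1) (hφ.integrable_lap hb.continuous.continuousOn)]
  linarith

lemma barrier_props {N : ℕ} {κ k : ℝ} (hκ : 0 < κ) (hk : 0 < k) (hkN : (N:ℝ) ≤ 2 * κ ^ 2 * k)
    (z : ES N) {R m : ℝ} (hR : 0 < R) (hm : 0 ≤ m) :
    ContDiff ℝ 2 (fun x => m * (1 + Real.exp (-k) - Real.exp (-k * (‖x - z‖ ^ 2 * (R ^ 2)⁻¹)))) ∧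
    ∀ x, κ * R ≤ dist x z →
      lap (fun x => m * (1 + Real.exp (-k) - Real.exp (-k * (‖x - z‖ ^ 2 * (R ^ 2)⁻¹)))) x ≤ 0 := by
  set T : ℝ → ℝ := fun s => m * (1 + Real.exp (-k) - Real.exp (-k * s)) with hT
  have hTc : ContDiff ℝ 2 T := by
    rw [hT]; fun_prop
  have hd : ∀ s, HasDerivAt T (m * k * Real.exp (-k * s)) s := by
    intro s
    have h1 : HasDerivAt (fun s : ℝ => -k * s) (-k) s := by
      simpa using (hasDerivAt_id s).const_mul (-k)
    have h2 : HasDerivAt T _ s := ((h1.exp).const_sub (1 + Real.exp (-k))).const_mul m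
    exact h2.congr_deriv (by ring)
  have hd1 : deriv T = fun s => m * k * Real.exp (-k * s) := funext fun s => (hd s).deriv
  have hd2 : ∀ s, deriv (deriv T) s = - m * k ^ 2 * Real.exp (-k * s) := by
    intro s
    rw [hd1]
    have h1 : HasDerivAt (fun s : ℝ => -k * s) (-k) s := by
      simpa using (hasDerivAt_id s).const_mul (-k)
    have h2 : HasDerivAt (fun s => m * k * Real.exp (-k * s)) _ s := (h1.exp).const_mul (m * k)
    rw [h2.deriv]; ring
  refine ⟨hTc.comp (contDiff_nsq z _), fun x hx => ?_⟩
  have h := lap_radial hTc z (R ^ 2)⁻¹ x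
  rw [show (fun x => m * (1 + Real.exp (-k) - Real.exp (-k * (‖x - z‖ ^ 2 * (R ^ 2)⁻¹)))) =
    fun x => T (‖x - z‖ ^ 2 * (R ^ 2)⁻¹) from rfl, h, hd2, hd1]
  simp only
  set E := Real.exp (-k * (‖x - z‖ ^ 2 * (R ^ 2)⁻¹)) with hE
  have hEp : 0 < E := Real.exp_pos _
  rw [dist_eq_norm] at hx
  have hs : κ ^ 2 ≤ ‖x - z‖ ^ 2 * (R ^ 2)⁻¹ := by
    rw [← div_eq_mul_inv, le_div_iff₀ (by positivity), ← mul_pow]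
    gcongr
  have h5 : 4 * (R ^ 2)⁻¹ ^ 2 * ‖x - z‖ ^ 2 * (-m * k ^ 2 * E) + 2 * N * (R ^ 2)⁻¹ * (m * k * E)
      = 2 * (R ^ 2)⁻¹ * m * k * E * (N - 2 * (‖x - z‖ ^ 2 * (R ^ 2)⁻¹) * k) := by ring
  rw [h5]
  refine mul_nonpos_of_nonneg_of_nonpos (by positivity) ?_
  nlinarith

/-- decay of subsolutions near boundary with exterior ball -/
lemma barrierDecay (N : ℕ) (hN : 0 < N) (κ : ℝ) (hκ : 0 < κ) : ∃ θ : ℝ, 0 < θ ∧ θ < 1 ∧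
    ∀ (U : Set (ES N)) (z : ES N) (R m : ℝ) (w : ES N → ℝ), IsOpen U → 0 < R → 0 ≤ m →
      ContinuousOn w U → WSub (U ∩ {x | 0 < w x}) w → (∀ x ∈ U, κ * R ≤ dist x z) →
      (∀ x ∈ U, x ∈ ball z R → w x ≤ m) →
      (∀ ζ ∈ frontier U, ζ ∈ ball z R → ∀ ε > 0, ∀ᶠ x in 𝓝[U] ζ, w x < ε) →
      ∀ x ∈ U, x ∈ closedBall z (R / 2) → w x ≤ θ * m := by
  obtain ⟨k, hk, hkN⟩ : ∃ k : ℝ, 0 < k ∧ (N:ℝ) ≤ 2 * κ ^ 2 * k :=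
    ⟨(N + 1) / (2 * κ ^ 2), by positivity, by field_simp; linarith⟩
  have he : Real.exp (-k) < Real.exp (-k / 4) := Real.exp_lt_exp.2 (by linarith)
  have he1 : Real.exp (-k / 4) < 1 := by rw [Real.exp_lt_one_iff]; linarith
  refine ⟨1 + Real.exp (-k) - Real.exp (-k / 4), by linarith [Real.exp_pos (-k)], by linarith, ?_⟩
  intro U z R m w hUo hR hm hwc hws hdist hwm hfr x hxU hx
  obtain ⟨hbC, hbl⟩ := barrier_props hκ hk hkN z hR hm
  set b := (fun x => m * (1 + Real.exp (-k) - Real.exp (-k * (‖x - z‖ ^ 2 * (R ^ 2)⁻¹)))) with hb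
  have hb0 : ∀ x, 0 ≤ b x := by
    intro x
    have : Real.exp (-k * (‖x - z‖ ^ 2 * (R ^ 2)⁻¹)) ≤ 1 := by
      rw [Real.exp_le_one_iff]
      have : 0 ≤ k * (‖x - z‖ ^ 2 * (R ^ 2)⁻¹) := by positivity
      linarith
    exact mul_nonneg hm (by linarith [Real.exp_pos (-k)])
  have hmp := maxPrinciple hN (U := U ∩ ball z R) (w := fun x => w x - b x) (hUo.inter isOpen_ball)
    (isBounded_ball.subset inter_subset_right)
    ((hwc.mono inter_subset_left).sub hbC.continuous.continuousOn)
    ((WSub.sub_smooth (U := (U ∩ ball z R) ∩ {x | 0 < w x - b x}) (hws.mono ?_) hbC ?_)) ?_ x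
    ⟨hxU, ?_⟩
  · have h1 : b x ≤ m * (1 + Real.exp (-k) - Real.exp (-k / 4)) := by
      refine mul_le_mul_of_nonneg_left ?_ hm
      have : Real.exp (-k / 4) ≤ Real.exp (-k * (‖x - z‖ ^ 2 * (R ^ 2)⁻¹)) := by
        rw [Real.exp_le_exp]
        have h3 : ‖x - z‖ ^ 2 * (R ^ 2)⁻¹ ≤ 1 / 4 := by
          rw [mem_closedBall, dist_eq_norm] at hx
          rw [← div_eq_mul_inv, div_le_iff₀ (by positivity)]
          nlinarith [norm_nonneg (x - z)]
        nlinarith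
      linarith
    linarith
  · rintro x ⟨⟨h1, h2⟩, h3⟩
    refine ⟨h1, ?_⟩
    simp only [mem_ofPred_eq] at h3 ⊢
    linarith [hb0 x]
  · rintro x ⟨⟨h1, h2⟩, h3⟩
    exact hbl x (hdist x h1)
  · intro ζ hζ ε hε
    have hζc : ζ ∈ closure U ∩ closedBall z R :=
      (closure_inter_subset_inter_closure _ _).trans
        (inter_subset_inter_right _ closure_ball_subset_closedBall) hζ.1
    have hζn : ζ ∉ U ∩ ball z R := by
      have := hζ.2
      rwa [(hUo.inter isOpen_ball).interior_eq] at this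
    by_cases hζb : ζ ∈ ball z R
    · have hζU : ζ ∉ U := fun h => hζn ⟨h, hζb⟩
      have := hfr ζ ⟨hζc.1, by rwa [hUo.interior_eq]⟩ hζb ε hε
      have h2 := nhdsWithin_mono ζ (inter_subset_left (s := U) (t := ball z R)) this
      filter_upwards [h2] with x hx
      have h3 : w x < ε := hx
      linarith [hb0 x]
    · have hd : dist ζ z = R := le_antisymm hζc.2 (not_lt.1 hζb)
      have hbζ : b ζ = m := by
        rw [dist_eq_norm] at hd
        simp only [hb, hd]
        rw [mul_inv_cancel₀ (by positivity)]
        simp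
      have h1 : ∀ᶠ x in 𝓝[U ∩ ball z R] ζ, m - ε < b x := by
        refine (hbC.continuous.continuousAt.eventually_const_lt ?_).filter_mono nhdsWithin_le_nhds
        linarith
      filter_upwards [h1, self_mem_nhdsWithin] with x hx hx'
      linarith [hwm x hx'.1 hx'.2]
  · exact mem_ball.2 (lt_of_le_of_lt hx (by linarith))

end

section

/-- height function of a Lipschitz graph domain `{H > 0}` in the direction `e` -/
structure Grph {N : ℕ} (Λ : ℝ) (H : ES N → ℝ) (e : ES N) : Prop where
  one_le : 1 ≤ Λ
  lip : ∀ x x', |H x - H x'| ≤ Λ * dist x x'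
  norm_e : ‖e‖ = 1
  shift : ∀ x (s : ℝ), H (x + s • e) = H x + s

/-- nonnegative solutions in `{H > 0} ∩ S` -/
structure NSol {N : ℕ} (H : ES N → ℝ) (A : ℝ) (V u : ES N → ℝ) (S : Set (ES N)) : Prop where
  meas : Measurable V
  sol : WSol ({x | 0 < H x} ∩ S) V u
  V0 : ∀ x, 0 < H x → x ∈ S → 0 ≤ V x
  VA : ∀ x, 0 < H x → x ∈ S → V x * H x ^ 2 ≤ A
  nn : ∀ x, 0 < H x → x ∈ S → 0 ≤ u x

/-- `u` vanishes on `{H = 0} ∩ S` -/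
def Vanish {N : ℕ} (H : ES N → ℝ) (u : ES N → ℝ) (S : Set (ES N)) : Prop :=
  ∀ ζ ∈ S, H ζ = 0 → ∀ ε > 0, ∀ᶠ x in 𝓝[{x | 0 < H x}] ζ, u x < ε

lemma NSol.mono {N : ℕ} {H : ES N → ℝ} {A : ℝ} {V u : ES N → ℝ} {S S' : Set (ES N)}
    (h : NSol H A V u S) (hS : S' ⊆ S) : NSol H A V u S' :=
  ⟨h.meas, h.sol.mono (inter_subset_inter_right _ hS), fun x h1 h2 => h.V0 x h1 (hS h2),
    fun x h1 h2 => h.VA x h1 (hS h2), fun x h1 h2 => h.nn x h1 (hS h2)⟩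

lemma Vanish.mono {N : ℕ} {H : ES N → ℝ} {u : ES N → ℝ} {S S' : Set (ES N)}
    (h : Vanish H u S) (hS : S' ⊆ S) : Vanish H u S' := fun ζ hζ => h ζ (hS hζ)

section
variable {N : ℕ} {Λ : ℝ} {H : ES N → ℝ} {e : ES N}

lemma Grph.pos (g : Grph Λ H e) : 0 < Λ := one_pos.trans_le g.one_le

lemma Grph.cont (g : Grph Λ H e) : Continuous H := by
  have : LipschitzWith Λ.toNNReal H := by
    refine LipschitzWith.of_dist_le_mul fun x y => ?_
    rw [Real.coe_toNNReal _ g.pos.le, Real.dist_eq]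
    exact g.lip x y
  exact this.continuous

lemma Grph.isOpen (g : Grph Λ H e) : IsOpen {x | 0 < H x} := isOpen_lt continuous_const g.cont

lemma Grph.le (g : Grph Λ H e) (x x' : ES N) : H x ≤ H x' + Λ * dist x x' := by
  have := (abs_le.1 (g.lip x x')).2; linarith

lemma Grph.dist_shift (g : Grph Λ H e) (x : ES N) (s : ℝ) : dist (x + s • e) x = |s| := by
  rw [dist_eq_norm]; simp [norm_smul, g.norm_e]

lemma Grph.dist_shift' (g : Grph Λ H e) (x : ES N) (s : ℝ) : dist x (x + s • e) = |s| := by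
  rw [dist_comm, g.dist_shift]

/-- frontier points of `{H>0} ∩ S` inside open `S` have `H = 0` -/
lemma Grph.frontier_zero (g : Grph Λ H e) {S : Set (ES N)} (hS : IsOpen S) {ζ : ES N}
    (hζ : ζ ∈ frontier ({x | 0 < H x} ∩ S)) (hζS : ζ ∈ S) : H ζ = 0 := by
  rw [(g.isOpen.inter hS).frontier_eq] at hζ
  have h1 : ζ ∈ closure {x | 0 < H x} := closure_mono inter_subset_left hζ.1
  have h2 : 0 ≤ H ζ := by
    have : closure {x | 0 < H x} ⊆ {x | 0 ≤ H x} :=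
      closure_minimal (fun x (hx : 0 < H x) => (le_of_lt hx : 0 ≤ H x)) (isClosed_le continuous_const g.cont)
    exact this h1
  refine le_antisymm ?_ h2
  by_contra h
  exact hζ.2 ⟨not_le.1 h, hζS⟩

end

lemma graphDecay (N : ℕ) (hN : 0 < N) (Λ : ℝ) (hΛ : 1 ≤ Λ) : ∃ θ : ℝ, 0 < θ ∧ θ < 1 ∧
    ∀ (H : ES N → ℝ) (e : ES N), Grph Λ H e → ∀ (x : ES N) (s m : ℝ) (w : ES N → ℝ),
      0 < H x → H x ≤ s → 0 ≤ m → ContinuousOn w ({x | 0 < H x} ∩ ball x (7 * s)) →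
      WSub (({x | 0 < H x} ∩ ball x (7 * s)) ∩ {x | 0 < w x}) w →
      (∀ p, 0 < H p → p ∈ ball x (7 * s) → w p ≤ m) → Vanish H w (ball x (7 * s)) →
      w x ≤ θ * m := by
  obtain ⟨θ, h0, h1, hθ⟩ := barrierDecay N hN (1 / (5 * Λ)) (by positivity)
  refine ⟨θ, h0, h1, ?_⟩
  intro H e g x s m w hx hxs hm hwc hws hwm hv
  have hs : 0 < s := hx.trans_le hxs
  have hd : dist (x + (-(2 * s)) • e) x = 2 * s := by
    rw [g.dist_shift, abs_neg, abs_of_pos (by linarith)]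
  have hsub : ball (x + (-(2 * s)) • e) (5 * s) ⊆ ball x (7 * s) :=
    ball_subset_ball' (by rw [hd]; linarith)
  refine hθ ({x | 0 < H x} ∩ ball x (7 * s)) (x + (-(2 * s)) • e) (5 * s) m w
    (g.isOpen.inter isOpen_ball) (by linarith) hm hwc hws ?_ ?_ ?_ x ⟨hx, ?_⟩ ?_
  · rintro p ⟨hp, -⟩
    have h2 := g.le p (x + (-(2 * s)) • e)
    rw [g.shift] at h2
    have hp : 0 < H p := hp
    have h3 : s ≤ Λ * dist p (x + (-(2 * s)) • e) := by linarith
    have hΛ := g.pos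
    rw [show 1 / (5 * Λ) * (5 * s) = s / Λ by field_simp, div_le_iff₀ hΛ]
    linarith
  · exact fun p hp _ => hwm p hp.1 hp.2
  · intro ζ hζ hζb ε hε
    have h2 := hv ζ (hsub hζb) (g.frontier_zero isOpen_ball hζ (hsub hζb)) ε hε
    exact nhdsWithin_mono ζ inter_subset_left h2
  · exact mem_ball_self (by linarith)
  · rw [mem_closedBall, dist_comm, hd]; linarith

lemma harnackStep (N : ℕ) (Λ A : ℝ) : ∃ C : ℝ, 1 ≤ C ∧
    ∀ (H : ES N → ℝ) (e : ES N), Grph Λ H e → ∀ (V u : ES N → ℝ) (S : Set (ES N)),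
      NSol H A V u S → ∀ (p p' : ES N) (h : ℝ), 0 < h → h ≤ H p → closedBall p (h / (2 * Λ)) ⊆ S →
      dist p' p ≤ h / (8 * Λ) → u p' ≤ C * u p := by
  obtain ⟨C, hC, hH⟩ := harnackBall N A
  refine ⟨C, hC, ?_⟩
  intro H e g V u S hu p p' h hh hp hS hd
  have hΛ := g.pos
  have hpos : ∀ z ∈ closedBall p (h / (2 * Λ)), h / 2 ≤ H z := by
    intro z hz
    have h1 := g.le p z
    rw [mem_closedBall, dist_comm] at hz
    have : Λ * dist p z ≤ Λ * (h / (2 * Λ)) := by gcongr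
    rw [show Λ * (h / (2 * Λ)) = h / 2 by field_simp] at this
    linarith
  have hsub : closedBall p (h / (2 * Λ)) ⊆ {x | 0 < H x} ∩ S := fun z hz =>
    ⟨(half_pos hh).trans_le (hpos z hz), hS hz⟩
  refine hH ({x | 0 < H x} ∩ S) V u p p' (h / (2 * Λ)) (by positivity) hsub hu.sol.sup
    (hu.sol.sub (fun x hx => hu.V0 x hx.1 hx.2) fun x hx => hu.nn x hx.1 hx.2)
    (fun z hz => hu.nn z (hsub hz).1 (hsub hz).2)
    (fun z hz => ⟨hu.V0 z (hsub hz).1 (hsub hz).2, ?_⟩) ?_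
  · refine le_trans ?_ (hu.VA z (hsub hz).1 (hsub hz).2)
    refine mul_le_mul_of_nonneg_left ?_ (hu.V0 z (hsub hz).1 (hsub hz).2)
    have h1 := hpos z hz
    have h2 : h / (2 * Λ) ≤ h / 2 := by
      have := g.one_le
      gcongr
      linarith
    gcongr
    linarith
  · rw [mem_closedBall]
    convert hd using 1
    field_simp
    norm_num

lemma harnackChain (N : ℕ) (Λ A : ℝ) : ∃ C : ℝ, 1 ≤ C ∧
    ∀ (H : ES N → ℝ) (e : ES N), Grph Λ H e → ∀ (V u : ES N → ℝ) (S : Set (ES N)),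
      NSol H A V u S → ∀ (p p' : ES N) (h : ℝ) (n : ℕ), 0 < h →
      (∀ q ∈ segment ℝ p p', h ≤ H q ∧ closedBall q (h / (2 * Λ)) ⊆ S) →
      dist p' p ≤ n * (h / (8 * Λ)) → u p' ≤ C ^ n * u p := by
  obtain ⟨C, hC, hH⟩ := harnackStep N Λ A
  refine ⟨C, hC, ?_⟩
  intro H e g V u S hu p p' h n hh hq hd
  have hC0 : 0 < C := by linarith
  rcases Nat.eq_zero_or_pos n with rfl | hn
  · simp at hd; simp [hd]
  have hn' : (0:ℝ) < n := by exact_mod_cast hn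
  have key : ∀ j : ℕ, j ≤ n → u (p + ((j:ℝ) / n) • (p' - p)) ≤ C ^ j * u p := by
    intro j
    induction j with
    | zero => intro _; simp
    | succ j ih =>
      intro hj
      have h1 := ih (by omega)
      have hjn : (j:ℝ) / n ≤ 1 := by
        rw [div_le_one hn']; exact_mod_cast (by omega : j ≤ n)
      have hmem : p + ((j:ℝ) / n) • (p' - p) ∈ segment ℝ p p' := by
        rw [segment_eq_image']
        exact ⟨(j:ℝ) / n, ⟨by positivity, hjn⟩, rfl⟩
      have h2 := hH H e g V u S hu (p + ((j:ℝ) / n) • (p' - p))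
        (p + (((j + 1 : ℕ):ℝ) / n) • (p' - p)) h hh (hq _ hmem).1 (hq _ hmem).2 (by
          rw [dist_eq_norm, add_sub_add_left_eq_sub, ← sub_smul, norm_smul]
          have : ((j + 1 : ℕ):ℝ) / n - j / n = 1 / n := by push_cast; ring
          rw [this, Real.norm_eq_abs, abs_of_pos (by positivity), ← dist_eq_norm]
          rw [one_div, inv_mul_le_iff₀ hn']
          exact hd)
      calc _ ≤ C * u (p + ((j:ℝ) / n) • (p' - p)) := h2
        _ ≤ C * (C ^ j * u p) := by gcongr
        _ = _ := by ring
  have := key n le_rfl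
  rwa [div_self hn'.ne', one_smul, add_sub_cancel] at this

lemma harnackGraph (N : ℕ) (Λ A q : ℝ) (hΛ : 1 ≤ Λ) (hq : 0 < q) : ∃ C : ℝ, 1 ≤ C ∧
    ∀ (H : ES N → ℝ) (e : ES N), Grph Λ H e → ∀ (V u : ES N → ℝ) (z : ES N) (r : ℝ), 0 < r →
      NSol H A V u (ball z (10 * Λ * r)) → ∀ x x', x ∈ closedBall z r → x' ∈ closedBall z r →
      q * r ≤ H x → q * r ≤ H x' → u x ≤ C * u x' := by
  wlog hq1 : q ≤ 1 generalizing q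
  · obtain ⟨C, hC, h⟩ := this 1 one_pos le_rfl
    refine ⟨C, hC, fun H e g V u z r hr hu x x' hx hx' h1 h2 => ?_⟩
    exact h H e g V u z r hr hu x x' hx hx' (by nlinarith) (by nlinarith)
  obtain ⟨C, hC, hH⟩ := harnackChain N Λ A
  obtain ⟨n, hn⟩ := exists_nat_ge (24 * Λ ^ 2 / q)
  have hC0 : 0 < C := by linarith
  refine ⟨C ^ n * (C ^ n * C ^ n), by
    have := one_le_pow₀ (n := n) hC
    nlinarith [mul_le_mul this this (by norm_num) (by positivity)], ?_⟩
  intro H e g V u z r hr hu x x' hx hx' h1 h2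
  have hΛ0 := g.pos
  rw [mem_closedBall] at hx hx'
  have hqr : 0 < q * r := by positivity
  have hrad : q * r / (2 * Λ) ≤ r := by
    rw [div_le_iff₀ (by positivity)]; nlinarith
  have hstep : ∀ d, d ≤ 3 * Λ * r → d ≤ n * (q * r / (8 * Λ)) := by
    intro d hd
    refine hd.trans ?_
    rw [div_le_iff₀ hq] at hn
    rw [← mul_div_assoc, le_div_iff₀ (by positivity)]
    nlinarith
  have hball : ∀ p, dist p z ≤ r + 3 * Λ * r → closedBall p (q * r / (2 * Λ)) ⊆ ball z (10 * Λ * r) := by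
    intro p hp
    refine (closedBall_subset_ball' ?_)
    nlinarith
  have vert : ∀ x, dist x z ≤ r → q * r ≤ H x → ∀ p ∈ segment ℝ x (x + (3 * Λ * r) • e),
      q * r ≤ H p ∧ closedBall p (q * r / (2 * Λ)) ⊆ ball z (10 * Λ * r) := by
    intro x hx h1 p hp
    rw [segment_eq_image'] at hp
    obtain ⟨s, hs, rfl⟩ := hp
    simp only [add_sub_cancel_left, smul_smul]
    have h0 : 0 ≤ s * (3 * Λ * r) := mul_nonneg hs.1 (by positivity)
    refine ⟨by rw [g.shift]; linarith, hball _ ?_⟩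
    have := dist_triangle (x + (s * (3 * Λ * r)) • e) x z
    rw [g.dist_shift, abs_of_nonneg h0] at this
    have h3 : s * (3 * Λ * r) ≤ 1 * (3 * Λ * r) := by
      refine mul_le_mul_of_nonneg_right hs.2 (by positivity)
    linarith
  have e1 : u (x' + (3 * Λ * r) • e) ≤ C ^ n * u x' := by
    refine hH H e g V u _ hu x' _ (q * r) n hqr (vert x' hx' h2) (hstep _ ?_)
    rw [g.dist_shift, abs_of_pos (by positivity)]
  have e3 : u x ≤ C ^ n * u (x + (3 * Λ * r) • e) := by
    refine hH H e g V u _ hu _ x (q * r) n hqr ?_ (hstep _ ?_)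
    · rw [segment_symm]; exact vert x hx h1
    · rw [g.dist_shift', abs_of_pos (by positivity)]
  have e2 : u (x + (3 * Λ * r) • e) ≤ C ^ n * u (x' + (3 * Λ * r) • e) := by
    refine hH H e g V u _ hu _ _ (q * r) n hqr ?_ (hstep _ ?_)
    · intro p hp
      rw [segment_eq_image'] at hp
      obtain ⟨s, hs, rfl⟩ := hp
      set m := x' + s • (x - x') with hm
      have hmz : dist m z ≤ r := by
        have : m ∈ segment ℝ x' x := by
          rw [segment_eq_image']; exact ⟨s, hs, rfl⟩
        have h5 := (convex_closedBall z r).segment_subset (mem_closedBall.2 hx') (mem_closedBall.2 hx)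
        exact h5 this
      have hpm : x' + (3 * Λ * r) • e + s • (x + (3 * Λ * r) • e - (x' + (3 * Λ * r) • e))
          = m + (3 * Λ * r) • e := by
        rw [hm, add_sub_add_right_eq_sub]; abel
      simp only [hpm]
      refine ⟨?_, hball _ ?_⟩
      · rw [g.shift]
        have h6 := g.le x m
        have h7 : dist x m ≤ 2 * r := by
          have := dist_triangle_right x m z
          linarith
        have : Λ * dist x m ≤ Λ * (2 * r) := by gcongr
        nlinarith
      · have := dist_triangle (m + (3 * Λ * r) • e) m z
        rw [g.dist_shift, abs_of_nonneg (by positivity)] at this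
        linarith
    · rw [dist_eq_norm, add_sub_add_right_eq_sub, ← dist_eq_norm]
      have := dist_triangle_right x x' z
      nlinarith
  calc u x ≤ C ^ n * u (x + (3 * Λ * r) • e) := e3
    _ ≤ C ^ n * (C ^ n * u (x' + (3 * Λ * r) • e)) := by gcongr
    _ ≤ C ^ n * (C ^ n * (C ^ n * u x')) := by gcongr
    _ = _ := by ring

end

section

lemma growth (N : ℕ) (Λ A : ℝ) (hΛ : 1 ≤ Λ) : ∃ (C : ℝ) (γ : ℕ), 1 ≤ C ∧
    ∀ (H : ES N → ℝ) (e : ES N), Grph Λ H e → ∀ (V u : ES N → ℝ) (z : ES N) (r : ℝ), 0 < r →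
      H z = 0 → NSol H A V u (ball z (100 * Λ ^ 2 * r)) →
      ∀ x, 0 < H x → H x ≤ 2 * Λ * r → dist x z ≤ 2 * r + H x →
      u x * H x ^ γ ≤ C * r ^ γ * u (z + r • e) := by
  obtain ⟨C₀, hC₀, hch⟩ := harnackChain N Λ A
  obtain ⟨C₂, hC₂, hgr⟩ := harnackGraph N Λ A (1 / (4 * Λ)) hΛ (by positivity)
  obtain ⟨n₁, hn₁⟩ := exists_nat_ge (8 * Λ)
  obtain ⟨γ, hγ⟩ := pow_unbounded_of_one_lt (C₀ ^ n₁) (by norm_num : (1:ℝ) < 2)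
  refine ⟨C₂ * (2 * Λ) ^ γ, γ, one_le_mul_of_one_le_of_one_le hC₂ (one_le_pow₀ (by linarith)), ?_⟩
  intro H e g V u z r hr hz hu
  have hΛ0 := g.pos
  have hrΛ : r ≤ Λ * r := by nlinarith
  have hrΛ2 : Λ * r ≤ Λ ^ 2 * r := by nlinarith
  have hA : 0 ≤ u (z + r • e) := by
    refine hu.nn _ (by rw [g.shift]; linarith) ?_
    rw [mem_ball, g.dist_shift, abs_of_pos hr]
    nlinarith
  have key : ∀ n : ℕ, ∀ x, 0 < H x → r ≤ 2 ^ n * H x → H x ≤ 2 * Λ * r → dist x z ≤ 2 * r + H x →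
      u x * H x ^ γ ≤ C₂ * (2 * Λ) ^ γ * r ^ γ * u (z + r • e) := by
    have base : ∀ x, 0 < H x → r ≤ H x → H x ≤ 2 * Λ * r → dist x z ≤ 2 * r + H x →
      u x * H x ^ γ ≤ C₂ * (2 * Λ) ^ γ * r ^ γ * u (z + r • e) := by
      intro x hx0 hx hx2 hd
      have h1 := hgr H e g V u z (4 * Λ * r) (by positivity)
        (hu.mono (ball_subset_ball (by nlinarith))) x (z + r • e)
        (by rw [mem_closedBall]; nlinarith)
        (by rw [mem_closedBall, g.dist_shift, abs_of_pos hr]; nlinarith)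
        (by rw [show 1 / (4 * Λ) * (4 * Λ * r) = r by field_simp]; exact hx)
        (by rw [show 1 / (4 * Λ) * (4 * Λ * r) = r by field_simp, g.shift]; linarith)
      calc u x * H x ^ γ ≤ (C₂ * u (z + r • e)) * (2 * Λ * r) ^ γ := by gcongr
        _ = _ := by rw [mul_pow]; ring
    intro n
    induction n with
    | zero => intro x hx0 hx; exact base x hx0 (by simpa using hx)
    | succ n ih =>
      intro x hx0 hx hx2 hd
      rcases le_or_gt r (H x) with hr1 | hr1
      · exact base x hx0 hr1 hx2 hd
      have hH1 : H (x + H x • e) = 2 * H x := by rw [g.shift]; ring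
      have h1 := ih (x + H x • e) (by rw [hH1]; linarith) (by rw [hH1]; rw [pow_succ] at hx; linarith)
        (by rw [hH1]; nlinarith) (by
          have := dist_triangle (x + H x • e) x z
          rw [g.dist_shift, abs_of_pos hx0] at this
          rw [hH1]; linarith)
      have h2 : u x ≤ C₀ ^ n₁ * u (x + H x • e) := by
        refine hch H e g V u _ hu (x + H x • e) x (H x) n₁ hx0 ?_ ?_
        · intro q hq
          rw [segment_symm, segment_eq_image'] at hq
          obtain ⟨s, hs, rfl⟩ := hq
          simp only [add_sub_cancel_left, smul_smul]
          have h0 : 0 ≤ s * H x := mul_nonneg hs.1 hx0.le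
          have h0' : s * H x ≤ H x := by nlinarith [hs.2]
          refine ⟨by rw [g.shift]; linarith, closedBall_subset_ball' ?_⟩
          have := dist_triangle (x + (s * H x) • e) x z
          rw [g.dist_shift, abs_of_nonneg h0] at this
          have h3 : H x / (2 * Λ) ≤ H x := by
            rw [div_le_iff₀ (by positivity)]; nlinarith
          nlinarith
        · rw [g.dist_shift', abs_of_pos hx0]
          rw [← mul_div_assoc, le_div_iff₀ (by positivity)]
          nlinarith
      have h3 : 0 ≤ u (x + H x • e) := by
        refine hu.nn _ (by rw [hH1]; linarith) ?_
        have := dist_triangle (x + H x • e) x z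
        rw [g.dist_shift, abs_of_pos hx0] at this
        rw [mem_ball]; nlinarith
      calc u x * H x ^ γ ≤ (C₀ ^ n₁ * u (x + H x • e)) * H x ^ γ := by gcongr
        _ ≤ (2 ^ γ * u (x + H x • e)) * H x ^ γ := by gcongr
        _ = u (x + H x • e) * (H (x + H x • e)) ^ γ := by rw [hH1, mul_pow]; ring
        _ ≤ _ := h1
  intro x hx0 hx2 hd
  obtain ⟨n, hn⟩ := pow_unbounded_of_one_lt (r / H x) (by norm_num : (1:ℝ) < 2)
  rw [div_lt_iff₀ hx0] at hn
  exact key n x hx0 hn.le hx2 hd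

lemma carleson (N : ℕ) (hN : 0 < N) (Λ A : ℝ) (hΛ : 1 ≤ Λ) : ∃ C : ℝ, 1 ≤ C ∧
    ∀ (H : ES N → ℝ) (e : ES N), Grph Λ H e → ∀ (V u : ES N → ℝ) (z : ES N) (r : ℝ), 0 < r →
      H z = 0 → NSol H A V u (ball z (100 * Λ ^ 2 * r)) → Vanish H u (ball z (100 * Λ ^ 2 * r)) →
      ∀ x, 0 < H x → x ∈ ball z r → u x ≤ C * u (z + r • e) := by
  obtain ⟨Cg, γ, hCg, hgrowth⟩ := growth N Λ A hΛ
  obtain ⟨θ, hθ0, hθ1, hdecay⟩ := graphDecay N hN Λ hΛ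
  set ε : ℝ := (1 - θ) / (14 * (γ + 1)) with hε
  have hε0 : 0 < ε := by
    have : 0 < 1 - θ := by linarith
    positivity
  have hεγ : 14 * (γ + 1) * ε = 1 - θ := by rw [hε]; field_simp
  have hε2 : 14 * ε ≤ 1 := by
    have h : (0:ℝ) ≤ γ := Nat.cast_nonneg γ
    nlinarith [mul_nonneg h hε0.le]
  have hbern : θ < (1 - 7 * ε) ^ γ := by
    have h := one_add_mul_le_pow (a := -(7 * ε)) (by linarith) γ
    have h2 : (0:ℝ) ≤ γ := Nat.cast_nonneg γ
    rw [← sub_eq_add_neg 1 (7 * ε)] at h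
    nlinarith [mul_nonneg h2 hε0.le]
  refine ⟨max 1 (Cg * (ε⁻¹) ^ γ), le_max_left _ _, ?_⟩
  intro H e g V u z r hr hz hu hv x hx hxz
  have hΛ0 := g.pos
  have hrΛ : r ≤ Λ * r := by nlinarith
  have hrΛ2 : Λ * r ≤ Λ ^ 2 * r := by nlinarith
  have hbig : 2 * r < 100 * Λ ^ 2 * r := by nlinarith
  have hb2 : ball z (2 * r) ⊆ ball z (100 * Λ ^ 2 * r) := ball_subset_ball hbig.le
  have hAnn : 0 ≤ u (z + r • e) := by
    refine hu.nn _ (by rw [g.shift]; linarith) ?_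
    rw [mem_ball, g.dist_shift, abs_of_pos hr]
    linarith
  set U := {x | 0 < H x} ∩ ball z (2 * r) with hU
  have hUo : IsOpen U := g.isOpen.inter isOpen_ball
  set f : ES N → ℝ := fun x => u x * (2 * r - dist x z) ^ γ with hf
  by_cases hux : u x ≤ 0
  · exact hux.trans (by positivity)
  push Not at hux
  have hxU : x ∈ U := ⟨hx, ball_subset_ball (by linarith) hxz⟩
  rw [mem_ball] at hxz
  have hfx : 0 < f x := mul_pos hux (pow_pos (by linarith) γ)
  have hucont : ContinuousOn u ({x | 0 < H x} ∩ ball z (100 * Λ ^ 2 * r)) := hu.sol.1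
  have hUsub : U ⊆ {x | 0 < H x} ∩ ball z (100 * Λ ^ 2 * r) := inter_subset_inter_right _ hb2
  have hfc : ContinuousOn f U := (hucont.mono hUsub).mul (by fun_prop)
  -- frontier
  by_cases hγ0 : γ = 0
  · -- trivial since growth bounds directly
    subst hγ0
    have h1 := hgrowth H e g V u z r hr hz hu x hx (by
      have := g.le x z; nlinarith) (by linarith)
    simp at h1
    exact h1.trans (mul_le_mul_of_nonneg_right (by simp) hAnn)
  have hfr : ∀ ζ ∈ frontier U, ∀ᶠ p in 𝓝[U] ζ, f p < f x := by
    intro ζ hζ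
    have hζc : dist ζ z ≤ 2 * r := by
      have : ζ ∈ closedBall z (2 * r) := closure_ball_subset_closedBall
        (closure_mono inter_subset_right hζ.1)
      exact this
    have hζH : 0 ≤ H ζ := by
      have h2 : closure U ⊆ {x | 0 ≤ H x} :=
        closure_minimal (fun x hx => (le_of_lt hx.1 : 0 ≤ H x)) (isClosed_le continuous_const g.cont)
      exact h2 hζ.1
    have hζB : ζ ∈ ball z (100 * Λ ^ 2 * r) := mem_ball.2 (by linarith)
    rcases hζH.eq_or_lt with h0 | h0
    · have h1 := hv ζ hζB h0.symm (f x / (2 * r) ^ γ) (by positivity)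
      have h2 := nhdsWithin_mono ζ (inter_subset_left (s := {x | 0 < H x}) (t := ball z (2 * r))) h1
      filter_upwards [h2, self_mem_nhdsWithin] with p hp hpU
      have hp1 : u p < f x / (2 * r) ^ γ := hp
      rw [lt_div_iff₀ (by positivity)] at hp1
      have hp0 := hu.nn p hpU.1 (hb2 hpU.2)
      have hpd := hpU.2
      rw [mem_ball] at hpd
      refine lt_of_le_of_lt ?_ hp1
      have : (2 * r - dist p z) ^ γ ≤ (2 * r) ^ γ :=
        pow_le_pow_left₀ (by linarith) (by linarith [dist_nonneg (x := p) (y := z)]) γ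
      exact mul_le_mul_of_nonneg_left this hp0
    · have hd : dist ζ z = 2 * r := by
        refine le_antisymm hζc ?_
        by_contra h
        refine hζ.2 ?_
        rw [hUo.interior_eq]
        exact ⟨h0, not_le.1 h⟩
      have hca : ContinuousAt f ζ := by
        have : ContinuousAt u ζ := hucont.continuousAt
          ((g.isOpen.inter isOpen_ball).mem_nhds ⟨h0, hζB⟩)
        exact this.mul (by fun_prop)
      have hfz : f ζ = 0 := by simp [hf, hd, hγ0]
      exact (hca.eventually_lt_const (by rw [hfz]; exact hfx)).filter_mono nhdsWithin_le_nhds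
  obtain ⟨x₂, hx₂, hmax⟩ := exists_max hUo (isBounded_ball.subset inter_subset_right) hfc hxU hfr
  have hS : 0 < f x₂ := hfx.trans_le (hmax x hxU)
  have hH2 : 0 < H x₂ := hx₂.1
  have hd2 : dist x₂ z < 2 * r := hx₂.2
  set d := 2 * r - dist x₂ z with hd
  have hd0 : 0 < d := by linarith
  have hu2 : 0 ≤ u x₂ := hu.nn x₂ hH2 (hb2 hx₂.2)
  have hmain : f x₂ ≤ Cg * (ε⁻¹) ^ γ * r ^ γ * u (z + r • e) := by
    rcases le_or_gt (ε * d) (H x₂) with hc | hc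
    · have h1 := hgrowth H e g V u z r hr hz hu x₂ hH2 (by
        have := g.le x₂ z; nlinarith) (by linarith)
      have h2 : d ≤ ε⁻¹ * H x₂ := by
        rw [le_inv_mul_iff₀ hε0]; exact hc
      calc f x₂ = u x₂ * d ^ γ := rfl
        _ ≤ u x₂ * (ε⁻¹ * H x₂) ^ γ := by gcongr
        _ = (ε⁻¹) ^ γ * (u x₂ * H x₂ ^ γ) := by rw [mul_pow]; ring
        _ ≤ (ε⁻¹) ^ γ * (Cg * r ^ γ * u (z + r • e)) := by gcongr
        _ = _ := by ring
    · exfalso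
      have h7 : 0 < 1 - 7 * ε := by linarith
      have hsub : ball x₂ (7 * (ε * d)) ⊆ ball z (2 * r) := by
        refine ball_subset_ball' ?_
        nlinarith
      set m := f x₂ / ((1 - 7 * ε) * d) ^ γ with hm
      have hm0 : 0 < m := by positivity
      have hUs : {x | 0 < H x} ∩ ball x₂ (7 * (ε * d)) ⊆ {x | 0 < H x} ∩ ball z (100 * Λ ^ 2 * r) :=
        inter_subset_inter_right _ (hsub.trans hb2)
      have h1 := hdecay H e g x₂ (ε * d) m u hH2 hc.le hm0.le (hucont.mono hUs) ?_ ?_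
        (hv.mono (hsub.trans hb2))
      · have h2 : f x₂ ≤ θ * m * d ^ γ := mul_le_mul_of_nonneg_right h1 (by positivity)
        have h3 : θ * m * d ^ γ = θ / (1 - 7 * ε) ^ γ * f x₂ := by
          rw [hm, mul_pow]; field_simp
        rw [h3] at h2
        have h4 : θ / (1 - 7 * ε) ^ γ < 1 := by
          rw [div_lt_one (by positivity)]; exact hbern
        nlinarith
      · refine WSub.mono ?_ (inter_subset_left.trans hUs)
        exact hu.sol.sub (fun x hx => hu.V0 x hx.1 hx.2) (fun x hx => hu.nn x hx.1 hx.2)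
      · intro p hp hpb
        have hpm := hmax p ⟨hp, hsub hpb⟩
        rw [hm, le_div_iff₀ (by positivity)]
        refine le_trans ?_ hpm
        refine mul_le_mul_of_nonneg_left ?_ (hu.nn p hp (hb2 (hsub hpb)))
        refine pow_le_pow_left₀ (by positivity) ?_ γ
        rw [mem_ball] at hpb
        have := dist_triangle p x₂ z
        nlinarith
  have hfin : u x * r ^ γ ≤ Cg * (ε⁻¹) ^ γ * r ^ γ * u (z + r • e) := by
    refine le_trans ?_ ((hmax x hxU).trans hmain)
    refine mul_le_mul_of_nonneg_left (pow_le_pow_left₀ hr.le (by linarith) γ) hux.le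
  have hrγ : 0 < r ^ γ := by positivity
  have : u x ≤ Cg * (ε⁻¹) ^ γ * u (z + r • e) := by
    refine le_of_mul_le_mul_right ?_ hrγ
    linarith
  exact this.trans (mul_le_mul_of_nonneg_right (le_max_right _ _) hAnn)

end

section

lemma integrable_pot {N : ℕ} {K : Set (ES N)} (hK : IsCompact K) {V u φ : ES N → ℝ}
    (hV : Measurable V) (hu : ContinuousOn u K) (hφ : ContinuousOn φ K)
    (h0 : ∀ x, x ∉ K → φ x = 0) {M : ℝ} (hM : ∀ x ∈ K, |V x| ≤ M) :
    Integrable fun x => V x * u x * φ x := by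
  have h1 : IntegrableOn (fun x => u x * φ x) K := (hu.mul hφ).integrableOn_compact hK
  have h2 : IntegrableOn (fun x => V x * (u x * φ x)) K :=
    Integrable.bdd_mul (c := M) h1 hV.aestronglyMeasurable
      ((ae_restrict_iff' hK.measurableSet).2 (Eventually.of_forall hM))
  simp only [mul_assoc]
  rwa [integrableOn_iff_integrable_of_support_subset] at h2
  intro x hx
  by_contra h
  exact hx (by simp [h0 x h])

lemma NSol.integrable {N : ℕ} {Λ : ℝ} {H : ES N → ℝ} {e : ES N} (g : Grph Λ H e) {A : ℝ}
    {V u w φ : ES N → ℝ} {S : Set (ES N)}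
    (h : NSol H A V u S) (hφ : IsTestFun ({x | 0 < H x} ∩ S) φ)
    (hw : ContinuousOn w ({x | 0 < H x} ∩ S)) : Integrable fun x => V x * w x * φ x := by
  rcases (tsupport φ).eq_empty_or_nonempty with he | hne
  · have : ∀ x, φ x = 0 := fun x => image_eq_zero_of_notMem_tsupport (by rw [he]; simp)
    simp [this]
  obtain ⟨p, hp, hm⟩ := hφ.2.1.exists_isMinOn hne g.cont.continuousOn
  have hpp : 0 < H p := (hφ.2.2 hp).1
  refine integrable_pot hφ.2.1 h.meas (hw.mono hφ.2.2) hφ.1.continuous.continuousOn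
    (fun x hx => image_eq_zero_of_notMem_tsupport hx) (M := A / H p ^ 2) fun x hx => ?_
  have hx' := hφ.2.2 hx
  have h1 := h.V0 x hx'.1 hx'.2
  have h2 := h.VA x hx'.1 hx'.2
  rw [abs_of_nonneg h1, le_div_iff₀ (by positivity)]
  refine le_trans ?_ h2
  have : H p ≤ H x := hm hx
  gcongr

/-- the comparison functions in the boundary Harnack argument -/
structure CW {N : ℕ} (H : ES N → ℝ) (A : ℝ) (V w : ES N → ℝ) (S : Set (ES N)) : Prop where
  cont : ContinuousOn w ({x | 0 < H x} ∩ S)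
  V0 : ∀ x, 0 < H x → x ∈ S → 0 ≤ V x
  VA : ∀ x, 0 < H x → x ∈ S → V x * H x ^ 2 ≤ A
  sup : ∀ m : ℝ, 0 ≤ m → WSup ({x | 0 < H x} ∩ S) V (fun x => w x + m)
  sub : WSub (({x | 0 < H x} ∩ S) ∩ {x | 0 < - w x}) (fun x => - w x)
  van : Vanish H (fun x => - w x) S

lemma CW.mono {N : ℕ} {H : ES N → ℝ} {A : ℝ} {V w : ES N → ℝ} {S S' : Set (ES N)}
    (h : CW H A V w S) (hS : S' ⊆ S) : CW H A V w S' :=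
  ⟨h.cont.mono (inter_subset_inter_right _ hS), fun x h1 h2 => h.V0 x h1 (hS h2),
    fun x h1 h2 => h.VA x h1 (hS h2), fun m hm => (h.sup m hm).mono (inter_subset_inter_right _ hS),
    h.sub.mono (inter_subset_inter_left _ (inter_subset_inter_right _ hS)), h.van.mono hS⟩

lemma integral_lap_test {N : ℕ} {U : Set (ES N)} {φ : ES N → ℝ} (hφ : IsTestFun U φ) :
    ∫ x, lap φ x = 0 := by
  have := integral_lap (f := fun _ => (1:ℝ)) contDiff_const hφ.c2 hφ.2.1
  simpa [lap_const] using this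

lemma CW.of_NSol {N : ℕ} {Λ : ℝ} {H : ES N → ℝ} {e : ES N} (g : Grph Λ H e) {A : ℝ}
    {V V' u v : ES N → ℝ} {S : Set (ES N)} (hu : NSol H A V u S) (hv : NSol H A V' v S)
    (hVV : ∀ x, 0 < H x → x ∈ S → V' x ≤ V x) (hvan : Vanish H u S) {α β : ℝ} (hα : 0 ≤ α)
    (hβ : 0 ≤ β) (hS : IsOpen S) : CW H A V' (fun x => α * v x - β * u x) S := by
  have hcu := hu.sol.1
  have hcv := hv.sol.1
  have hcw : ContinuousOn (fun x => α * v x - β * u x) ({x | 0 < H x} ∩ S) :=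
    (continuousOn_const.mul hcv).sub (continuousOn_const.mul hcu)
  have heq : ∀ φ, IsTestFun ({x | 0 < H x} ∩ S) φ → ∫ x, (α * v x - β * u x) * lap φ x
      = ∫ x, (α * (V' x * v x * φ x) - β * (V x * u x * φ x)) := by
    intro φ hφ
    rw [integral_sub ((hv.integrable g hφ hcv).const_mul _) ((hu.integrable g hφ hcu).const_mul _),
      integral_const_mul, integral_const_mul, ← hv.sol.2 φ hφ, ← hu.sol.2 φ hφ,
      ← integral_const_mul, ← integral_const_mul,
      ← integral_sub ((hφ.integrable_lap hcv).const_mul _) ((hφ.integrable_lap hcu).const_mul _)]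
    congr 1; ext x; ring
  refine ⟨hcw, hv.V0, hv.VA, ?_, ?_, ?_⟩
  · intro m hm
    refine ⟨hcw.add continuousOn_const, fun φ hφ h0 => ?_⟩
    have h1 : ∫ x, (α * v x - β * u x + m) * lap φ x = ∫ x, (α * v x - β * u x) * lap φ x := by
      simp only [add_mul]
      rw [integral_add (hφ.integrable_lap hcw) (hφ.integrable_lap continuousOn_const),
        integral_const_mul, integral_lap_test hφ]
      simp
    rw [h1, heq φ hφ]
    refine integral_mono (((hv.integrable g hφ hcv).const_mul _).sub
      ((hu.integrable g hφ hcu).const_mul _))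
      (hv.integrable g hφ (hcw.add continuousOn_const)) fun x => ?_
    simp only
    by_cases hx : x ∈ {x | 0 < H x} ∩ S
    · have a1 := hVV x hx.1 hx.2
      have a2 := hv.V0 x hx.1 hx.2
      have a3 := hu.nn x hx.1 hx.2
      have a4 := h0 x
      have b1 : 0 ≤ (V x - V' x) * (β * u x * φ x) :=
        mul_nonneg (by linarith) (by positivity)
      have b2 : 0 ≤ V' x * m * φ x := by positivity
      nlinarith
    · simp [hφ.zero_out hx]
  · refine ⟨(hcw.neg).mono inter_subset_left, fun φ hφ h0 => ?_⟩
    have hφ' := hφ.mono inter_subset_left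
    simp only [neg_mul]
    rw [integral_neg, heq φ hφ', ← integral_neg]
    refine integral_nonneg fun x => ?_
    simp only [Pi.zero_apply]
    by_cases hx : x ∈ ({x | 0 < H x} ∩ S) ∩ {x | 0 < -(α * v x - β * u x)}
    · have a1 := hVV x hx.1.1 hx.1.2
      have a2 := hv.V0 x hx.1.1 hx.1.2
      have a3 := hu.nn x hx.1.1 hx.1.2
      have a4 := h0 x
      have a5 : 0 < -(α * v x - β * u x) := hx.2
      have b1 : 0 ≤ (V x - V' x) * (β * u x * φ x) :=
        mul_nonneg (by linarith) (by positivity)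
      have b2 : 0 ≤ V' x * (-(α * v x - β * u x)) * φ x := by positivity
      nlinarith
    · simp [hφ.zero_out hx]
  · intro ζ hζS hζ ε hε
    have h1 := hvan ζ hζS hζ (ε / (β + 1)) (by positivity)
    have h2 : ∀ᶠ x in 𝓝[{x | 0 < H x}] ζ, x ∈ S := nhdsWithin_le_nhds (hS.mem_nhds hζS)
    filter_upwards [h1, h2, self_mem_nhdsWithin] with x hx1 hx2 hx3
    have a1 := hv.nn x hx3 hx2
    have a2 := hu.nn x hx3 hx2
    rw [lt_div_iff₀ (by positivity)] at hx1
    nlinarith [mul_nonneg hα a1]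

lemma bhpStep (N : ℕ) (hN : 0 < N) (Λ A : ℝ) (hΛ : 1 ≤ Λ) : ∃ δ M a κ : ℝ, 0 < δ ∧ 0 < M ∧ 0 < a ∧
    0 < κ ∧ κ < 1 ∧ δ ≤ κ ∧
    ∀ (H : ES N → ℝ) (e : ES N), Grph Λ H e → ∀ (V w : ES N → ℝ) (z : ES N) (ρ m : ℝ), 0 < ρ →
      0 ≤ m → CW H A V w (ball z ρ) → (∀ x, 0 < H x → x ∈ ball z ρ → -m ≤ w x) →
      (∀ x, δ * ρ ≤ H x → x ∈ ball z ρ → M * m ≤ w x) →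
      (∀ x, 0 < H x → x ∈ ball z (κ * ρ) → -(a * m) ≤ w x) ∧
      (∀ x, δ * (κ * ρ) ≤ H x → x ∈ ball z (κ * ρ) → M * (a * m) ≤ w x) := by
  obtain ⟨c, hc0, hc1, hwh⟩ := weakHarnack N A (1 / (8 * Λ)) (by positivity)
  obtain ⟨θ, hθ0, hθ1, hdecay⟩ := graphDecay N hN Λ hΛ
  obtain ⟨n, hn⟩ := exists_pow_lt_of_lt_one (half_pos hc0) hθ1
  have hΛ0 : 0 < Λ := by linarith
  set κ : ℝ := 1 - 1 / (100 * Λ) with hκ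
  have hκ1 : 1 / (100 * Λ) ≤ 1 / 100 := by
    rw [div_le_div_iff₀ (by positivity) (by norm_num)]; linarith
  have hκp : 0 < 1 / (100 * Λ) := by positivity
  set δ : ℝ := 1 / (700 * Λ * (n + 1)) with hδ
  have hδ0 : 0 < δ := by positivity
  have hδn : 7 * (n + 1) * δ = 1 / (100 * Λ) := by rw [hδ]; field_simp; norm_num
  have hn0 : (0:ℝ) ≤ n := Nat.cast_nonneg n
  have hδ1 : 7 * δ ≤ 1 / (100 * Λ) := by nlinarith [mul_nonneg hn0 hδ0.le]
  refine ⟨δ, 2 / c, c / 2, κ, hδ0, by positivity, by positivity, by linarith, by linarith,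
    by linarith, ?_⟩
  intro H e g V w z ρ m hρ hm hw hlow hlow2
  have hκρ : ball z (κ * ρ) ⊆ ball z ρ := ball_subset_ball (by nlinarith)
  have hcM : c * (2 / c * m) = 2 * m := by field_simp
  refine ⟨?_, ?_⟩
  · have key : ∀ j : ℕ, ∀ x, 0 < H x → x ∈ ball z (ρ - 7 * j * δ * ρ) → - w x ≤ θ ^ j * m := by
      intro j
      induction j with
      | zero =>
        intro x hx hxb
        simp at hxb
        have := hlow x hx hxb
        simp; linarith
      | succ j ih =>
        intro x hx hxb
        have hj0 : (0:ℝ) ≤ 7 * j * δ * ρ := by positivity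
        rw [mem_ball] at hxb
        push_cast at hxb
        have hδρ : 0 < δ * ρ := by positivity
        rcases le_or_gt (δ * ρ) (H x) with h | h
        · have h1 := hlow2 x h (by rw [mem_ball]; nlinarith)
          have h2 : 0 ≤ 2 / c * m := by positivity
          have h3 : 0 ≤ θ ^ (j + 1) * m := by positivity
          linarith
        · have hb1 : ball x (7 * (δ * ρ)) ⊆ ball z (ρ - 7 * j * δ * ρ) :=
            ball_subset_ball' (by linarith)
          have hb2 : ball x (7 * (δ * ρ)) ⊆ ball z ρ := hb1.trans (ball_subset_ball (by linarith))
          have hw' := hw.mono hb2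
          have h1 := hdecay H e g x (δ * ρ) (θ ^ j * m) (fun x => - w x) hx h.le (by positivity)
            hw'.cont.neg hw'.sub (fun p hp hpb => ih p hp (hb1 hpb)) hw'.van
          rw [pow_succ]
          linarith
    intro x hx hxb
    have h1 := key n x hx (ball_subset_ball (by
      have : 7 * n * δ ≤ 1 / (100 * Λ) := by nlinarith
      nlinarith) hxb)
    have h2 : θ ^ n * m ≤ c / 2 * m := by gcongr
    linarith
  · intro x hHx hxb
    rcases le_or_gt (δ * ρ) (H x) with h | h
    · have h1 := hlow2 x h (hκρ hxb)
      have : 2 / c * (c / 2 * m) ≤ 2 / c * m := by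
        refine mul_le_mul_of_nonneg_left ?_ (by positivity)
        nlinarith
      linarith
    · rw [mem_ball] at hxb
      set s := δ * ρ with hs
      have hs0 : 0 < s := by positivity
      have hsκ : δ * (κ * ρ) = κ * s := by rw [hs]; ring
      rw [hsκ] at hHx
      set R := s / (4 * Λ) with hR
      have hR0 : 0 < R := by positivity
      have hΛR : Λ * R = s / 4 := by rw [hR]; field_simp
      have hRle : R ≤ s / 4 := by nlinarith
      have hHR : ∀ p ∈ closedBall x R, s / 2 ≤ H p := by
        intro p hp
        have h1 := g.le x p
        rw [mem_closedBall, dist_comm] at hp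
        have : Λ * dist x p ≤ Λ * R := by gcongr
        nlinarith
      have hRb : closedBall x R ⊆ ball z ρ := by
        refine closedBall_subset_ball' ?_
        have : s ≤ 1 / (100 * Λ) * ρ := by
          rw [hs]; nlinarith
        have : κ * ρ = ρ - 1 / (100 * Λ) * ρ := by rw [hκ]; ring
        linarith
      have hxx : dist (x + (R / 4) • e) x = R / 4 := by
        rw [g.dist_shift, abs_of_pos (by positivity)]
      have hsmall : 1 / (8 * Λ) * R ≤ R / 8 := by
        have : 1 / (8 * Λ) ≤ 1 / 8 := by
          rw [div_le_div_iff₀ (by positivity) (by norm_num)]; linarith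
        nlinarith
      have hxb' : ball (x + (R / 4) • e) (1 / (8 * Λ) * R) ⊆ ball x (R / 2) :=
        ball_subset_ball' (by rw [hxx]; linarith)
      have h1 := hwh ({x | 0 < H x} ∩ ball z ρ) V (fun x => w x + m) x (x + (R / 4) • e) R
        (2 / c * m) hR0 (fun p hp => ⟨(half_pos hs0).trans_le (hHR p hp), hRb hp⟩) (hw.sup m hm)
        (fun p hp => by
          have := hlow p ((half_pos hs0).trans_le (hHR p hp)) (hRb hp)
          linarith)
        (fun p hp => by
          have hp1 := (half_pos hs0).trans_le (hHR p hp)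
          have hp2 := hw.V0 p hp1 (hRb hp)
          refine ⟨hp2, le_trans ?_ (hw.VA p hp1 (hRb hp))⟩
          have : R ≤ H p := by linarith [hHR p hp]
          gcongr)
        hxb' (by positivity)
        (fun p hp => by
          have hp1 : p ∈ ball z ρ := hRb (closedBall_subset_closedBall (by linarith)
            (ball_subset_closedBall (hxb' hp)))
          have h2 := g.le (x + (R / 4) • e) p
          rw [g.shift] at h2
          rw [mem_ball, dist_comm] at hp
          have h3 : Λ * dist (x + (R / 4) • e) p ≤ Λ * (1 / (8 * Λ) * R) := by gcongr
          have h4 : Λ * (1 / (8 * Λ) * R) = R / 8 := by field_simp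
          have h5 : κ * s = s - 1 / (100 * Λ) * s := by rw [hκ]; ring
          have h6 : 1 / (100 * Λ) * s = R / 25 := by rw [hR]; field_simp; norm_num
          have h7 := hlow2 p (by linarith) hp1
          linarith)
      rw [hcM] at h1
      have : 2 / c * (c / 2 * m) = m := by field_simp
      linarith

set_option maxHeartbeats 1000000 in
lemma bhp (N : ℕ) (hN : 0 < N) (Λ A : ℝ) (hΛ : 1 ≤ Λ) : ∃ C : ℝ, 1 ≤ C ∧
    ∀ (H : ES N → ℝ) (e : ES N), Grph Λ H e → ∀ (V V' u v : ES N → ℝ) (z : ES N) (r : ℝ), 0 < r →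
      H z = 0 → NSol H A V u (ball z (400 * Λ ^ 3 * r)) → NSol H A V' v (ball z (400 * Λ ^ 3 * r)) →
      (∀ x, 0 < H x → x ∈ ball z (400 * Λ ^ 3 * r) → V' x ≤ V x) →
      Vanish H u (ball z (400 * Λ ^ 3 * r)) →
      ∀ x, 0 < H x → x ∈ ball z r → u x * v (z + r • e) ≤ C * (v x * u (z + r • e)) := by
  obtain ⟨δ, M, a, κ, hδ, hM, ha, hκ0, hκ1, hδκ, hstep⟩ := bhpStep N hN Λ A hΛ
  obtain ⟨C₁, hC₁, hcar⟩ := carleson N hN Λ A hΛ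
  have hΛ0 : 0 < Λ := by linarith
  obtain ⟨C₂, hC₂, hhar⟩ := harnackGraph N Λ A (δ / (4 * Λ)) hΛ (by positivity)
  refine ⟨(M + 1) * (C₁ * C₂) * C₂, ?_, ?_⟩
  · have : 1 ≤ C₁ * C₂ := one_le_mul_of_one_le_of_one_le hC₁ hC₂
    have : 1 ≤ C₁ * C₂ * C₂ := one_le_mul_of_one_le_of_one_le this hC₂
    nlinarith
  intro H e g V V' u v z₀ r hr hz hu hv hVV hvan x hx hxb
  have hC₁0 : 0 < C₁ := by linarith
  have hC₂0 : 0 < C₂ := by linarith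
  have hrΛ : r ≤ Λ * r := by nlinarith
  have hrΛ2 : Λ * r ≤ Λ ^ 2 * r := by nlinarith
  have hrΛ3 : Λ ^ 2 * r ≤ Λ ^ 3 * r := by nlinarith [mul_nonneg (sq_nonneg Λ) hr.le]
  set As := z₀ + r • e with hAs
  have hAH : H As = r := by rw [hAs, g.shift, hz, zero_add]
  have hAd : dist As z₀ = r := by rw [hAs, g.dist_shift, abs_of_pos hr]
  have hA1 : As ∈ ball z₀ (400 * Λ ^ 3 * r) := by rw [mem_ball, hAd]; linarith
  have huA : 0 ≤ u As := hu.nn _ (by rw [hAH]; exact hr) hA1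
  have hvA : 0 ≤ v As := hv.nn _ (by rw [hAH]; exact hr) hA1
  have hsubB : ball z₀ (4 * Λ * r) ⊆ ball z₀ (400 * Λ ^ 3 * r) := ball_subset_ball (by linarith)
  have hsubH : ball z₀ (10 * Λ * (4 * Λ * r)) ⊆ ball z₀ (400 * Λ ^ 3 * r) :=
    ball_subset_ball (by nlinarith)
  have hsubC : ball z₀ (100 * Λ ^ 2 * (4 * Λ * r)) ⊆ ball z₀ (400 * Λ ^ 3 * r) :=
    ball_subset_ball (by nlinarith)
  have hδ1 : δ < 1 := by linarith
  have hqr : δ / (4 * Λ) * (4 * Λ * r) = δ * r := by field_simp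
  have hAcb : As ∈ closedBall z₀ (4 * Λ * r) := by rw [mem_closedBall, hAd]; linarith
  have hδr : δ * r ≤ r := by nlinarith
  -- upper bound for u
  have hub : ∀ p, 0 < H p → p ∈ ball z₀ (4 * Λ * r) → u p ≤ C₁ * C₂ * u As := by
    intro p hp hpb
    have h1 := hcar H e g V u z₀ (4 * Λ * r) (by positivity) hz (hu.mono hsubC) (hvan.mono hsubC)
      p hp hpb
    have h2 := hhar H e g V u z₀ (4 * Λ * r) (by positivity) (hu.mono hsubH)
      (z₀ + (4 * Λ * r) • e) As
      (by rw [mem_closedBall, g.dist_shift, abs_of_pos (by positivity)]) hAcb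
      (by rw [hqr, g.shift, hz]; linarith) (by rw [hqr, hAH]; exact hδr)
    calc u p ≤ C₁ * u (z₀ + (4 * Λ * r) • e) := h1
      _ ≤ C₁ * (C₂ * u As) := by gcongr
      _ = _ := by ring
  have hvb : ∀ p, δ * r ≤ H p → p ∈ ball z₀ (4 * Λ * r) → v As ≤ C₂ * v p := by
    intro p hp hpb
    exact hhar H e g V' v z₀ (4 * Λ * r) (by positivity) (hv.mono hsubH) As p hAcb
      (ball_subset_closedBall hpb) (by rw [hqr, hAH]; exact hδr) (by rw [hqr]; exact hp)
  set α := (M + 1) * (C₁ * C₂) * C₂ * u As with hα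
  have hα0 : 0 ≤ α := by positivity
  have hcw := CW.of_NSol g hu hv hVV hvan hα0 hvA isOpen_ball
  set w : ES N → ℝ := fun x => α * v x - v As * u x with hw
  set m := C₁ * C₂ * (u As * v As) with hm
  have hm0 : 0 ≤ m := by positivity
  have hlow : ∀ p, 0 < H p → p ∈ ball z₀ (4 * Λ * r) → -m ≤ w p := by
    intro p hp hpb
    have h1 := mul_le_mul_of_nonneg_left (hub p hp hpb) hvA
    have h2 := mul_nonneg hα0 (hv.nn p hp (hsubB hpb))
    simp only [hw, hm]
    nlinarith
  have hlow2 : ∀ p, δ * r ≤ H p → p ∈ ball z₀ (4 * Λ * r) → M * m ≤ w p := by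
    intro p hp hpb
    have hp0 : 0 < H p := lt_of_lt_of_le (by positivity) hp
    have h1 := mul_le_mul_of_nonneg_left (hub p hp0 hpb) hvA
    have h2 := mul_le_mul_of_nonneg_left (hvb p hp hpb)
      (show 0 ≤ (M + 1) * (C₁ * C₂) * u As by positivity)
    simp only [hw, hm, hα]
    nlinarith
  suffices h : 0 ≤ w x by
    simp only [hw, hα] at h
    nlinarith
  have hMm : 0 ≤ M * m := by positivity
  have hxd := hxb
  rw [mem_ball] at hxd
  rcases le_or_gt r (H x) with hc | hc
  · exact hMm.trans (hlow2 x (hδr.trans hc) (ball_subset_ball (by linarith) hxb))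
  set z := x + (-(H x)) • e with hzdef
  have hz0 : H z = 0 := by rw [hzdef, g.shift]; ring
  have hxz : dist x z = H x := by rw [hzdef, g.dist_shift', abs_neg, abs_of_pos hx]
  have hzb : ball z r ⊆ ball z₀ (4 * Λ * r) := by
    refine ball_subset_ball' ?_
    have := dist_triangle_left z z₀ x
    rw [hxz] at this
    linarith
  have key : ∀ j : ℕ, (∀ p, 0 < H p → p ∈ ball z (κ ^ j * r) → -(a ^ j * m) ≤ w p) ∧
      (∀ p, δ * (κ ^ j * r) ≤ H p → p ∈ ball z (κ ^ j * r) → M * (a ^ j * m) ≤ w p) := by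
    intro j
    induction j with
    | zero =>
      simp only [pow_zero, one_mul]
      exact ⟨fun p hp hpb => hlow p hp (hzb hpb), fun p hp hpb => hlow2 p hp (hzb hpb)⟩
    | succ j ih =>
      have hsb : ball z (κ ^ j * r) ⊆ ball z₀ (400 * Λ ^ 3 * r) := by
        refine Subset.trans (ball_subset_ball ?_) (hzb.trans hsubB)
        have : κ ^ j ≤ 1 := pow_le_one₀ hκ0.le hκ1.le
        nlinarith
      have h1 := hstep H e g V' w z (κ ^ j * r) (a ^ j * m) (by positivity) (by positivity)
        (hcw.mono hsb) ih.1 ih.2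
      have e1 : κ * (κ ^ j * r) = κ ^ (j + 1) * r := by ring
      have e2 : a * (a ^ j * m) = a ^ (j + 1) * m := by ring
      rw [e1, e2] at h1
      exact h1
  obtain ⟨j, hj1, hj2⟩ := exists_nat_pow_near_of_lt_one (x := H x / r) (by positivity)
    ((div_le_one hr).2 hc.le) hκ0 hκ1
  rw [lt_div_iff₀ hr] at hj1
  rw [div_le_iff₀ hr] at hj2
  rcases hj2.eq_or_lt with hj3 | hj3
  · -- boundary case, use a previous scale when possible
    cases j with
    | zero =>
      rw [pow_zero, one_mul] at hj3
      exact absurd hj3 hc.ne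
    | succ j =>
      have hp : 0 < κ ^ j * r := by positivity
      have e1 : κ ^ (j + 1) * r = κ * (κ ^ j * r) := by ring
      refine le_trans ?_ ((key j).2 x ?_ ?_)
      · positivity
      · rw [hj3, e1]
        exact mul_le_mul_of_nonneg_right hδκ hp.le
      · rw [mem_ball, hxz, hj3, e1]
        exact mul_lt_of_lt_one_left hp hκ1
  · have hp : 0 < κ ^ j * r := by positivity
    have e1 : κ ^ (j + 1) * r = κ * (κ ^ j * r) := by ring
    refine le_trans ?_ ((key j).2 x ?_ ?_)
    · positivity
    · rw [e1] at hj1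
      exact (mul_le_mul_of_nonneg_right hδκ hp.le).trans hj1.le
    · rw [mem_ball, hxz]; exact hj3

end

section

open scoped Convolution

open scoped Convolution

/-- convolution of a rough function with a smooth one -/
def mol {N : ℕ} (g η : ES N → ℝ) : ES N → ℝ :=
  convolution g η (ContinuousLinearMap.lsmul ℝ ℝ) volume

lemma mol_apply {N : ℕ} (g η : ES N → ℝ) (x : ES N) : mol g η x = ∫ z, g z * η (x - z) := rfl

lemma mol_contDiff {N : ℕ} {g η : ES N → ℝ} (hg : LocallyIntegrable g) (hη : ContDiff ℝ (⊤ : ℕ∞) η)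
    (hc : HasCompactSupport η) : ContDiff ℝ (⊤ : ℕ∞) (mol g η) :=
  hc.contDiff_convolution_right _ hg hη

lemma pd_mol {N : ℕ} {g η : ES N → ℝ} (hg : LocallyIntegrable g) (hη : ContDiff ℝ 1 η)
    (hc : HasCompactSupport η) (v : ES N) (x : ES N) :
    fderiv ℝ (mol g η) x v = mol g (fun z => fderiv ℝ η z v) x := by
  have h := hc.hasFDerivAt_convolution_right (ContinuousLinearMap.lsmul ℝ ℝ) hg hη x
  unfold mol
  rw [h.fderiv, convolution_precompR_apply _ hg (hc.fderiv ℝ) (hη.continuous_fderiv (by norm_num))]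

lemma lap_mol {N : ℕ} {g η : ES N → ℝ} (hg : LocallyIntegrable g) (hη : ContDiff ℝ 2 η)
    (hc : HasCompactSupport η) (x : ES N) : lap (mol g η) x = mol g (lap η) x := by
  have hc' : ∀ i : Fin N, HasCompactSupport (fun z => fderiv ℝ η z (ev i)) := fun i =>
    hc.fderiv_apply (𝕜 := ℝ) _
  have h1 : ∀ i : Fin N, fderiv ℝ (fun y => fderiv ℝ (mol g η) y (ev i)) x (ev i) =
      mol g (fun z => fderiv ℝ (fun y => fderiv ℝ η y (ev i)) z (ev i)) x := by
    intro i
    rw [← pd_mol hg (contDiff_pd hη _) (hc' i)]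
    congr 2
    ext y
    exact pd_mol hg (hη.of_le (by norm_num)) hc _ y
  rw [lap_def, Finset.sum_congr rfl fun i _ => h1 i]
  simp only [mol_apply, lap_def, Finset.mul_sum]
  rw [integral_finsetSum]
  intro i _
  have hcd : Continuous (fun z => fderiv ℝ (fun y => fderiv ℝ η y (ev i)) z (ev i)) :=
    ((contDiff_pd hη (ev i)).continuous_fderiv (by norm_num)).clm_apply continuous_const
  have hcc : HasCompactSupport (fun z => fderiv ℝ (fun y => fderiv ℝ η y (ev i)) z (ev i)) :=
    (hc' i).fderiv_apply (𝕜 := ℝ) _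
  exact (hcc.convolutionExists_right (ContinuousLinearMap.lsmul ℝ ℝ) hg hcd x)

lemma lap_reflect {N : ℕ} {η : ES N → ℝ} (hη : ContDiff ℝ 2 η) (x z : ES N) :
    lap (fun z => η (x - z)) z = lap η (x - z) := by
  have h1 : ∀ {f : ES N → ℝ}, ContDiff ℝ 1 f → ∀ (z v : ES N),
      fderiv ℝ (fun z => f (x - z)) z v = - fderiv ℝ f (x - z) v := by
    intro f hf z v
    have h2 : HasFDerivAt (fun z : ES N => x - z) (-ContinuousLinearMap.id ℝ (ES N)) z :=
      (hasFDerivAt_id z).const_sub x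
    have h3 := ((hf.differentiable (by norm_num) (x - z)).hasFDerivAt).comp z h2
    have h4 : HasFDerivAt (fun z => f (x - z)) _ z := h3
    rw [h4.fderiv]
    simp
  rw [lap_def, lap_def]
  refine Finset.sum_congr rfl fun i _ => ?_
  have h2 : (fun y => fderiv ℝ (fun z => η (x - z)) y (ev i)) =
      fun y => - fderiv ℝ η (x - y) (ev i) := by
    ext y; exact h1 (hη.of_le (by norm_num)) y _
  rw [h2, fderiv_fun_neg]
  have := h1 (contDiff_pd hη (ev i)) z (ev i)
  simp only [neg_apply, this, neg_neg]

/-- smooth convex truncations -/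
lemma exists_theta {ε : ℝ} (hε : 0 < ε) : ∃ T : ℝ → ℝ, ContDiff ℝ (⊤ : ℕ∞) T ∧
    (∀ s, s ≤ ε → T s = 0) ∧ (∀ s, 0 ≤ T s) ∧ (∀ s, s - 2 * ε ≤ T s) ∧
    (∀ s, 0 ≤ deriv T s ∧ deriv T s ≤ 1) ∧ (∀ s, 0 ≤ deriv (deriv T) s) ∧
    (∀ s, T s ≤ s * deriv T s) := by
  set k : ℝ → ℝ := fun s => Real.smoothTransition ((s - ε) / ε) with hk
  have hkc : ContDiff ℝ (⊤ : ℕ∞) k :=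
    Real.smoothTransition.contDiff.comp ((contDiff_id.sub contDiff_const).div_const _)
  have hkcont := hkc.continuous
  have hkm : Monotone k := by
    intro s t hst
    apply Real.smoothTransition.monotone
    gcongr
  have hk0 : ∀ s, 0 ≤ k s := fun s => Real.smoothTransition.nonneg _
  have hk1 : ∀ s, k s ≤ 1 := fun s => Real.smoothTransition.le_one _
  have hkz : ∀ s, s ≤ ε → k s = 0 := fun s hs =>
    Real.smoothTransition.zero_of_nonpos (div_nonpos_of_nonpos_of_nonneg (by linarith) hε.le)
  have hko : ∀ s, 2 * ε ≤ s → k s = 1 := fun s hs =>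
    Real.smoothTransition.one_of_one_le (by rw [le_div_iff₀ hε]; linarith)
  set T : ℝ → ℝ := fun s => ∫ t in (0:ℝ)..s, k t with hT
  have hd : ∀ s, HasDerivAt T (k s) s := fun s =>
    intervalIntegral.integral_hasDerivAt_right (hkcont.intervalIntegrable _ _)
      (hkcont.stronglyMeasurableAtFilter _ _) hkcont.continuousAt
  have hderiv : deriv T = k := funext fun s => (hd s).deriv
  have hTmono : Monotone T := monotone_of_deriv_nonneg (fun s => (hd s).differentiableAt)
    (fun s => by rw [hderiv]; exact hk0 s)
  have hTz : ∀ s, s ≤ ε → T s = 0 := by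
    intro s hs
    have : ∫ t in (0:ℝ)..s, k t = ∫ t in (0:ℝ)..s, (0:ℝ) := by
      refine intervalIntegral.integral_congr fun t ht => hkz t ?_
      rcases ht with ⟨_, h2⟩
      exact h2.trans (max_le hε.le hs)
    simp only [hT, this, intervalIntegral.integral_zero]
  have hT0 : ∀ s, 0 ≤ T s := by
    intro s
    rcases le_or_gt s ε with h | h
    · rw [hTz s h]
    · rw [← hTz ε le_rfl]; exact hTmono h.le
  refine ⟨T, ?_, hTz, hT0, ?_, ?_, ?_, ?_⟩
  · have h : ContDiff ℝ ((⊤ : ℕ∞) + 1) T := by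
      rw [contDiff_succ_iff_deriv]
      refine ⟨fun s => (hd s).differentiableAt, ?_, by rw [hderiv]; exact hkc⟩
      intro h; simp at h
    exact h.of_le (by simp)
  · intro s
    rcases le_or_gt s (2 * ε) with h | h
    · linarith [hT0 s]
    · have h1 : T s - T (2 * ε) = ∫ t in (2 * ε)..s, k t := by
        simp only [hT]
        rw [intervalIntegral.integral_interval_sub_left] <;> exact hkcont.intervalIntegrable _ _
      have h2 : ∫ t in (2 * ε)..s, k t = ∫ t in (2 * ε)..s, (1:ℝ) := by
        refine intervalIntegral.integral_congr fun t ht => hko t ?_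
        rw [uIcc_of_le h.le] at ht
        exact ht.1
      rw [h2] at h1
      simp at h1
      linarith [hT0 (2 * ε)]
  · intro s; rw [hderiv]; exact ⟨hk0 s, hk1 s⟩
  · intro s; rw [hderiv]; exact hkm.deriv_nonneg
  · intro s
    rw [hderiv]
    rcases le_or_gt s ε with h | h
    · rw [hTz s h, hkz s h]; simp
    · have h1 : T s ≤ ∫ t in (0:ℝ)..s, k s :=
        intervalIntegral.integral_mono_on (by linarith) (hkcont.intervalIntegrable _ _)
          (by simp) fun t ht => hkm ht.2
      simpa using h1

end

section

open scoped Convolution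

open scoped Convolution

lemma mol_bound {N : ℕ} {g η : ES N → ℝ} {B : ℝ} (hB : ∀ z, |g z| ≤ B) (h0 : ∀ z, 0 ≤ η z)
    (hi : Integrable η) (h1 : ∫ z, η z = 1) (x : ES N) : |mol g η x| ≤ B := by
  rw [mol_apply]
  have h2 : Integrable fun z => η (x - z) := hi.comp_sub_left x
  have h3 := norm_integral_le_of_norm_le (f := fun z => g z * η (x - z)) (h2.const_mul B)
    (Eventually.of_forall fun z => by
      rw [norm_mul, Real.norm_eq_abs, Real.norm_eq_abs, abs_of_nonneg (h0 _)]
      exact mul_le_mul_of_nonneg_right (hB z) (h0 _))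
  rw [integral_const_mul, integral_sub_left_eq_self (fun z => η z) volume x, h1, mul_one] at h3
  exact h3

lemma mol_comm {N : ℕ} (g η : ES N → ℝ) (x : ES N) :
    mol g η x = (convolution η g (ContinuousLinearMap.lsmul ℝ ℝ) volume) x := by
  rw [mol_apply, convolution_eq_swap]
  congr 1
  ext z
  simp [mul_comm]

/-- the standard bumps -/
def bmp (N n : ℕ) : ContDiffBump (0 : ES N) where
  rIn := 1 / ((n:ℝ) + 1)
  rOut := 2 * (1 / ((n:ℝ) + 1))
  rIn_pos := by positivity
  rIn_lt_rOut := by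
    have : 0 < 1 / ((n:ℝ) + 1) := by positivity
    linarith

lemma bmp_tendsto (N : ℕ) : Tendsto (fun n => (bmp N n).rOut) atTop (𝓝 0) := by
  have := (tendsto_one_div_add_atTop_nhds_zero_nat (𝕜 := ℝ)).const_mul 2
  simpa [bmp] using this

def eta (N n : ℕ) : ES N → ℝ := (bmp N n).normed volume

lemma eta_smooth (N n : ℕ) : ContDiff ℝ (⊤ : ℕ∞) (eta N n) := (bmp N n).contDiff_normed
lemma eta_cs (N n : ℕ) : HasCompactSupport (eta N n) := (bmp N n).hasCompactSupport_normed
lemma eta_nonneg (N n : ℕ) (z : ES N) : 0 ≤ eta N n z := (bmp N n).nonneg_normed z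
lemma eta_int (N n : ℕ) : ∫ z, eta N n z = 1 := (bmp N n).integral_normed
lemma eta_integrable (N n : ℕ) : Integrable (eta N n) :=
  (eta_smooth N n).continuous.integrable_of_hasCompactSupport (eta_cs N n)
lemma eta_tsupport (N n : ℕ) : tsupport (eta N n) = closedBall 0 (bmp N n).rOut :=
  (bmp N n).tsupport_normed_eq

lemma lap_mol_sol {N : ℕ} {U : Set (ES N)} {V s : ES N → ℝ} (hs : WSol U V s)
    {W : Set (ES N)} (hW : IsCompact W) (hWU : W ⊆ U) {n : ℕ} {x : ES N}
    (hx : closedBall x (bmp N n).rOut ⊆ W) :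
    lap (mol (W.indicator s) (eta N n)) x = mol (W.indicator fun z => V z * s z) (eta N n) x := by
  have hsi : Integrable (W.indicator s) :=
    (integrable_indicator_iff hW.measurableSet).2 ((hs.1.mono hWU).integrableOn_compact hW)
  have hη2 : ContDiff ℝ 2 (eta N n) := contDiff_infty.1 (eta_smooth N n) 2
  rw [lap_mol hsi.locallyIntegrable hη2 (eta_cs N n), mol_apply, mol_apply]
  have hsm : ContDiff ℝ (⊤ : ℕ∞) (fun z => eta N n (x - z)) :=
    (eta_smooth N n).comp (contDiff_const.sub contDiff_id)
  have hz0 : ∀ z, z ∉ closedBall x (bmp N n).rOut → eta N n (x - z) = 0 := by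
    intro z hz
    refine image_eq_zero_of_notMem_tsupport fun h => hz ?_
    rw [eta_tsupport, mem_closedBall, dist_zero_right] at h
    rw [mem_closedBall, dist_comm, dist_eq_norm]
    exact h
  have hts : tsupport (fun z => eta N n (x - z)) ⊆ closedBall x (bmp N n).rOut := by
    refine closure_minimal (fun z hz => ?_) isClosed_closedBall
    by_contra h
    exact hz (hz0 z h)
  have htest : IsTestFun U (fun z => eta N n (x - z)) :=
    ⟨hsm, (isCompact_closedBall x _).of_isClosed_subset (isClosed_tsupport _) hts,
      hts.trans (hx.trans hWU)⟩
  have h := hs.2 _ htest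
  have e1 : ∀ z, W.indicator s z * lap (eta N n) (x - z) =
      s z * lap (fun z => eta N n (x - z)) z := by
    intro z
    rw [lap_reflect hη2]
    by_cases hz : z ∈ W
    · rw [indicator_of_mem hz]
    · rw [← lap_reflect hη2, lap_eq_zero (fun h' => hz (hx (hts h')))]; simp
  have e2 : ∀ z, W.indicator (fun z => V z * s z) z * eta N n (x - z) =
      V z * s z * eta N n (x - z) := by
    intro z
    by_cases hz : z ∈ W
    · rw [indicator_of_mem hz]
    · rw [hz0 z (fun h' => hz (hx h'))]; simp
  simp_rw [e1, e2]
  exact h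

end

section

open scoped Convolution

open scoped Convolution

lemma mol_unif {N : ℕ} {s : ES N → ℝ} {W W1 : Set (ES N)} {r : ℝ} (hr : 0 < r)
    (hW1 : IsCompact W1) (hs : ContinuousOn s W1) (hsub : ∀ x ∈ W, closedBall x r ⊆ W1)
    {ω : ℝ} (hω : 0 < ω) : ∀ᶠ n in atTop, ∀ x ∈ W, |mol (W1.indicator s) (eta N n) x - s x| ≤ ω := by
  have huc := hW1.uniformContinuousOn_of_continuous hs
  rw [Metric.uniformContinuousOn_iff] at huc
  obtain ⟨d, hd, hd'⟩ := huc ω hω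
  have h1 := (bmp_tendsto N).eventually (Iio_mem_nhds (lt_min hd hr))
  filter_upwards [h1] with n hn x hx
  have hn1 := lt_of_lt_of_le hn (min_le_left _ _)
  have hn2 := lt_of_lt_of_le hn (min_le_right _ _)
  have hxW : x ∈ W1 := hsub x hx (mem_closedBall_self hr.le)
  have hsi : Integrable (W1.indicator s) :=
    (integrable_indicator_iff hW1.measurableSet).2 (hs.integrableOn_compact hW1)
  have h2 := (bmp N n).dist_normed_convolution_le (μ := volume) (x₀ := x) (ε := ω)
    (g := W1.indicator s) hsi.aestronglyMeasurable (fun z hz => by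
      have hz1 : z ∈ W1 := hsub x hx (ball_subset_closedBall (ball_subset_ball hn2.le hz))
      rw [indicator_of_mem hz1, indicator_of_mem hxW]
      exact (hd' z hz1 x hxW (lt_trans hz hn1)).le)
  rw [indicator_of_mem hxW, Real.dist_eq] at h2
  rw [mol_comm]
  exact h2

set_option maxHeartbeats 1000000 in
lemma kato {N : ℕ} {U : Set (ES N)} (hU : IsOpen U) {V s b p : ES N → ℝ} (hV : Measurable V)
    (hV0 : ∀ x ∈ U, 0 ≤ V x) (hVb : ∀ K ⊆ U, IsCompact K → ∃ M : ℝ, ∀ x ∈ K, |V x| ≤ M)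
    (hs : WSol U V s) (hb : ContDiff ℝ (⊤ : ℕ∞) b) (hb0 : ∀ x ∈ U, 0 ≤ b x) {ε : ℝ} (hε : 0 < ε)
    {W : Set (ES N)} (hWdef : W = {x | x ∈ U ∧ ε / 2 ≤ s x - b x}) (hW : IsCompact W)
    (hp : IntegrableOn p W) (hp0 : ∀ x ∈ W, 0 ≤ p x) {τ : ℝ} (hτ : 0 < τ) :
    ∃ f, IsTestFun U f ∧ (∀ x, 0 ≤ f x) ∧ (∀ x, x ∉ W → f x = 0) ∧
      (∀ x ∈ U, s x - b x - 3 * ε ≤ f x) ∧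
      - (∫ x in W, p x * max (lap b x) 0) - τ ≤ ∫ x, p x * (lap f x - V x * f x) := by
  obtain ⟨T, hTs, hTz, hT0, hTl, hT1, hT2, hTc⟩ := exists_theta hε
  have hWU : W ⊆ U := by rw [hWdef]; exact fun x hx => hx.1
  obtain ⟨r, hr, hrU⟩ := hW.exists_cthickening_subset_open hU hWU
  set W1 := cthickening r W with hW1def
  have hW1 : IsCompact W1 := hW.cthickening
  set W2 := thickening (r / 2) W with hW2def
  have hW2o : IsOpen W2 := isOpen_thickening
  have hWW2 : W ⊆ W2 := self_subset_thickening (by positivity) W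
  have hW2b : ∀ x ∈ W2, closedBall x (r / 2) ⊆ W1 := by
    intro x hx z hz
    obtain ⟨w, hw, hxw⟩ := mem_thickening_iff.1 hx
    refine mem_cthickening_of_dist_le z w r W hw ?_
    have := dist_triangle z x w
    rw [mem_closedBall] at hz
    linarith
  have hW21 : W2 ⊆ W1 := fun x hx => hW2b x hx (mem_closedBall_self (by positivity))
  have hsc1 : ContinuousOn s W1 := hs.1.mono hrU
  obtain ⟨M, hM⟩ := hVb W1 hrU hW1
  obtain ⟨S, hS⟩ := hW1.exists_bound_of_continuousOn hsc1
  set M' := max M 0 with hM'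
  set S' := max S 0 with hS'
  have hM'0 : 0 ≤ M' := le_max_right _ _
  have hS'0 : 0 ≤ S' := le_max_right _ _
  have hMM : ∀ x ∈ W1, |V x| ≤ M' := fun x hx => (hM x hx).trans (le_max_left _ _)
  have hSS : ∀ x ∈ W1, |s x| ≤ S' := fun x hx => (hS x hx).trans (le_max_left _ _)
  set s1 := W1.indicator s with hs1
  set gv := W1.indicator (fun z => V z * s z) with hgv
  have hs1b : ∀ z, |s1 z| ≤ S' := by
    intro z
    by_cases hz : z ∈ W1
    · rw [hs1, indicator_of_mem hz]; exact hSS z hz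
    · rw [hs1, indicator_of_notMem hz]; simpa using hS'0
  have hgvb : ∀ z, |gv z| ≤ M' * S' := by
    intro z
    by_cases hz : z ∈ W1
    · rw [hgv, indicator_of_mem hz, abs_mul]
      exact mul_le_mul (hMM z hz) (hSS z hz) (abs_nonneg _) hM'0
    · rw [hgv, indicator_of_notMem hz]; simpa using mul_nonneg hM'0 hS'0
  have hs1i : Integrable s1 :=
    (integrable_indicator_iff hW1.measurableSet).2 (hsc1.integrableOn_compact hW1)
  have hgvi : Integrable gv := by
    refine (integrable_indicator_iff hW1.measurableSet).2 ?_
    exact Integrable.bdd_mul (c := M') (hsc1.integrableOn_compact hW1) hV.aestronglyMeasurable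
      ((ae_restrict_iff' hW1.measurableSet).2 (Eventually.of_forall hMM))
  set sd : ℕ → ES N → ℝ := fun n => mol s1 (eta N n) with hsd
  set vd : ℕ → ES N → ℝ := fun n => mol gv (eta N n) with hvd
  have hsds : ∀ n, ContDiff ℝ (⊤ : ℕ∞) (sd n) := fun n =>
    mol_contDiff hs1i.locallyIntegrable (eta_smooth N n) (eta_cs N n)
  have hvds : ∀ n, ContDiff ℝ (⊤ : ℕ∞) (vd n) := fun n =>
    mol_contDiff hgvi.locallyIntegrable (eta_smooth N n) (eta_cs N n)
  have hsdb : ∀ n x, |sd n x| ≤ S' := fun n x =>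
    mol_bound hs1b (eta_nonneg N n) (eta_integrable N n) (eta_int N n) x
  have hvdb : ∀ n x, |vd n x| ≤ M' * S' := fun n x =>
    mol_bound hgvb (eta_nonneg N n) (eta_integrable N n) (eta_int N n) x
  -- the error tends to zero
  have herr : Tendsto (fun n => ∫ x in W, p x * |vd n x - V x * sd n x|) atTop (𝓝 0) := by
    have h0 : (0:ℝ) = ∫ x in W, (0:ℝ) := by simp
    rw [h0]
    refine tendsto_integral_of_dominated_convergence (fun x => (M' * S' + M' * S') * |p x|) ?_ ?_ ?_ ?_
    · intro n
      refine hp.aestronglyMeasurable.mul ?_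
      exact (((hvds n).continuous.measurable.sub
        (hV.mul (hsds n).continuous.measurable)).norm).aestronglyMeasurable
    · exact hp.norm.const_mul _
    · intro n
      refine (ae_restrict_iff' hW.measurableSet).2 (Eventually.of_forall fun x hx => ?_)
      have h1 : |vd n x - V x * sd n x| ≤ M' * S' + M' * S' := by
        refine (abs_sub _ _).trans (add_le_add (hvdb n x) ?_)
        rw [abs_mul]
        exact mul_le_mul (hMM x (hW21 (hWW2 hx))) (hsdb n x) (abs_nonneg _) hM'0
      rw [norm_mul, Real.norm_eq_abs, Real.norm_eq_abs, abs_abs, mul_comm]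
      exact mul_le_mul_of_nonneg_right h1 (abs_nonneg _)
    · have h1 := ContDiffBump.ae_convolution_tendsto_right_of_locallyIntegrable (μ := volume)
        (φ := bmp N) (K := 2) (bmp_tendsto N) (Eventually.of_forall fun n => le_of_eq rfl)
        hgvi.locallyIntegrable
      rw [ae_restrict_iff' hW.measurableSet]
      filter_upwards [h1] with x hx hxW
      have hxW1 := hW21 (hWW2 hxW)
      have h2 : Tendsto (fun n => vd n x) atTop (𝓝 (V x * s x)) := by
        have : gv x = V x * s x := by rw [hgv, indicator_of_mem hxW1]
        rw [← this]
        refine hx.congr fun n => ?_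
        exact (mol_comm gv (eta N n) x).symm
      have h3 : Tendsto (fun n => sd n x) atTop (𝓝 (s x)) := by
        rw [Metric.tendsto_nhds]
        intro ω hω
        filter_upwards [mol_unif (half_pos hr) hW1 hsc1 hW2b (half_pos hω)] with n hn
        have := hn x (hWW2 hxW)
        rw [Real.dist_eq]
        exact lt_of_le_of_lt this (half_lt_self hω)
      have h4 := ((h2.sub (h3.const_mul (V x))).abs).const_mul (p x)
      simpa using h4
  have hE1 := herr.eventually (Iio_mem_nhds hτ)
  have hE2 := mol_unif (half_pos hr) hW1 hsc1 hW2b (half_pos hε)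
  have hE3 := (bmp_tendsto N).eventually (Iio_mem_nhds (half_pos hr))
  obtain ⟨n, hn1, hn2, hn3⟩ := (hE1.and (hE2.and hE3)).exists
  have hn1' : ∫ x in W, p x * |vd n x - V x * sd n x| < τ := hn1
  have hn2' : ∀ x ∈ W2, |sd n x - s x| ≤ ε / 2 := hn2
  have hn3' : (bmp N n).rOut < r / 2 := hn3
  classical
  set F : ES N → ℝ := fun x => T (sd n x - b x) with hF
  have hFs : ContDiff ℝ (⊤ : ℕ∞) F := hTs.comp ((hsds n).sub hb)
  set f : ES N → ℝ := fun x => if x ∈ W2 then F x else 0 with hf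
  have hf0 : ∀ x, x ∉ W → f x = 0 := by
    intro x hx
    by_cases h2 : x ∈ W2
    · have h3 : s x - b x < ε / 2 := by
        by_contra h
        push Not at h
        exact hx (by rw [hWdef]; exact ⟨hrU (hW21 h2), h⟩)
      have h4 := (abs_le.1 (hn2' x h2)).2
      simp only [hf, if_pos h2, hF]
      exact hTz _ (by linarith)
    · simp only [hf, if_neg h2]
  have hfF : ∀ x ∈ W2, f =ᶠ[𝓝 x] F := fun x hx => by
    filter_upwards [hW2o.mem_nhds hx] with z hz
    simp only [hf, if_pos hz]
  have hf0' : ∀ x, x ∉ W → f =ᶠ[𝓝 x] fun _ => 0 := fun x hx => by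
    filter_upwards [hW.isClosed.isOpen_compl.mem_nhds hx] with z hz
    exact hf0 z hz
  have hfs : ContDiff ℝ (⊤ : ℕ∞) f := by
    rw [contDiff_iff_contDiffAt]
    intro x
    by_cases hx : x ∈ W
    · exact hFs.contDiffAt.congr_of_eventuallyEq (hfF x (hWW2 hx))
    · exact contDiffAt_const.congr_of_eventuallyEq (hf0' x hx)
  have hfn : ∀ x, 0 ≤ f x := by
    intro x
    simp only [hf]
    split_ifs
    · exact hT0 _
    · exact le_rfl
  have hts : tsupport f ⊆ W := closure_minimal (fun x hx => by
    by_contra h; exact hx (hf0 x h)) hW.isClosed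
  have htest : IsTestFun U f :=
    ⟨hfs, hW.of_isClosed_subset (isClosed_tsupport _) hts, hts.trans hWU⟩
  refine ⟨f, htest, hfn, hf0, ?_, ?_⟩
  · intro x hx
    by_cases hxW : x ∈ W
    · have h4 := (abs_le.1 (hn2' x (hWW2 hxW))).1
      simp only [hf, if_pos (hWW2 hxW), hF]
      have := hTl (sd n x - b x)
      linarith
    · rw [hf0 x hxW]
      have : s x - b x < ε / 2 := by
        by_contra h
        push Not at h
        exact hxW (by rw [hWdef]; exact ⟨hx, h⟩)
      linarith
  · have hb2 : ContDiff ℝ 2 b := contDiff_infty.1 hb 2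
    have hs2 : ContDiff ℝ 2 (sd n) := contDiff_infty.1 (hsds n) 2
    have hT2' : ContDiff ℝ 2 T := contDiff_infty.1 hTs 2
    have hpt : ∀ x ∈ W, -(max (lap b x) 0) - |vd n x - V x * sd n x| ≤ lap f x - V x * f x := by
      intro x hx
      have hx2 := hWW2 hx
      have e1 : lap f x = deriv (deriv T) (sd n x - b x) * gradsq (fun x => sd n x - b x) x
          + deriv T (sd n x - b x) * (vd n x - lap b x) := by
        rw [lap_congr (hfF x hx2), hF, lap_comp (u := fun x => sd n x - b x) (hs2.sub hb2) hT2',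
          lap_sub hs2 hb2]
        rw [lap_mol_sol hs hW1 hrU ((closedBall_subset_closedBall hn3'.le).trans (hW2b x hx2))]
      have e2 : f x = T (sd n x - b x) := by simp only [hf, if_pos hx2, hF]
      rw [e1, e2]
      set σ := sd n x - b x with hσ
      have a1 := mul_nonneg (hT2 σ) (gradsq_nonneg (fun x => sd n x - b x) x)
      have a2 := (hT1 σ).1
      have a3 := (hT1 σ).2
      have a4 := hV0 x (hWU hx)
      have a5 := hb0 x (hWU hx)
      have a6 : V x * T σ ≤ V x * (sd n x * deriv T σ) := by
        refine mul_le_mul_of_nonneg_left ((hTc σ).trans ?_) a4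
        exact mul_le_mul_of_nonneg_right (by linarith) a2
      have a7 : deriv T σ * lap b x ≤ max (lap b x) 0 := by
        calc deriv T σ * lap b x ≤ deriv T σ * max (lap b x) 0 :=
              mul_le_mul_of_nonneg_left (le_max_left _ _) a2
          _ ≤ 1 * max (lap b x) 0 := mul_le_mul_of_nonneg_right a3 (le_max_right _ _)
          _ = _ := one_mul _
      have a8 : -|vd n x - V x * sd n x| ≤ deriv T σ * (vd n x - V x * sd n x) := by
        calc -|vd n x - V x * sd n x| ≤ - (deriv T σ * |vd n x - V x * sd n x|) := by
              have := mul_le_mul_of_nonneg_right a3 (abs_nonneg (vd n x - V x * sd n x))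
              linarith
          _ = deriv T σ * (-|vd n x - V x * sd n x|) := by ring
          _ ≤ _ := mul_le_mul_of_nonneg_left (neg_abs_le _) a2
      have e3 : deriv T σ * (vd n x - V x * sd n x) =
        deriv T σ * vd n x - V x * (sd n x * deriv T σ) := by ring
      have e4 : deriv T σ * (vd n x - lap b x) = deriv T σ * vd n x - deriv T σ * lap b x := by ring
      linarith
    have hz : ∀ x, x ∉ W → p x * (lap f x - V x * f x) = 0 := by
      intro x hx
      rw [hf0 x hx, lap_eq_zero (fun h => hx (hts h))]; simp
    rw [← setIntegral_eq_integral_of_forall_compl_eq_zero hz]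
    have hMW : ∀ x ∈ W, |V x| ≤ M' := fun x hx => hMM x (hW21 (hWW2 hx))
    have hbdd : ∀ {q : ES N → ℝ} {B : ℝ}, Measurable q → (∀ x ∈ W, |q x| ≤ B) →
        IntegrableOn (fun x => p x * q x) W := by
      intro q B hq hB
      exact Integrable.mul_bdd (c := B) hp hq.aestronglyMeasurable
        ((ae_restrict_iff' hW.measurableSet).2 (Eventually.of_forall hB))
    obtain ⟨B1, hB1⟩ := hW.exists_bound_of_continuousOn (lap_continuous hb2).continuousOn
    obtain ⟨B2, hB2⟩ := hW.exists_bound_of_continuousOn (lap_continuous htest.c2).continuousOn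
    obtain ⟨B3, hB3⟩ := hW.exists_bound_of_continuousOn hfs.continuous.continuousOn
    have i1 : IntegrableOn (fun x => p x * max (lap b x) 0) W :=
      hbdd (B := B1) ((lap_continuous hb2).max continuous_const).measurable (fun x hx => by
        rw [abs_of_nonneg (le_max_right _ _)]
        exact max_le ((le_abs_self _).trans (hB1 x hx)) ((norm_nonneg _).trans (hB1 x hx)))
    have i2 : IntegrableOn (fun x => p x * |vd n x - V x * sd n x|) W :=
      hbdd (B := M' * S' + M' * S') (((hvds n).continuous.measurable.sub
        (hV.mul (hsds n).continuous.measurable)).norm) (fun x hx => by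
        rw [abs_abs]
        refine (abs_sub _ _).trans (add_le_add (hvdb n x) ?_)
        rw [abs_mul]
        exact mul_le_mul (hMW x hx) (hsdb n x) (abs_nonneg _) hM'0)
    have i3 : IntegrableOn (fun x => p x * (lap f x - V x * f x)) W :=
      hbdd (B := B2 + M' * B3) ((lap_continuous htest.c2).measurable.sub
        (hV.mul hfs.continuous.measurable)) (fun x hx => by
        refine (abs_sub _ _).trans (add_le_add (hB2 x hx) ?_)
        rw [abs_mul]
        exact mul_le_mul (hMW x hx) (hB3 x hx) (abs_nonneg _) hM'0)
    have h1 : ∫ x in W, (-(p x * max (lap b x) 0) - p x * |vd n x - V x * sd n x|) ≤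
        ∫ x in W, p x * (lap f x - V x * f x) := by
      refine setIntegral_mono_on (i1.neg.sub i2) i3 hW.measurableSet fun x hx => ?_
      have := mul_le_mul_of_nonneg_left (hpt x hx) (hp0 x hx)
      linarith
    have h2 := integral_sub (f := fun x => -(p x * max (lap b x) 0)) i1.neg i2
    rw [integral_neg] at h2
    rw [h2] at h1
    linarith

end

section

set_option maxHeartbeats 1000000 in
/-- comparison on an annulus around a boundary point -/
lemma sphereComp (N : ℕ) (hN : 0 < N) (Λ A : ℝ) (hΛ : 1 ≤ Λ) : ∃ C : ℝ, 1 ≤ C ∧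
    ∀ (H : ES N → ℝ) (e : ES N), Grph Λ H e → ∀ (V V' u v : ES N → ℝ) (y : ES N) (R : ℝ), 0 < R →
      H y = 0 → NSol H A V u (ball y (100 * Λ * R)) → NSol H A V' v (ball y (100 * Λ * R)) →
      (∀ x, 0 < H x → x ∈ ball y (100 * Λ * R) → V' x ≤ V x) →
      Vanish H u (ball y (100 * Λ * R) \ {y}) →
      ∀ x, 0 < H x → R / 2 ≤ dist x y → dist x y ≤ 2 * R →
        u x * v (y + R • e) ≤ C * (v x * u (y + R • e)) := by
  have hΛ0 : 0 < Λ := by linarith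
  set c : ℝ := 1 / (2000 * Λ ^ 3) with hc
  have hc0 : 0 < c := by positivity
  have hΛ3 : 1 ≤ Λ ^ 3 := one_le_pow₀ hΛ
  have hc1 : c ≤ 1 / 2000 := by
    rw [hc]; apply one_div_le_one_div_of_le (by norm_num); linarith
  have hcc : 400 * Λ ^ 3 * c = 1 / 5 := by rw [hc]; field_simp; norm_num
  obtain ⟨C₁, hC₁, hbhp⟩ := bhp N hN Λ A hΛ
  obtain ⟨C₂, hC₂, hhar⟩ := harnackGraph N Λ A (c / 4) hΛ (by positivity)
  have hC₁0 : 0 < C₁ := by linarith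
  have hC₂0 : 0 < C₂ := by linarith
  have hC22 : 1 ≤ C₂ * C₂ := one_le_mul_of_one_le_of_one_le hC₂ hC₂
  have hCC : 1 ≤ C₁ * (C₂ * C₂) := one_le_mul_of_one_le_of_one_le hC₁ hC22
  refine ⟨C₁ * (C₂ * C₂), hCC, ?_⟩
  intro H e g V V' u v y R hR hy hu hv hVV hvan x hx hxl hxu
  have hRΛ : R ≤ Λ * R := by nlinarith
  have hsubH : ball y (10 * Λ * (4 * R)) ⊆ ball y (100 * Λ * R) := ball_subset_ball (by nlinarith)
  have hAd : dist (y + R • e) y = R := by rw [g.dist_shift, abs_of_pos hR]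
  have hAH : H (y + R • e) = R := by rw [g.shift, hy, zero_add]
  have hAb : y + R • e ∈ ball y (100 * Λ * R) := by rw [mem_ball, hAd]; linarith
  have hxb : x ∈ ball y (100 * Λ * R) := by rw [mem_ball]; linarith
  have huA := hu.nn _ (by rw [hAH]; exact hR) hAb
  have hvA := hv.nn _ (by rw [hAH]; exact hR) hAb
  have hux := hu.nn x hx hxb
  have hvx := hv.nn x hx hxb
  have hq : c / 4 * (4 * R) = c * R := by ring
  have hcR : c * R ≤ 1 / 2000 * R := by gcongr
  have hcR0 : 0 < c * R := by positivity
  have har : ∀ (V u : ES N → ℝ), NSol H A V u (ball y (100 * Λ * R)) → ∀ p p',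
      dist p y ≤ 4 * R → dist p' y ≤ 4 * R → c * R ≤ H p → c * R ≤ H p' → u p ≤ C₂ * u p' := by
    intro V u hu p p' hp hp' hH hH'
    exact hhar H e g V u y (4 * R) (by positivity) (hu.mono hsubH) p p' hp hp'
      (by rw [hq]; exact hH) (by rw [hq]; exact hH')
  rcases le_or_gt (c * R) (H x) with h | h
  · have h1 := har V u hu x (y + R • e) (by linarith) (by linarith) h (by linarith)
    have h2 := har V' v hv (y + R • e) x (by linarith) (by linarith) (by linarith) h
    calc u x * v (y + R • e) ≤ (C₂ * u (y + R • e)) * (C₂ * v x) :=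
          mul_le_mul h1 h2 hvA (by positivity)
      _ = 1 * ((C₂ * C₂) * (v x * u (y + R • e))) := by ring
      _ ≤ C₁ * ((C₂ * C₂) * (v x * u (y + R • e))) := by gcongr
      _ = _ := by ring
  · set z := x + (-(H x)) • e with hzdef
    have hz0 : H z = 0 := by rw [hzdef, g.shift]; ring
    have hxz : dist x z = H x := by rw [hzdef, g.dist_shift', abs_neg, abs_of_pos hx]
    have hzy1 : dist z y ≤ dist x y + H x := by
      have := dist_triangle_left z y x; linarith
    have hzy2 : dist x y ≤ H x + dist z y := by
      have := dist_triangle x z y; linarith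
    have hr : 400 * Λ ^ 3 * (c * R) = R / 5 := by rw [← mul_assoc, hcc]; ring
    have hzb : ball z (400 * Λ ^ 3 * (c * R)) ⊆ ball y (100 * Λ * R) := by
      refine ball_subset_ball' ?_
      rw [hr]; linarith
    have hzb' : ball z (400 * Λ ^ 3 * (c * R)) ⊆ ball y (100 * Λ * R) \ {y} := by
      intro p hp
      refine ⟨hzb hp, ?_⟩
      rintro rfl
      rw [mem_ball, hr, dist_comm] at hp
      linarith
    have h1 := hbhp H e g V V' u v z (c * R) hcR0 hz0 (hu.mono hzb) (hv.mono hzb)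
      (fun x h1 h2 => hVV x h1 (hzb h2)) (hvan.mono hzb') x hx (by rw [mem_ball, hxz]; exact h)
    set B := z + (c * R) • e with hB
    have hBH : H B = c * R := by rw [hB, g.shift, hz0, zero_add]
    have hBz : dist B z = c * R := by rw [hB, g.dist_shift, abs_of_pos hcR0]
    have hBy : dist B y ≤ 4 * R := by
      have := dist_triangle B z y; linarith
    have h2 := har V u hu B (y + R • e) hBy (by linarith) (by linarith) (by linarith)
    have h3 := har V' v hv (y + R • e) B (by linarith) hBy (by linarith) (by linarith)
    calc u x * v (y + R • e) ≤ u x * (C₂ * v B) := by gcongr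
      _ = C₂ * (u x * v B) := by ring
      _ ≤ C₂ * (C₁ * (v x * u B)) := by gcongr
      _ ≤ C₂ * (C₁ * (v x * (C₂ * u (y + R • e)))) := by gcongr
      _ = _ := by ring

lemma NSol.one {N : ℕ} {H : ES N → ℝ} {A : ℝ} (hA : 0 ≤ A) (S : Set (ES N)) :
    NSol H A (fun _ => 0) (fun _ => 1) S := by
  refine ⟨measurable_const, ⟨continuousOn_const, fun φ hφ => ?_⟩, fun _ _ _ => le_rfl,
    fun _ _ _ => by simpa using hA, fun _ _ _ => zero_le_one⟩
  simp [integral_lap_test hφ]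

/-- upper bound on an annulus around a boundary point -/
lemma annulusBound (N : ℕ) (hN : 0 < N) (Λ A : ℝ) (hΛ : 1 ≤ Λ) (hA : 0 ≤ A) : ∃ C : ℝ, 1 ≤ C ∧
    ∀ (H : ES N → ℝ) (e : ES N), Grph Λ H e → ∀ (V u : ES N → ℝ) (y : ES N) (R : ℝ), 0 < R →
      H y = 0 → NSol H A V u (ball y (100 * Λ * R)) →
      Vanish H u (ball y (100 * Λ * R) \ {y}) →
      ∀ x, 0 < H x → R / 2 ≤ dist x y → dist x y ≤ 2 * R → u x ≤ C * u (y + R • e) := by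
  obtain ⟨C, hC, h⟩ := sphereComp N hN Λ A hΛ
  refine ⟨C, hC, fun H e g V u y R hR hy hu hvan x hx h1 h2 => ?_⟩
  have := h H e g V (fun _ => 0) u (fun _ => 1) y R hR hy hu (NSol.one hA _)
    (fun x h1 h2 => hu.V0 x h1 h2) hvan x hx h1 h2
  simpa using this

/-- local graph structure near a boundary point -/
structure Loc {N : ℕ} (Ω : Set (ES N)) (x₀ y : ES N) (Λ : ℝ) (H : ES N → ℝ) (e : ES N) (ρ : ℝ) :
    Prop where
  g : Grph Λ H e
  Hy : H y = 0
  ρpos : 0 < ρ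
  mem : ∀ x ∈ ball y ρ, (x ∈ Ω ↔ 0 < H x)
  dis : ∀ x ∈ ball y ρ, 0 < H x → H x ≤ Λ * dista Ω x
  x0 : ρ ≤ dist x₀ y
  opn : IsOpen Ω

lemma exists_loc {N : ℕ} {Ω : Set (ES N)} (hΩ : IsLipschitzDomain Ω) {x₀ y : ES N} (hx₀ : x₀ ∈ Ω)
    (hy : y ∈ frontier Ω) : ∃ Λ H e ρ, Loc Ω x₀ y Λ H e ρ := by
  obtain ⟨g, i, f, L, ε, hε, hf, hfi, hmem⟩ := hΩ.2.2 y hy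
  have hyΩ : y ∉ Ω := fun h => by
    have := hΩ.1.frontier_eq ▸ hy
    exact this.2 h
  set H : ES N → ℝ := fun x => g x i - f (g x) with hH
  set Λ : ℝ := 1 + L with hΛ
  have hL : (0:ℝ) ≤ L := L.coe_nonneg
  have hlip : ∀ x x', |H x - H x'| ≤ Λ * dist x x' := by
    intro x x'
    have h1 : |f (g x) - f (g x')| ≤ L * dist x x' := by
      have := hf.dist_le_mul (g x) (g x')
      rwa [g.dist_map, Real.dist_eq] at this
    have h2 : |g x i - g x' i| ≤ dist x x' := by
      have h3 := PiLp.norm_apply_le (g x - g x') i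
      rw [← dist_eq_norm, g.dist_map] at h3
      simpa using h3
    simp only [hH]
    calc |g x i - f (g x) - (g x' i - f (g x'))| =
        |(g x i - g x' i) - (f (g x) - f (g x'))| := by congr 1; ring
      _ ≤ |g x i - g x' i| + |f (g x) - f (g x')| := abs_sub _ _
      _ ≤ dist x x' + L * dist x x' := add_le_add h2 h1
      _ = _ := by rw [hΛ]; ring
  set e : ES N := g.symm (EuclideanSpace.single i 1) with he
  have hgr : Grph Λ H e := by
    refine ⟨by linarith, hlip, ?_, ?_⟩
    · rw [he, g.symm.norm_map]; simp
    · intro x s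
      have h1 : g (x + s • e) = g x + s • EuclideanSpace.single i 1 := by
        rw [map_add, map_smul, he, g.apply_symm_apply]
      have h2 : f (g (x + s • e)) = f (g x) := by
        refine hfi _ _ fun j hj => ?_
        rw [h1]; simp [hj]
      simp only [hH, h2]
      rw [h1]
      simp
      ring
  have hmem' : ∀ x ∈ ball y ε, (x ∈ Ω ↔ 0 < H x) := fun x hx => by
    rw [hmem x hx]; simp only [hH, sub_pos]
  have hHy : H y = 0 := by
    have h1 : H y ≤ 0 := by
      by_contra h
      push Not at h
      exact hyΩ ((hmem' y (mem_ball_self hε)).2 h)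
    refine le_antisymm h1 ?_
    have hycl : y ∈ closure Ω := frontier_subset_closure hy
    refine le_of_forall_pos_le_add fun δ hδ => ?_
    obtain ⟨x, hx, hxd⟩ := Metric.mem_closure_iff.1 hycl (min ε (δ / Λ)) (lt_min hε
      (div_pos hδ hgr.pos))
    rw [lt_min_iff, lt_div_iff₀ hgr.pos] at hxd
    have h2 := (hmem' x (by rw [mem_ball, dist_comm]; exact hxd.1)).1 hx
    have h3 := hgr.le x y
    rw [dist_comm x y] at h3
    nlinarith
  have hdp : 0 < dist x₀ y := dist_pos.2 (fun h => hyΩ (h ▸ hx₀))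
  refine ⟨Λ, H, e, min (ε / 4) (dist x₀ y), hgr, hHy, lt_min (by positivity) hdp, ?_, ?_,
    min_le_right _ _, hΩ.1⟩
  · exact fun x hx => hmem' x (ball_subset_ball ((min_le_left _ _).trans (by linarith)) hx)
  · intro x hx hxH
    have hxy : dist x y < ε / 4 := lt_of_lt_of_le hx (min_le_left _ _)
    have hΛp := hgr.pos
    rw [← div_le_iff₀' hΛp, dista]
    refine (le_infDist ⟨y, hyΩ⟩).2 fun z hz => ?_
    rw [div_le_iff₀' hΛp]
    by_cases hzb : z ∈ ball y ε
    · have h1 : H z ≤ 0 := by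
        by_contra h
        push Not at h
        exact hz ((hmem' z hzb).2 h)
      linarith [hgr.le x z]
    · rw [mem_ball, not_lt] at hzb
      have h1 := hgr.le x y
      have h2 := dist_triangle_left z y x
      rw [hHy] at h1
      have h3 : dist x y ≤ dist x z := by linarith
      have := mul_le_mul_of_nonneg_left h3 hΛp.le
      linarith

end

section

/-- admissible potentials -/
structure VC {N : ℕ} (Ω : Set (ES N)) (a : ℝ) (V : ES N → ℝ) : Prop where
  meas : Measurable V
  V0 : ∀ x ∈ Ω, 0 ≤ V x
  VA : ∀ x ∈ Ω, V x * dista Ω x ^ 2 ≤ a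
  bdd : ∀ K ⊆ Ω, IsCompact K → ∃ M : ℝ, ∀ x ∈ K, |V x| ≤ M

lemma VC.of_class {N : ℕ} {Ω : Set (ES N)} {a : ℝ} {V : ES N → ℝ} (hV : VClass Ω a V)
    (hΩ : IsOpen Ω) {y : ES N} (hy : y ∉ Ω) : VC Ω a V := by
  refine ⟨hV.1, fun x hx => (hV.2 x hx).1, fun x hx => (hV.2 x hx).2, fun K hK hKc => ?_⟩
  rcases K.eq_empty_or_nonempty with h | hne
  · exact ⟨0, fun x hx => by simp [h] at hx⟩
  obtain ⟨p, hp, hm⟩ := hKc.exists_isMinOn hne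
    (continuous_infDist_pt (Ωᶜ)).continuousOn
  have hpos : 0 < infDist p Ωᶜ := by
    rw [← hΩ.isClosed_compl.notMem_iff_infDist_pos ⟨y, hy⟩]
    exact fun h => h (hK hp)
  refine ⟨a / infDist p Ωᶜ ^ 2, fun x hx => ?_⟩
  have h1 := hV.2 x (hK hx)
  rw [abs_of_nonneg h1.1, le_div_iff₀ (by positivity)]
  refine le_trans ?_ h1.2
  have h2 : infDist p Ωᶜ ≤ infDist x Ωᶜ := hm hx
  have h3 := h1.1
  unfold dista
  gcongr

lemma VC.integrable {N : ℕ} {Ω : Set (ES N)} {a : ℝ} {V u φ : ES N → ℝ} (hV : VC Ω a V)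
    {U : Set (ES N)} (hU : U ⊆ Ω) (hφ : IsTestFun U φ) (hu : ContinuousOn u U) :
    Integrable fun x => V x * u x * φ x := by
  obtain ⟨M, hM⟩ := hV.bdd _ (hφ.2.2.trans hU) hφ.2.1
  exact integrable_pot hφ.2.1 hV.meas (hu.mono hφ.2.2) hφ.1.continuous.continuousOn
    (fun x hx => image_eq_zero_of_notMem_tsupport hx) hM

/-- Martin type functions -/
structure KT {N : ℕ} (Ω : Set (ES N)) (V : ES N → ℝ) (y : ES N) (u : ES N → ℝ) : Prop where
  sol : WSol Ω V u
  nn : ∀ x ∈ Ω, 0 ≤ u x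
  van : ∀ z ∈ frontier Ω, z ≠ y → ∀ ε > 0, ∀ᶠ x in 𝓝[Ω] z, u x < ε

/-- Green type functions -/
structure GT {N : ℕ} (Ω : Set (ES N)) (V : ES N → ℝ) (x₀ : ES N) (G : ES N → ℝ) : Prop where
  sol : WSol (Ω \ {x₀}) V G
  pos : ∀ x ∈ Ω \ {x₀}, 0 < G x
  van : ∀ z ∈ frontier Ω, ∀ ε > 0, ∀ᶠ x in 𝓝[Ω] z, G x < ε
  li : LocallyIntegrableOn G Ω
  rep : ∀ φ, IsTestFun Ω φ → ∫ x, G x * (lap φ x - V x * φ x) = - φ x₀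

lemma LVHarmonic.wsol {N : ℕ} {Ω : Set (ES N)} {V u : ES N → ℝ} (h : LVHarmonic Ω V u) :
    WSol Ω V u := by
  refine ⟨h.1, fun φ hφ => ?_⟩
  have e1 : ∫ x in Ω, u x * lap φ x = ∫ x, u x * lap φ x :=
    setIntegral_eq_integral_of_forall_compl_eq_zero
      (fun x hx => by rw [hφ.lap_out hx, mul_zero])
  have e2 : ∫ x in Ω, V x * u x * φ x = ∫ x, V x * u x * φ x :=
    setIntegral_eq_integral_of_forall_compl_eq_zero
      (fun x hx => by rw [hφ.zero_out hx, mul_zero])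
  rw [← e1, ← e2]
  exact h.2.2.2 φ hφ

lemma KT.of_martin {N : ℕ} {Ω : Set (ES N)} {V u : ES N → ℝ} {x₀ y : ES N}
    (h : IsMartinKernel Ω V x₀ y u) : KT Ω V y u :=
  ⟨h.1.wsol, fun x hx => (h.2.1 x hx).le, fun z hz hzy _ hε =>
    (h.2.2.2 z hz hzy).eventually (Iio_mem_nhds hε)⟩

lemma GT.of_green {N : ℕ} {Ω : Set (ES N)} (hΩ : IsOpen Ω) {a : ℝ} {V G : ES N → ℝ} {x₀ : ES N}
    (hx₀ : x₀ ∈ Ω) (hV : VC Ω a V) (h : IsGreenFunction Ω V x₀ G) : GT Ω V x₀ G := by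
  have hrep : ∀ φ, IsTestFun Ω φ → ∫ x, G x * (lap φ x - V x * φ x) = - φ x₀ := by
    intro φ hφ
    rw [← setIntegral_eq_integral_of_forall_compl_eq_zero (s := Ω)
      (fun x hx => by rw [hφ.lap_out hx, hφ.zero_out hx]; simp)]
    exact h.2.2.2.2 φ hφ
  refine ⟨⟨h.1, fun φ hφ => ?_⟩, h.2.1, ?_, h.2.2.1, hrep⟩
  · have h1 := hrep φ (hφ.mono sdiff_subset)
    rw [hφ.zero_out (by simp : x₀ ∉ Ω \ {x₀})] at h1
    have i1 := hφ.integrable_lap h.1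
    have i2 := hV.integrable sdiff_subset hφ h.1
    have e1 : ∀ x, G x * (lap φ x - V x * φ x) = G x * lap φ x - V x * G x * φ x := fun x => by ring
    simp_rw [e1] at h1
    rw [integral_sub i1 i2] at h1
    linarith
  · intro z hz ε hε
    have hzx : z ≠ x₀ := by
      rintro rfl
      rw [hΩ.frontier_eq] at hz
      exact hz.2 hx₀
    have h1 := (h.2.2.2.1 z hz).eventually (Iio_mem_nhds hε)
    rw [eventually_nhdsWithin_iff] at h1 ⊢
    filter_upwards [h1, isOpen_ne.mem_nhds hzx] with x hx hx2 hx3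
    exact hx ⟨hx3, hx2⟩

section
variable {N : ℕ} {Ω : Set (ES N)} {x₀ y : ES N} {Λ : ℝ} {H : ES N → ℝ} {e : ES N} {ρ : ℝ}

lemma Loc.y_notMem (L : Loc Ω x₀ y Λ H e ρ) : y ∉ Ω := fun h => by
  have := (L.mem y (mem_ball_self L.ρpos)).1 h
  rw [L.Hy] at this
  exact lt_irrefl _ this

lemma Loc.nsol (L : Loc Ω x₀ y Λ H e ρ) {a : ℝ} {V u : ES N → ℝ} (hV : VC Ω a V)
    {U : Set (ES N)} (hU : Ω ∩ ball y ρ ⊆ U) (hu : WSol U V u)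
    (hnn : ∀ x ∈ Ω ∩ ball y ρ, 0 ≤ u x) : NSol H (a * Λ ^ 2) V u (ball y ρ) := by
  have hm : ∀ x, 0 < H x → x ∈ ball y ρ → x ∈ Ω := fun x h1 h2 => (L.mem x h2).2 h1
  refine ⟨hV.meas, hu.mono fun x hx => hU ⟨hm x hx.1 hx.2, hx.2⟩,
    fun x h1 h2 => hV.V0 x (hm x h1 h2), fun x h1 h2 => ?_, fun x h1 h2 => hnn x ⟨hm x h1 h2, h2⟩⟩
  have h3 := L.dis x h2 h1
  have h4 := hV.V0 x (hm x h1 h2)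
  calc V x * H x ^ 2 ≤ V x * (Λ * dista Ω x) ^ 2 := by gcongr
    _ = V x * dista Ω x ^ 2 * Λ ^ 2 := by ring
    _ ≤ a * Λ ^ 2 := mul_le_mul_of_nonneg_right (hV.VA x (hm x h1 h2)) (sq_nonneg _)

lemma Loc.mem_frontier (L : Loc Ω x₀ y Λ H e ρ) {ζ : ES N} (hζ : ζ ∈ ball y ρ) (h0 : H ζ = 0) :
    ζ ∈ frontier Ω := by
  rw [L.opn.frontier_eq]
  refine ⟨?_, fun h => by
    have := (L.mem ζ hζ).1 h
    rw [h0] at this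
    exact lt_irrefl _ this⟩
  rw [Metric.mem_closure_iff]
  intro ε hε
  have hd : 0 < ρ - dist ζ y := sub_pos.2 hζ
  set s := min ε (ρ - dist ζ y) / 2 with hs
  have hm : 0 < min ε (ρ - dist ζ y) := lt_min hε hd
  have hs0 : 0 < s := by positivity
  have hs1 : s < ε := by have := min_le_left ε (ρ - dist ζ y); linarith
  have hs2 : s < ρ - dist ζ y := by have := min_le_right ε (ρ - dist ζ y); linarith
  have hd2 : dist (ζ + s • e) ζ = s := by rw [L.g.dist_shift, abs_of_pos hs0]
  refine ⟨ζ + s • e, (L.mem _ ?_).2 (by rw [L.g.shift, h0]; linarith), ?_⟩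
  · rw [mem_ball]
    have := dist_triangle (ζ + s • e) ζ y
    linarith
  · rw [dist_comm, hd2]; exact hs1

lemma Loc.vanish (L : Loc Ω x₀ y Λ H e ρ) {u : ES N → ℝ} {S : Set (ES N)} (hS : S ⊆ ball y ρ)
    (h : ∀ z ∈ frontier Ω, z ∈ S → ∀ ε > 0, ∀ᶠ x in 𝓝[Ω] z, u x < ε) : Vanish H u S := by
  intro ζ hζ h0 ε hε
  have h1 := h ζ (L.mem_frontier (hS hζ) h0) hζ ε hε
  rw [eventually_nhdsWithin_iff] at h1 ⊢
  filter_upwards [h1, isOpen_ball.mem_nhds (hS hζ)] with x hx hx2 hx3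
  exact hx ((L.mem x hx2).2 hx3)

lemma KT.nsol (L : Loc Ω x₀ y Λ H e ρ) {a : ℝ} {V u : ES N → ℝ} (hV : VC Ω a V)
    (hu : KT Ω V y u) : NSol H (a * Λ ^ 2) V u (ball y ρ) :=
  L.nsol hV inter_subset_left hu.sol fun x hx => hu.nn x hx.1

lemma KT.vanish (L : Loc Ω x₀ y Λ H e ρ) {V u : ES N → ℝ} (hu : KT Ω V y u) :
    Vanish H u (ball y ρ \ {y}) :=
  L.vanish sdiff_subset fun z hz hzS => hu.van z hz hzS.2

lemma Loc.x0_notMem (L : Loc Ω x₀ y Λ H e ρ) : x₀ ∉ ball y ρ := fun h => by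
  have := L.x0
  rw [mem_ball] at h
  linarith

lemma GT.nsol (L : Loc Ω x₀ y Λ H e ρ) {a : ℝ} {V G : ES N → ℝ} (hV : VC Ω a V)
    (hG : GT Ω V x₀ G) : NSol H (a * Λ ^ 2) V G (ball y ρ) := by
  have : Ω ∩ ball y ρ ⊆ Ω \ {x₀} := fun x hx => ⟨hx.1, fun h => L.x0_notMem (h ▸ hx.2)⟩
  exact L.nsol hV this hG.sol fun x hx => (hG.pos x (this hx)).le

lemma GT.vanish (L : Loc Ω x₀ y Λ H e ρ) {V G : ES N → ℝ} (hG : GT Ω V x₀ G) :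
    Vanish H G (ball y ρ) := L.vanish Subset.rfl fun z hz _ => hG.van z hz

end

set_option maxHeartbeats 1000000 in
/-- comparison outside a ball centered at `y` -/
lemma outerComp {N : ℕ} (hN : 0 < N) {Ω : Set (ES N)} (hbd : Bornology.IsBounded Ω)
    {x₀ y : ES N} {Λ : ℝ} {H : ES N → ℝ} {e : ES N} {ρ : ℝ} (L : Loc Ω x₀ y Λ H e ρ) {a : ℝ}
    {V V' u v : ES N → ℝ} (hV : VC Ω a V) (hV' : VC Ω a V') (hVV : ∀ x ∈ Ω, V' x ≤ V x)
    (hu : KT Ω V y u) (hv : KT Ω V' y v) : ∃ C : ℝ, 1 ≤ C ∧ ∀ R : ℝ, 0 < R → 100 * Λ * R ≤ ρ →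
      ∀ x ∈ Ω, R < dist x y → u x * v (y + R • e) ≤ C * (v x * u (y + R • e)) := by
  obtain ⟨C, hC, hsph⟩ := sphereComp N hN Λ (a * Λ ^ 2) L.g.one_le
  refine ⟨C, hC, fun R hR hRρ => ?_⟩
  have hΛ := L.g.one_le
  have hRΛ : R ≤ Λ * R := by nlinarith
  have hb : ball y (100 * Λ * R) ⊆ ball y ρ := ball_subset_ball hRρ
  have hAd : dist (y + R • e) y = R := by rw [L.g.dist_shift, abs_of_pos hR]
  have hAΩ : y + R • e ∈ Ω := (L.mem _ (by rw [mem_ball, hAd]; linarith)).2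
    (by rw [L.g.shift, L.Hy]; linarith)
  have huA := hu.nn _ hAΩ
  have hvA := hv.nn _ hAΩ
  have hC0 : 0 ≤ C * u (y + R • e) := mul_nonneg (by linarith) huA
  have hs : ∀ x ∈ Ω, R / 2 ≤ dist x y → dist x y ≤ 2 * R →
      u x * v (y + R • e) ≤ C * (v x * u (y + R • e)) := by
    intro x hx h1 h2
    have hxb : x ∈ ball y (100 * Λ * R) := by rw [mem_ball]; linarith
    exact hsph H e L.g V V' u v y R hR L.Hy ((hu.nsol L hV).mono hb) ((hv.nsol L hV').mono hb)
      (fun x h1 h2 => hVV x ((L.mem x (hb h2)).2 h1)) ((hu.vanish L).mono (sdiff_subset_sdiff_left hb))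
      x ((L.mem x (hb hxb)).1 hx) h1 h2
  set w : ES N → ℝ := fun x => v (y + R • e) * u x - C * u (y + R • e) * v x with hw
  have hwc : ContinuousOn w Ω := (continuousOn_const.mul hu.sol.1).sub
    (continuousOn_const.mul hv.sol.1)
  have hUo : IsOpen (Ω \ closedBall y R) := L.opn.sdiff isClosed_closedBall
  have key := maxPrinciple hN hUo (hbd.subset sdiff_subset) (w := w) (hwc.mono sdiff_subset) ?_ ?_
  · intro x hx hxR
    have := key x ⟨hx, by rw [mem_closedBall]; linarith⟩
    simp only [hw] at this
    linarith
  · refine ⟨hwc.mono (inter_subset_left.trans sdiff_subset), fun φ hφ h0 => ?_⟩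
    have hφ' : IsTestFun Ω φ := hφ.mono (inter_subset_left.trans sdiff_subset)
    have iu := hV.integrable Subset.rfl hφ' hu.sol.1
    have iv := hV'.integrable Subset.rfl hφ' hv.sol.1
    have lu := hφ'.integrable_lap hu.sol.1
    have lv := hφ'.integrable_lap hv.sol.1
    have heq : ∫ x, w x * lap φ x = ∫ x, (v (y + R • e) * (V x * u x * φ x)
        - C * u (y + R • e) * (V' x * v x * φ x)) := by
      rw [integral_sub (iu.const_mul _) (iv.const_mul _), integral_const_mul, integral_const_mul,
        ← hu.sol.2 φ hφ', ← hv.sol.2 φ hφ', ← integral_const_mul, ← integral_const_mul,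
        ← integral_sub (lu.const_mul _) (lv.const_mul _)]
      congr 1; ext x; simp only [hw]; ring
    rw [heq]
    refine integral_nonneg fun x => ?_
    simp only [Pi.zero_apply]
    by_cases hx : x ∈ (Ω \ closedBall y R) ∩ {x | 0 < w x}
    · have a1 := hVV x hx.1.1
      have a2 := hV'.V0 x hx.1.1
      have a3 := hu.nn x hx.1.1
      have a4 := h0 x
      have a5 : 0 < w x := hx.2
      have b1 : 0 ≤ (V x - V' x) * (v (y + R • e) * u x * φ x) :=
        mul_nonneg (by linarith) (by positivity)
      have b2 : 0 ≤ V' x * w x * φ x := by positivity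
      simp only [hw] at b2
      nlinarith
    · simp [hφ.zero_out hx]
  · intro ζ hζ ε hε
    rw [hUo.frontier_eq] at hζ
    have hζR : R ≤ dist ζ y := by
      have h1 : Ω \ closedBall y R ⊆ {x | R ≤ dist x y} := fun x hx => by
        have := hx.2
        rw [mem_closedBall, not_le] at this
        exact this.le
      exact closure_minimal h1 (isClosed_le continuous_const (continuous_id.dist continuous_const))
        hζ.1
    rcases lt_or_ge (dist ζ y) (2 * R) with h | h
    · rw [eventually_nhdsWithin_iff]
      filter_upwards [isOpen_ball.mem_nhds (show ζ ∈ ball y (2 * R) from h)] with x hx hxU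
      have h2 := hxU.2
      rw [mem_closedBall, not_le] at h2
      have := hs x hxU.1 (by linarith) (le_of_lt hx)
      simp only [hw]
      linarith
    · have hζΩ : ζ ∉ Ω := fun h' => hζ.2 ⟨h', by rw [mem_closedBall]; linarith⟩
      have hζf : ζ ∈ frontier Ω := by
        rw [L.opn.frontier_eq]
        exact ⟨closure_mono sdiff_subset hζ.1, hζΩ⟩
      have hζy : ζ ≠ y := by
        rintro rfl
        rw [dist_self] at h
        linarith
      have h1 := hu.van ζ hζf hζy (ε / (v (y + R • e) + 1)) (by positivity)
      rw [eventually_nhdsWithin_iff] at h1 ⊢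
      filter_upwards [h1] with x hx hxU
      have h2 := hx hxU.1
      rw [lt_div_iff₀ (by positivity)] at h2
      have h3 := mul_nonneg hC0 (hv.nn x hxU.1)
      have h4 := hu.nn x hxU.1
      simp only [hw]
      nlinarith

end

section

/-- one-dimensional cutoff -/
def cut (s : ℝ) : ℝ := Real.smoothTransition (16 / 7 - s * (4 / 7))

lemma cut_contDiff {n : ℕ∞} : ContDiff ℝ n cut :=
  Real.smoothTransition.contDiff.comp (by fun_prop)

lemma cut_one {s : ℝ} (hs : s ≤ 9 / 4) : cut s = 1 :=
  Real.smoothTransition.one_of_one_le (by linarith)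

lemma cut_zero {s : ℝ} (hs : 4 ≤ s) : cut s = 0 :=
  Real.smoothTransition.zero_of_nonpos (by linarith)

/-- smooth cutoffs with scale invariant bounds -/
lemma exists_cut (N : ℕ) : ∃ C : ℝ, 0 ≤ C ∧ ∀ (c : ES N) (R : ℝ), 0 < R → ∃ ξ : ES N → ℝ,
    ContDiff ℝ (⊤ : ℕ∞) ξ ∧ (∀ x, 0 ≤ ξ x) ∧ (∀ x, dist x c ≤ 3 / 2 * R → ξ x = 1) ∧
    (∀ x, |lap ξ x| ≤ C * (R ^ 2)⁻¹) ∧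
    (∀ x, x ∉ closedBall c (2 * R) → lap ξ x = 0) ∧ ∀ x, 2 * R ≤ dist x c → ξ x = 0 := by
  have hT2 : ContDiff ℝ 2 cut := cut_contDiff (n := 2)
  have hT1 : ContDiff ℝ 1 (deriv cut) := by
    have : ContDiff ℝ (1 + 1) cut := hT2
    exact (contDiff_succ_iff_deriv.1 this).2.2
  have hcont : Continuous fun s : ℝ => 4 * s * deriv (deriv cut) s + 2 * N * deriv cut s := by
    have h1 : Continuous (deriv (deriv cut)) := hT1.continuous_deriv (by norm_num)
    have h2 := hT1.continuous
    fun_prop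
  obtain ⟨C, hC⟩ := (isCompact_Icc (a := (0:ℝ)) (b := 4)).exists_bound_of_continuousOn
    hcont.continuousOn
  have hz : ∀ s : ℝ, 4 < s → cut =ᶠ[𝓝 s] fun _ => 0 := fun s hs => by
    filter_upwards [lt_mem_nhds hs] with t ht using cut_zero ht.le
  have hz1 : ∀ s : ℝ, 4 < s → deriv cut s = 0 := fun s hs => by
    rw [(hz s hs).deriv_eq]; simp
  have hz2 : ∀ s : ℝ, 4 < s → deriv (deriv cut) s = 0 := fun s hs => by
    rw [(hz s hs).deriv.deriv_eq]; simp
  refine ⟨max C 0, le_max_right _ _, fun c R hR => ⟨fun x => cut (‖x - c‖ ^ 2 * (R ^ 2)⁻¹),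
    cut_contDiff.comp (contDiff_nsq c _), fun x => Real.smoothTransition.nonneg _, ?_, ?_, ?_, ?_⟩⟩
  · intro x hx
    apply cut_one
    rw [← div_eq_mul_inv, div_le_iff₀ (by positivity), ← dist_eq_norm]
    have := pow_le_pow_left₀ dist_nonneg hx 2
    linarith
  · intro z
    rw [lap_radial hT2]
    set s := ‖z - c‖ ^ 2 * (R ^ 2)⁻¹ with hs
    have hs0 : 0 ≤ s := by positivity
    have e : 4 * (R ^ 2)⁻¹ ^ 2 * ‖z - c‖ ^ 2 * deriv (deriv cut) s
        + 2 * N * (R ^ 2)⁻¹ * deriv cut s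
        = (4 * s * deriv (deriv cut) s + 2 * N * deriv cut s) * (R ^ 2)⁻¹ := by
      rw [hs]; ring
    rw [e, abs_mul, abs_of_pos (a := (R ^ 2)⁻¹) (by positivity)]
    refine mul_le_mul_of_nonneg_right ?_ (by positivity)
    rcases le_or_gt s 4 with h | h
    · exact (hC s ⟨hs0, h⟩).trans (le_max_left _ _)
    · rw [hz1 s h, hz2 s h]; simp
  · intro z hz'
    rw [lap_radial hT2]
    have h : 4 < ‖z - c‖ ^ 2 * (R ^ 2)⁻¹ := by
      rw [← div_eq_mul_inv, lt_div_iff₀ (by positivity), ← dist_eq_norm]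
      rw [mem_closedBall, not_le] at hz'
      have := pow_lt_pow_left₀ hz' (by positivity) two_ne_zero
      linarith
    rw [hz1 _ h, hz2 _ h]; simp
  · intro z hz'
    apply cut_zero
    rw [← div_eq_mul_inv, le_div_iff₀ (by positivity), ← dist_eq_norm]
    have := pow_le_pow_left₀ (by positivity) hz' 2
    linarith

lemma int_bound {N : ℕ} {W : Set (ES N)} (hW : MeasurableSet W) {F : ES N → ℝ} {c : ES N} {r B : ℝ}
    (hB : 0 ≤ B)
    (h0 : ∀ x ∈ W, 0 ≤ F x) (h1 : ∀ x ∈ W, x ∈ closedBall c r → F x ≤ B)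
    (h2 : ∀ x ∈ W, x ∉ closedBall c r → F x = 0) :
    ∫ x in W, F x ≤ B * volume.real (closedBall c r) := by
  rw [← integral_indicator hW]
  have : B * volume.real (closedBall c r) = ∫ x, (closedBall c r).indicator (fun _ => B) x := by
    rw [integral_indicator measurableSet_closedBall, setIntegral_const, smul_eq_mul, mul_comm]
  rw [this]
  refine integral_mono_of_nonneg (Eventually.of_forall fun x => ?_) ?_
    (Eventually.of_forall fun x => ?_)
  · exact indicator_nonneg h0 x
  · exact (integrable_indicator_iff measurableSet_closedBall).2
      (integrableOn_const (isCompact_closedBall c r).measure_lt_top.ne)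
  · by_cases hx : x ∈ W
    · rw [indicator_of_mem hx]
      by_cases hc : x ∈ closedBall c r
      · rw [indicator_of_mem hc]; exact h1 x hx hc
      · rw [indicator_of_notMem hc, h2 x hx hc]
    · rw [indicator_of_notMem hx]
      exact indicator_nonneg (fun _ _ => hB) x

lemma vol_ball (N : ℕ) : ∃ ω : ℝ, 0 < ω ∧ ∀ (c : ES N) (r : ℝ), 0 ≤ r →
    volume.real (closedBall c r) = r ^ N * ω := by
  refine ⟨volume.real (ball (0 : ES N) 1), ?_, fun c r hr => ?_⟩
  · exact ENNReal.toReal_pos (measure_ball_pos _ _ one_pos).ne' measure_ball_lt_top.ne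
  · rw [Measure.addHaar_real_closedBall _ _ hr]; simp

set_option maxHeartbeats 1000000 in
/-- lower bound for the product of Martin and Green functions -/
lemma lowerProd {N : ℕ} (hN : 0 < N) {Ω : Set (ES N)} (hbd : Bornology.IsBounded Ω)
    {x₀ y : ES N} (hx₀ : x₀ ∈ Ω) {Λ : ℝ} {H : ES N → ℝ} {e : ES N} {ρ : ℝ}
    (L : Loc Ω x₀ y Λ H e ρ) {a : ℝ} (ha : 0 ≤ a)
    {V u G : ES N → ℝ} (hV : VC Ω a V) (hu : KT Ω V y u) (hG : GT Ω V x₀ G) :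
    ∃ C : ℝ, 1 ≤ C ∧ ∀ R : ℝ, 0 < R → 300 * Λ ^ 2 * R ≤ ρ →
      u x₀ * R ^ 2 ≤ C * R ^ N * (u (y + R • e) * G (y + R • e)) := by
  have hΛ := L.g.one_le
  have hA : 0 ≤ a * Λ ^ 2 := by positivity
  obtain ⟨C₁, hC₁, hann⟩ := annulusBound N hN Λ (a * Λ ^ 2) hΛ hA
  obtain ⟨C₂, hC₂, hcar⟩ := carleson N hN Λ (a * Λ ^ 2) hΛ
  obtain ⟨C₃, hC₃, hhar⟩ := harnackGraph N Λ (a * Λ ^ 2) (1 / 3) hΛ (by norm_num)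
  obtain ⟨C₄, hC₄, hcut⟩ := exists_cut N
  obtain ⟨ω, hω, hvol⟩ := vol_ball N
  refine ⟨C₁ * C₄ * (C₂ * C₃) * (2 ^ N * ω) + 1, by
    have : 0 ≤ C₁ * C₄ * (C₂ * C₃) * (2 ^ N * ω) := by positivity
    linarith, fun R hR hRρ => ?_⟩
  have hRΛ : R ≤ Λ * R := by nlinarith
  have hRΛ2 : Λ * R ≤ Λ ^ 2 * R := by
    have := mul_le_mul_of_nonneg_left hRΛ L.g.pos.le
    linarith
  have hAd : dist (y + R • e) y = R := by rw [L.g.dist_shift, abs_of_pos hR]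
  have hAb : y + R • e ∈ ball y ρ := by rw [mem_ball, hAd]; linarith
  have hAΩ : y + R • e ∈ Ω := (L.mem _ hAb).2 (by rw [L.g.shift, L.Hy]; linarith)
  have huA := hu.nn _ hAΩ
  have hGA : 0 < G (y + R • e) := hG.pos _ ⟨hAΩ, fun h => L.x0_notMem (h ▸ hAb)⟩
  have huann : ∀ x ∈ Ω, R / 2 ≤ dist x y → dist x y ≤ 2 * R → u x ≤ C₁ * u (y + R • e) := by
    intro x hx h1 h2
    have hb : ball y (100 * Λ * R) ⊆ ball y ρ := ball_subset_ball (by linarith)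
    exact hann H e L.g V u y R hR L.Hy ((hu.nsol L hV).mono hb)
      ((hu.vanish L).mono (sdiff_subset_sdiff_left hb)) x
      ((L.mem x (by rw [mem_ball]; linarith)).1 hx) h1 h2
  have hGb : ∀ x ∈ Ω, dist x y ≤ 2 * R → G x ≤ C₂ * C₃ * G (y + R • e) := by
    intro x hx h2
    have hb : ball y (100 * Λ ^ 2 * (3 * R)) ⊆ ball y ρ := ball_subset_ball (by linarith)
    have hb' : ball y (10 * Λ * (3 * R)) ⊆ ball y ρ := ball_subset_ball (by linarith)
    have h3 := hcar H e L.g V G y (3 * R) (by positivity) L.Hy ((hG.nsol L hV).mono hb)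
      (fun ζ hζ => (hG.vanish L) ζ (hb hζ)) x
      ((L.mem x (by rw [mem_ball]; linarith)).1 hx) (by rw [mem_ball]; linarith)
    have h4 := hhar H e L.g V G y (3 * R) (by positivity) ((hG.nsol L hV).mono hb')
      (y + (3 * R) • e) (y + R • e)
      (by rw [mem_closedBall, L.g.dist_shift, abs_of_pos (by positivity)])
      (by rw [mem_closedBall, hAd]; linarith)
      (by rw [L.g.shift, L.Hy]; linarith) (by rw [L.g.shift, L.Hy]; linarith)
    calc G x ≤ C₂ * G (y + (3 * R) • e) := h3
      _ ≤ C₂ * (C₃ * G (y + R • e)) := by gcongr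
      _ = _ := by ring
  obtain ⟨ξ, hξs, hξ0, hξ1, hξl, hξz, hξe⟩ := hcut y R hR
  set lam := C₁ * u (y + R • e) with hlam
  have hlam0 : 0 ≤ lam := mul_nonneg (by linarith) huA
  set b : ES N → ℝ := fun x => lam * ξ x with hb
  have hξ2 : ContDiff ℝ 2 ξ := contDiff_infty.1 hξs 2
  have hlapb : ∀ x, lap b x = lam * lap ξ x := fun x => lap_const_mul lam hξ2 x
  set U := Ω \ closedBall y R with hU
  have hUo : IsOpen U := L.opn.sdiff isClosed_closedBall
  have hUΩ : U ⊆ Ω := sdiff_subset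
  have hbs : ContDiff ℝ (⊤ : ℕ∞) b := contDiff_const.mul hξs
  have hb0 : ∀ x, 0 ≤ b x := fun x => mul_nonneg hlam0 (hξ0 x)
  have hx₀U : x₀ ∈ U := ⟨hx₀, by rw [mem_closedBall, not_le]; have := L.x0; linarith⟩
  set B := lam * (C₄ * (R ^ 2)⁻¹) * (C₂ * C₃ * G (y + R • e)) with hB
  have hB0 : 0 ≤ B := by positivity
  have main : ∀ δ > 0, u x₀ ≤ B * volume.real (closedBall y (2 * R)) + 4 * δ := by
    intro δ hδ
    have hW : IsCompact {x | x ∈ U ∧ δ / 2 ≤ u x - b x} := by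
      refine compact_superlevel (w := fun x => u x - b x) hUo (hbd.subset hUΩ)
        ((hu.sol.1.mono hUΩ).sub hbs.continuous.continuousOn) fun ζ hζ => ?_
      rw [hUo.frontier_eq] at hζ
      have hζR : R ≤ dist ζ y := by
        have h1 : U ⊆ {x | R ≤ dist x y} := fun x hx => by
          have := hx.2
          rw [mem_closedBall, not_le] at this
          exact this.le
        exact closure_minimal h1
          (isClosed_le continuous_const (continuous_id.dist continuous_const)) hζ.1
      rcases lt_or_ge (dist ζ y) (3 / 2 * R) with h | h
      · rw [eventually_nhdsWithin_iff]
        filter_upwards [isOpen_ball.mem_nhds (show ζ ∈ ball y (3 / 2 * R) from h)] with x hx hxU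
        have h2 := hxU.2
        rw [mem_closedBall, not_le] at h2
        rw [mem_ball] at hx
        have := huann x hxU.1 (by linarith) (by linarith)
        simp only [hb]
        rw [hξ1 x hx.le]
        linarith
      · have hζΩ : ζ ∉ Ω := fun h' => hζ.2 ⟨h', by rw [mem_closedBall]; linarith⟩
        have hζf : ζ ∈ frontier Ω := by
          rw [L.opn.frontier_eq]
          exact ⟨closure_mono hUΩ hζ.1, hζΩ⟩
        have hζy : ζ ≠ y := by
          rintro rfl
          rw [dist_self] at h
          linarith
        have h1 := hu.van ζ hζf hζy (δ / 2) (by positivity)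
        rw [eventually_nhdsWithin_iff] at h1 ⊢
        filter_upwards [h1] with x hx hxU
        have h2 := hx hxU.1
        have := hb0 x
        linarith
    set W := {x | x ∈ U ∧ δ / 2 ≤ u x - b x} with hWd
    have hWΩ : W ⊆ Ω := fun x hx => hUΩ hx.1
    have hae : Function.update G x₀ 0 =ᵐ[volume] G := by
      have : Nonempty (Fin N) := ⟨⟨0, hN⟩⟩
      have : ∀ᵐ x : ES N ∂volume, x ≠ x₀ := by
        simp [ae_iff]
      filter_upwards [this] with x hx
      rw [Function.update_of_ne hx]
    have hp0 : ∀ x ∈ Ω, 0 ≤ Function.update G x₀ 0 x := by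
      intro x hx
      by_cases h : x = x₀
      · rw [h]; simp
      · rw [Function.update_of_ne h]; exact (hG.pos x ⟨hx, h⟩).le
    have hpi : IntegrableOn (Function.update G x₀ 0) W := by
      have := hG.li.integrableOn_compact_subset hWΩ hW
      exact this.congr (ae_restrict_of_ae hae.symm)
    obtain ⟨f, hft, hf0, hfW, hfl, hfi⟩ := kato hUo hV.meas (fun x hx => hV.V0 x (hUΩ hx))
      (fun K hK => hV.bdd K (hK.trans hUΩ)) (hu.sol.mono hUΩ) hbs (fun x _ => hb0 x) hδ
      hWd hW hpi (fun x hx => hp0 x (hWΩ hx)) hδ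
    have e1 : ∫ x, Function.update G x₀ 0 x * (lap f x - V x * f x) = - f x₀ := by
      rw [← hG.rep f (hft.mono hUΩ)]
      refine integral_congr_ae ?_
      filter_upwards [hae] with x hx
      rw [hx]
    rw [e1] at hfi
    have h1 := hfl x₀ hx₀U
    have hbx : b x₀ = 0 := by
      have := L.x0
      simp only [hb]; rw [hξe x₀ (by linarith), mul_zero]
    have h2 : ∫ x in W, Function.update G x₀ 0 x * max (lap b x) 0 ≤
        B * volume.real (closedBall y (2 * R)) := by
      refine int_bound hW.measurableSet hB0 (fun x hx => mul_nonneg (hp0 x (hWΩ hx))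
        (le_max_right _ _)) (fun x hx hxb => ?_) fun x hx hxb => ?_
      · have hxx : x ≠ x₀ := by
          rintro rfl
          rw [mem_closedBall] at hxb
          have := L.x0
          linarith
        rw [Function.update_of_ne hxx]
        have g1 := hGb x (hWΩ hx) hxb
        have g2 : max (lap b x) 0 ≤ lam * (C₄ * (R ^ 2)⁻¹) := by
          refine max_le ?_ (by positivity)
          rw [hlapb]
          exact mul_le_mul_of_nonneg_left ((le_abs_self _).trans (hξl x)) hlam0
        rw [hB, mul_comm]
        exact mul_le_mul g2 g1 (hG.pos x ⟨hWΩ hx, hxx⟩).le (by positivity)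
      · rw [hlapb, hξz x hxb]; simp
    linarith
  have h5 : u x₀ ≤ B * volume.real (closedBall y (2 * R)) := by
    refine le_of_forall_pos_le_add fun δ hδ => ?_
    have := main (δ / 4) (by positivity)
    linarith
  rw [hvol y _ (by positivity)] at h5
  have h6 : u x₀ * R ^ 2 ≤ B * ((2 * R) ^ N * ω) * R ^ 2 :=
    mul_le_mul_of_nonneg_right h5 (by positivity)
  have h7 : B * ((2 * R) ^ N * ω) * R ^ 2 =
      (C₁ * C₄ * (C₂ * C₃) * (2 ^ N * ω)) * R ^ N * (u (y + R • e) * G (y + R • e)) := by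
    rw [hB, hlam, mul_pow]; field_simp
  have h8 : 0 ≤ R ^ N * (u (y + R • e) * G (y + R • e)) := by positivity
  linarith

end

section

/-- subsolution bump -/
lemma chi_sub (N : ℕ) {ε A : ℝ} (hε : 0 < ε) (hA : 0 ≤ A) : ∃ k : ℝ, 0 < k ∧
    ∀ (c z : ES N) (ρ v : ℝ), 0 < ρ → ε * ρ ≤ dist z c → 
      (z ∈ closedBall c ρ → v * ρ ^ 2 ≤ A) →
      (ρ ^ 2)⁻¹ * phi k c ρ z ≤ lap (phi k c ρ) z - v * phi k c ρ z := by
  set k : ℝ := 1 + (9 + 2 * N + A) / (4 * ε ^ 2) with hk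
  have hk1 : 1 ≤ k := by
    have : 0 ≤ (9 + 2 * N + A) / (4 * ε ^ 2) := by positivity
    linarith
  have hk2 : 9 + 2 * N + A ≤ 4 * ε ^ 2 * k := by
    have : 4 * ε ^ 2 * k = 4 * ε ^ 2 + (9 + 2 * N + A) := by rw [hk]; field_simp
    rw [this]; have : 0 < 4 * ε ^ 2 := by positivity
    linarith
  have hk0 : 0 < k := by linarith
  refine ⟨k, hk0, fun c z ρ v hρ hz hv => ?_⟩
  by_cases hzb : z ∈ ball c ρ
  · have hv' := hv (ball_subset_closedBall hzb)
    rw [lap_phi]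
    unfold phi
    set s := ‖z - c‖ ^ 2 * (ρ ^ 2)⁻¹ with hs
    rw [mem_ball, dist_eq_norm] at hzb
    rw [dist_eq_norm] at hz
    have hs1 : s < 1 := by
      rw [hs, ← div_eq_mul_inv, div_lt_one (by positivity)]
      exact pow_lt_pow_left₀ hzb (norm_nonneg _) two_ne_zero
    have hs2 : ε ^ 2 ≤ s := by
      rw [hs, ← div_eq_mul_inv, le_div_iff₀ (by positivity), ← mul_pow]
      exact pow_le_pow_left₀ (by positivity) hz 2
    rw [Fk_deriv hk0 hs1, Fk_deriv2 hk0 hs1]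
    have hF := Fk_nonneg k s
    have h1s : 0 < 1 - s := by linarith
    have hs0 : 0 ≤ s := by positivity
    set w := (1 - s)⁻¹ with hw
    have hw1 : 1 ≤ w := (one_le_inv₀ h1s).2 (by linarith)
    set i := (ρ ^ 2)⁻¹ with hi
    have hi0 : 0 < i := by positivity
    have e1 : 4 * i ^ 2 * ‖z - c‖ ^ 2 * ((k ^ 2 / (1 - s) ^ 4 - 2 * k / (1 - s) ^ 3) * Fk k s) +
        2 * N * i * (-(k / (1 - s) ^ 2) * Fk k s) =
        i * ((4 * s * (k ^ 2 * w ^ 4 - 2 * k * w ^ 3) - 2 * N * k * w ^ 2) * Fk k s) := by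
      rw [hw, hs]; field_simp; ring
    have hvi : v ≤ A * i := by
      rw [hi, ← div_eq_mul_inv, le_div_iff₀ (by positivity)]; exact hv'
    have hkey : 1 + A ≤ 4 * s * (k ^ 2 * w ^ 4 - 2 * k * w ^ 3) - 2 * N * k * w ^ 2 := by
      have hw2 : w ^ 2 ≤ w ^ 4 := pow_le_pow_right₀ hw1 (by norm_num)
      have hw3 : w ^ 3 ≤ w ^ 4 := pow_le_pow_right₀ hw1 (by norm_num)
      have hw4 : 1 ≤ w ^ 4 := one_le_pow₀ hw1
      have g1 : 4 * ε ^ 2 * (k ^ 2 * w ^ 4) ≤ 4 * s * (k ^ 2 * w ^ 4) := by gcongr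
      have g2 : 4 * s * (2 * k * w ^ 3) ≤ 4 * 1 * (2 * k * w ^ 4) := by gcongr
      have g3 : 2 * N * k * w ^ 2 ≤ 2 * N * k * w ^ 4 := by gcongr
      have g4 : (9 + 2 * N + A) * (k * w ^ 4) ≤ 4 * ε ^ 2 * k * (k * w ^ 4) := by gcongr
      have g5 : 1 ≤ k * w ^ 4 := by nlinarith
      have g6 : (1 + A) * 1 ≤ (1 + A) * (k * w ^ 4) := by gcongr
      linarith
    rw [e1]
    have g7 : v * Fk k s ≤ A * i * Fk k s := by gcongr
    have g8 : i * ((1 + A) * Fk k s) ≤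
        i * ((4 * s * (k ^ 2 * w ^ 4 - 2 * k * w ^ 3) - 2 * N * k * w ^ 2) * Fk k s) := by gcongr
    linarith
  · have hzb' : ρ ≤ dist z c := by rwa [mem_ball, not_lt] at hzb
    have hs : 1 ≤ ‖z - c‖ ^ 2 * (ρ ^ 2)⁻¹ := by
      rw [← div_eq_mul_inv, le_div_iff₀ (by positivity), one_mul, ← dist_eq_norm]
      exact pow_le_pow_left₀ hρ.le hzb' 2
    have hc1 : Continuous (deriv (Fk k)) := (Fk_deriv_contDiff k).continuous
    have hc2 : Continuous (deriv (deriv (Fk k))) :=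
      (Fk_deriv_contDiff k).continuous_deriv (by norm_num)
    have z1 : deriv (Fk k) (‖z - c‖ ^ 2 * (ρ ^ 2)⁻¹) = 0 := by
      have : closure (Ioi (1:ℝ)) ⊆ {s | deriv (Fk k) s = 0} := closure_minimal
        (fun s hs => Fk_deriv_zero hk0 hs) (isClosed_eq hc1 continuous_const)
      rw [closure_Ioi] at this
      exact this hs
    have z2 : deriv (deriv (Fk k)) (‖z - c‖ ^ 2 * (ρ ^ 2)⁻¹) = 0 := by
      have : closure (Ioi (1:ℝ)) ⊆ {s | deriv (deriv (Fk k)) s = 0} := closure_minimal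
        (fun s hs => Fk_deriv2_zero hk0 hs) (isClosed_eq hc2 continuous_const)
      rw [closure_Ioi] at this
      exact this hs
    rw [lap_phi, z1, z2]
    unfold phi
    rw [Fk_zero hk0 hs]
    simp

/-- smooth extension to the line -/
lemma exists_ext {b : ℝ} (hb : 0 < b) {T : ℝ → ℝ} (hT : ∀ s, -b < s → ContDiffAt ℝ (⊤ : ℕ∞) T s) :
    ∃ T' : ℝ → ℝ, ContDiff ℝ (⊤ : ℕ∞) T' ∧ ∀ s, 0 ≤ s → T' =ᶠ[𝓝 s] T := by
  refine ⟨fun s => Real.smoothTransition (4 / b * s + 2) * T s, ?_, fun s hs => ?_⟩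
  · rw [contDiff_iff_contDiffAt]
    intro s
    rcases lt_or_ge (-b) s with h | h
    · refine ContDiffAt.mul ?_ (hT s h)
      have : ContDiff ℝ (⊤ : ℕ∞) fun s : ℝ => Real.smoothTransition (4 / b * s + 2) :=
        Real.smoothTransition.contDiff.comp (by fun_prop)
      exact this.contDiffAt
    · refine (contDiffAt_const (c := (0:ℝ))).congr_of_eventuallyEq ?_
      filter_upwards [gt_mem_nhds (show s < -(b / 2) by linarith)] with t ht
      rw [Real.smoothTransition.zero_of_nonpos, zero_mul]
      have : 4 / b * t ≤ 4 / b * (-(b / 2)) := by gcongr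
      have h2 : 4 / b * (-(b / 2)) = -2 := by field_simp; norm_num
      linarith
  · filter_upwards [lt_mem_nhds (show -(b / 4) < s by linarith)] with t ht
    rw [Real.smoothTransition.one_of_one_le, one_mul]
    have : 4 / b * (-(b / 4)) ≤ 4 / b * t := by gcongr
    have h2 : 4 / b * (-(b / 4)) = -1 := by field_simp
    linarith

/-- radial functions with explicit Laplacian -/
lemma exists_radial {N : ℕ} {b : ℝ} (hb : 0 < b) {T T1 T2 : ℝ → ℝ}
    (hT : ∀ s, -b < s → ContDiffAt ℝ (⊤ : ℕ∞) T s)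
    (h1 : ∀ s, -b < s → HasDerivAt T (T1 s) s) (h2 : ∀ s, -b < s → HasDerivAt T1 (T2 s) s)
    (c : ES N) : ∃ q : ES N → ℝ, ContDiff ℝ (⊤ : ℕ∞) q ∧ (∀ x, q x = T (‖x - c‖ ^ 2)) ∧
      ∀ x, lap q x = 4 * ‖x - c‖ ^ 2 * T2 (‖x - c‖ ^ 2) + 2 * N * T1 (‖x - c‖ ^ 2) := by
  obtain ⟨T', hT', he⟩ := exists_ext hb hT
  refine ⟨fun x => T' (‖x - c‖ ^ 2 * 1), hT'.comp (contDiff_nsq c 1), fun x => ?_, fun x => ?_⟩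
  · simp only [mul_one]
    exact (he _ (by positivity)).eq_of_nhds
  · rw [lap_radial (contDiff_infty.1 hT' 2)]
    have hs : 0 ≤ ‖x - c‖ ^ 2 := by positivity
    simp only [mul_one, one_pow]
    have e1 : ∀ s, -b < s → deriv T s = T1 s := fun s hs => (h1 s hs).deriv
    have e2 : deriv T =ᶠ[𝓝 (‖x - c‖ ^ 2)] T1 := by
      filter_upwards [lt_mem_nhds (show -b < ‖x - c‖ ^ 2 by linarith)] with t ht using e1 t ht
    rw [(he _ hs).deriv_eq, (he _ hs).deriv.deriv_eq, e1 _ (by linarith), e2.deriv_eq,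
      (h2 _ (by linarith)).deriv]

lemma peak3 {N : ℕ} (hN : 3 ≤ N) (K : ℝ) (hK : 1 ≤ K) : ∃ ε : ℝ, 0 < ε ∧ ε ≤ 1 / 4 ∧
    ∀ (a : ES N) (ρ : ℝ), 0 < ρ → ∃ q : ES N → ℝ, ContDiff ℝ (⊤ : ℕ∞) q ∧
      (∀ x, 0 < q x ∧ lap q x ≤ 0) ∧
      ∀ x x', dist x a ≤ ε * ρ → ρ / 2 ≤ dist x' a → K * q x' ≤ q x := by
  refine ⟨1 / (4 * K), by positivity, ?_, fun a ρ hρ => ?_⟩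
  · rw [div_le_div_iff₀ (by positivity) (by norm_num)]; linarith
  set ε := 1 / (4 * K) with hε
  have hε0 : 0 < ε := by positivity
  set b := (ε * ρ) ^ 2 with hb
  have hb0 : 0 < b := by positivity
  obtain ⟨q, hq, hqe, hql⟩ := exists_radial (N := N) hb0 (T := fun s => (s + b) ^ (-(1/2) : ℝ))
    (T1 := fun s => -(1/2) * (s + b) ^ (-(3/2) : ℝ)) (T2 := fun s => 3/4 * (s + b) ^ (-(5/2) : ℝ))
    (fun s hs => by
      have : s + b ≠ 0 := by linarith
      exact (contDiffAt_id.add contDiffAt_const).rpow_const_of_ne this)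
    (fun s hs => by
      have h := ((hasDerivAt_id s).add_const b).rpow_const (p := -(1/2)) (Or.inl (by simp; linarith))
      exact h.congr_deriv (by simp; norm_num))
    (fun s hs => by
      have h := (((hasDerivAt_id s).add_const b).rpow_const (p := -(3/2))
        (Or.inl (by simp; linarith))).const_mul (-(1/2))
      exact h.congr_deriv (by simp; norm_num; ring)) a
  refine ⟨q, hq, fun x => ⟨?_, ?_⟩, fun x x' hx hx' => ?_⟩
  · rw [hqe]; positivity
  · rw [hql]
    set s := ‖x - a‖ ^ 2
    have hs : 0 ≤ s := by positivity
    have h1 : (s + b) ^ (-(3/2) : ℝ) = (s + b) ^ (-(5/2) : ℝ) * (s + b) := by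
      rw [← Real.rpow_add_one (by positivity)]; norm_num
    rw [h1]
    have h2 : 0 < (s + b) ^ (-(5/2) : ℝ) := by positivity
    have hN' : (3:ℝ) ≤ N := by exact_mod_cast hN
    have h3 : 3 * s ≤ N * (s + b) := by nlinarith
    nlinarith
  · rw [hqe, hqe, ← dist_eq_norm, ← dist_eq_norm]
    have e : ∀ t : ℝ, 0 ≤ t → t ^ (-(1/2) : ℝ) = (Real.sqrt t)⁻¹ := fun t ht => by
      rw [Real.rpow_neg ht, Real.sqrt_eq_rpow]
    rw [e _ (by positivity), e _ (by positivity)]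
    have h1 : Real.sqrt (dist x a ^ 2 + b) ≤ 2 * (ε * ρ) := by
      rw [Real.sqrt_le_left (by positivity)]
      have := pow_le_pow_left₀ dist_nonneg hx 2
      rw [hb]; nlinarith
    have h2 : ρ / 2 ≤ Real.sqrt (dist x' a ^ 2 + b) := by
      apply Real.le_sqrt_of_sq_le
      have := pow_le_pow_left₀ (by positivity) hx' 2
      linarith
    have h3 : 0 < Real.sqrt (dist x a ^ 2 + b) := by positivity
    have h4 : 2 * (ε * ρ) * K = ρ / 2 := by rw [hε]; field_simp; norm_num
    rw [← div_eq_mul_inv, ← one_div, div_le_div_iff₀ (by linarith) h3]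
    nlinarith

set_option maxHeartbeats 1000000 in
lemma peak2 {κ : ℝ} (hκ : 0 < κ) (hκ1 : κ ≤ 1) (K : ℝ) (hK : 1 ≤ K) : ∃ ε : ℝ, 0 < ε ∧ ε ≤ 1 / 4 ∧
    ∀ (a z : ES 2) (ρ : ℝ), 0 < ρ → dist a z ≤ ρ / κ → ∃ q : ES 2 → ℝ, ContDiff ℝ (⊤ : ℕ∞) q ∧
      (∀ x, κ * ρ ≤ dist x z → 0 < q x ∧ lap q x ≤ 0) ∧
      ∀ x x', κ * ρ ≤ dist x z → κ * ρ ≤ dist x' z → dist x a ≤ ε * ρ → ρ / 2 ≤ dist x' a →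
        K * q x' ≤ q x := by
  set D := 1 + 1 / κ ^ 2 with hD
  have hD1 : 1 ≤ D := by have : 0 < 1 / κ ^ 2 := by positivity
                         linarith
  have hD0 : 0 < D := by linarith
  set M := 2 * D ^ 2 * ((1 + 2 / κ) ^ 2 + 1) with hM
  have hM1 : 1 ≤ M := by
    have h1 : 1 ≤ D ^ 2 := one_le_pow₀ hD1
    have h2 : 0 ≤ (1 + 2 / κ) ^ 2 := by positivity
    have h3 : 0 ≤ D ^ 2 * (1 + 2 / κ) ^ 2 := by positivity
    nlinarith
  set P := Real.exp (K * Real.log M) with hP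
  have hP1 : 1 ≤ P := Real.one_le_exp (mul_nonneg (by linarith) (Real.log_nonneg hM1))
  set ε := κ / (4 * P) with hε
  have hε0 : 0 < ε := by positivity
  have hεκ : ε ≤ κ / 4 := by
    rw [hε]; apply div_le_div_of_nonneg_left <;> linarith
  refine ⟨ε, hε0, by linarith, fun a z ρ hρ haz => ?_⟩
  set β := ε * ρ / (2 * D ^ 2) * κ ^ 2 with hβ
  have hβ0 : 0 < β := by positivity
  have hb0 : 0 < (ε * ρ) ^ 2 := by positivity
  have hb'0 : 0 < β ^ 2 := by positivity
  have hlog : ∀ b : ℝ, 0 < b → ∀ c : ES 2, ∃ q : ES 2 → ℝ, ContDiff ℝ (⊤ : ℕ∞) q ∧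
      (∀ x, q x = Real.log (‖x - c‖ ^ 2 + b)) ∧
      ∀ x, lap q x = 4 * b / (‖x - c‖ ^ 2 + b) ^ 2 := by
    intro b hb c
    obtain ⟨q, h1, h2, h3⟩ := exists_radial (N := 2) hb (T := fun s => Real.log (s + b))
      (T1 := fun s => (s + b)⁻¹) (T2 := fun s => -((s + b) ^ 2)⁻¹)
      (fun s hs => (contDiffAt_id.add contDiffAt_const).log (by simp; linarith))
      (fun s hs => (((hasDerivAt_id s).add_const b).log (by simp; linarith)).congr_deriv
        (by simp))
      (fun s hs => (((hasDerivAt_id s).add_const b).inv (by simp; linarith)).congr_deriv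
        (by simp [neg_div])) c
    refine ⟨q, h1, h2, fun x => ?_⟩
    rw [h3]
    have : 0 < ‖x - c‖ ^ 2 + b := by positivity
    field_simp
    push_cast
    ring
  obtain ⟨p, hp1, hp2, hp3⟩ := hlog _ hb0 a
  obtain ⟨r, hr1, hr2, hr3⟩ := hlog _ hb'0 z
  set q : ES 2 → ℝ := fun x => (r x + Real.log (2 * D ^ 2)) - p x with hq
  have hqs : ContDiff ℝ (⊤ : ℕ∞) q := (hr1.add contDiff_const).sub hp1
  have hql : ∀ x, lap q x = lap r x - lap p x := fun x => by
    rw [hq, lap_sub (contDiff_infty.1 (hr1.add contDiff_const) 2) (contDiff_infty.1 hp1 2),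
      lap_add (contDiff_infty.1 hr1 2) contDiff_const, lap_const, add_zero]
  have hqv : ∀ x, q x = Real.log ((dist x z ^ 2 + β ^ 2) * (2 * D ^ 2) /
      (dist x a ^ 2 + (ε * ρ) ^ 2)) := fun x => by
    rw [Real.log_div (by positivity) (by positivity), Real.log_mul (by positivity) (by positivity),
      hq]
    simp only [hp2, hr2, dist_eq_norm]
  have hfar : ∀ x, κ * ρ ≤ dist x z → dist x a ≤ D * dist x z := fun x hx => by
    have h1 := dist_triangle x z a
    rw [dist_comm z a] at h1
    have h2 : ρ / κ ≤ 1 / κ ^ 2 * dist x z := by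
      calc ρ / κ = 1 / κ ^ 2 * (κ * ρ) := by field_simp
        _ ≤ _ := by gcongr
    rw [hD]; linarith
  have hβε : β ≤ ε * ρ / (2 * D ^ 2) := by
    rw [hβ]
    apply mul_le_of_le_one_right (by positivity)
    exact pow_le_one₀ hκ.le hκ1
  have hερ : ε * ρ ≤ κ / 4 * ρ := by gcongr
  refine ⟨q, hqs, fun x hx => ⟨?_, ?_⟩, fun x x' hx hx' h1 h2 => ?_⟩
  · rw [hqv]
    apply Real.log_pos
    rw [lt_div_iff₀ (by positivity), one_mul]
    have h1 := pow_le_pow_left₀ dist_nonneg (hfar x hx) 2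
    have h2 : (ε * ρ) ^ 2 < dist x z ^ 2 :=
      pow_lt_pow_left₀ (by nlinarith [mul_pos hκ hρ]) (by positivity) two_ne_zero
    have h3 : 1 ≤ D ^ 2 := one_le_pow₀ hD1
    have h4 : dist x z ^ 2 ≤ D ^ 2 * dist x z ^ 2 := by
      have := sq_nonneg (dist x z)
      nlinarith
    have h5 : 0 < β ^ 2 * D ^ 2 := by positivity
    nlinarith
  · rw [hql, hr3, hp3, ← dist_eq_norm, ← dist_eq_norm, sub_nonpos,
      div_le_div_iff₀ (by positivity) (by positivity)]
    have h1 := pow_le_pow_left₀ dist_nonneg (hfar x hx) 2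
    have g1 : β * dist x a ^ 2 ≤ ε * ρ / 2 * dist x z ^ 2 := by
      calc β * dist x a ^ 2 ≤ ε * ρ / (2 * D ^ 2) * (D * dist x z) ^ 2 := by gcongr
        _ = _ := by field_simp
    have hx2 := pow_le_pow_left₀ (by positivity) hx 2
    have g2 : β * (ε * ρ) ^ 2 ≤ ε * ρ / 2 * dist x z ^ 2 := by
      have hβ2 : β ≤ ε * ρ / 2 := by
        refine hβε.trans ?_
        apply div_le_div_of_nonneg_left (by positivity) (by norm_num)
        have : 1 ≤ D ^ 2 := one_le_pow₀ hD1
        linarith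
      calc β * (ε * ρ) ^ 2 ≤ ε * ρ / 2 * (κ * ρ) ^ 2 := by
            gcongr
            linarith
        _ ≤ _ := by gcongr
    have g3 : β * (dist x a ^ 2 + (ε * ρ) ^ 2) ≤ ε * ρ * (dist x z ^ 2 + β ^ 2) := by
      have : 0 ≤ ε * ρ * β ^ 2 := by positivity
      linarith
    have g4 := pow_le_pow_left₀ (by positivity) g3 2
    linarith
  · have hq2 : q x' ≤ Real.log M := by
      rw [hqv]
      apply Real.log_le_log (by positivity)
      rw [div_le_iff₀ (by positivity), hM]
      have g1 : dist x' z ≤ (1 + 2 / κ) * dist x' a := by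
        have := dist_triangle x' a z
        have g2 : ρ / κ ≤ 2 / κ * dist x' a := by
          calc ρ / κ = 2 / κ * (ρ / 2) := by field_simp
            _ ≤ _ := by gcongr
        linarith
      have g3 := pow_le_pow_left₀ dist_nonneg g1 2
      have g4 : β ^ 2 ≤ dist x' a ^ 2 + (ε * ρ) ^ 2 := by
        have hβ2 : β ≤ ε * ρ := by
          refine hβε.trans ?_
          apply div_le_self (by positivity)
          have : 1 ≤ D ^ 2 := one_le_pow₀ hD1
          linarith
        have := pow_le_pow_left₀ hβ0.le hβ2 2
        have := sq_nonneg (dist x' a)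
        linarith
      have g5 : 0 ≤ (1 + 2 / κ) ^ 2 * (ε * ρ) ^ 2 := by positivity
      have g6 : dist x' z ^ 2 + β ^ 2 ≤
          ((1 + 2 / κ) ^ 2 + 1) * (dist x' a ^ 2 + (ε * ρ) ^ 2) := by linarith
      calc _ ≤ ((1 + 2 / κ) ^ 2 + 1) * (dist x' a ^ 2 + (ε * ρ) ^ 2) * (2 * D ^ 2) := by gcongr
        _ = _ := by ring
    have hq1 : K * Real.log M ≤ q x := by
      rw [hqv, Real.le_log_iff_exp_le (by positivity), ← hP, le_div_iff₀ (by positivity)]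
      have g1 := pow_le_pow_left₀ dist_nonneg h1 2
      have g2 := pow_le_pow_left₀ (by positivity) hx 2
      have g3 : P * (dist x a ^ 2 + (ε * ρ) ^ 2) ≤ P * (2 * (ε * ρ) ^ 2) := by gcongr; linarith
      have g4 : P * (2 * (ε * ρ) ^ 2) ≤ (κ * ρ) ^ 2 := by
        have : P * (2 * (ε * ρ) ^ 2) = (κ * ρ) ^ 2 / (8 * P) := by rw [hε]; field_simp; norm_num
        rw [this]
        apply div_le_self (by positivity)
        linarith
      have g5 : (κ * ρ) ^ 2 ≤ (dist x z ^ 2 + β ^ 2) * (2 * D ^ 2) := by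
        have : 1 ≤ 2 * D ^ 2 := by have : 1 ≤ D ^ 2 := one_le_pow₀ hD1
                                   linarith
        calc (κ * ρ) ^ 2 ≤ dist x z ^ 2 + β ^ 2 := by linarith
          _ ≤ _ := le_mul_of_one_le_right (by positivity) this
      linarith
    have : K * q x' ≤ K * Real.log M := by gcongr
    linarith

/-- superharmonic functions peaked at `a` -/
lemma peak {N : ℕ} (hN : 2 ≤ N) {κ : ℝ} (hκ : 0 < κ) (hκ1 : κ ≤ 1) (K : ℝ) (hK : 1 ≤ K) :
    ∃ ε : ℝ, 0 < ε ∧ ε ≤ 1 / 4 ∧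
    ∀ (a z : ES N) (ρ : ℝ), 0 < ρ → dist a z ≤ ρ / κ → ∃ q : ES N → ℝ, ContDiff ℝ (⊤ : ℕ∞) q ∧
      (∀ x, κ * ρ ≤ dist x z → 0 < q x ∧ lap q x ≤ 0) ∧
      ∀ x x', κ * ρ ≤ dist x z → κ * ρ ≤ dist x' z → dist x a ≤ ε * ρ → ρ / 2 ≤ dist x' a →
        K * q x' ≤ q x := by
  rcases hN.eq_or_lt with rfl | h
  · exact peak2 hκ hκ1 K hK
  · obtain ⟨ε, h1, h2, h3⟩ := peak3 (N := N) h K hK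
    refine ⟨ε, h1, h2, fun a z ρ hρ _ => ?_⟩
    obtain ⟨q, g1, g2, g3⟩ := h3 a ρ hρ
    exact ⟨q, g1, fun x _ => g2 x, fun x x' _ _ => g3 x x'⟩

end

section

set_option maxHeartbeats 2000000 in
/-- upper bound for the product of Martin and Green functions -/
lemma upperProd {N : ℕ} (hN : 2 ≤ N) {Ω : Set (ES N)} (hbd : Bornology.IsBounded Ω)
    {x₀ y : ES N} (hx₀ : x₀ ∈ Ω) {Λ : ℝ} {H : ES N → ℝ} {e : ES N} {ρ : ℝ}
    (L : Loc Ω x₀ y Λ H e ρ) {a : ℝ} (ha : 0 ≤ a)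
    {V u G : ES N → ℝ} (hV : VC Ω a V) (hu : KT Ω V y u) (hG : GT Ω V x₀ G) :
    ∃ C : ℝ, 1 ≤ C ∧ ∀ R : ℝ, 0 < R → 300 * Λ ^ 2 * R ≤ ρ →
      R ^ N * (u (y + R • e) * G (y + R • e)) ≤ C * R ^ 2 := by
  have hΛ := L.g.one_le
  have hΛ0 := L.g.pos
  have hρ := L.ρpos
  have hA : 0 ≤ a * Λ ^ 2 := by positivity
  obtain ⟨C₃, hC₃, hhar⟩ := harnackGraph N Λ (a * Λ ^ 2) (1 / 4) hΛ (by norm_num)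
  obtain ⟨C₄, hC₄, hcut⟩ := exists_cut N
  obtain ⟨ω, hω, hvol⟩ := vol_ball N
  obtain ⟨ε, hε, hε4, hpeak⟩ := peak hN (κ := 1 / (16 * Λ)) (by positivity)
    (by rw [div_le_one (by positivity)]; linarith) (2 * C₃ ^ 2) (by nlinarith)
  obtain ⟨k, hk, hchi⟩ := chi_sub N hε hA
  -- the ball around the pole
  obtain ⟨r0, hr0, hr0Ω, hr0ρ⟩ : ∃ r0 > 0, closedBall x₀ (2 * r0) ⊆ Ω ∧ 4 * r0 ≤ ρ := by
    obtain ⟨t, ht, htΩ⟩ := Metric.isOpen_iff.1 L.opn x₀ hx₀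
    have hm : 0 < min t ρ := lt_min ht hρ
    refine ⟨min t ρ / 4, by positivity, (closedBall_subset_ball ?_).trans htΩ, ?_⟩
    · have := min_le_left t ρ; linarith
    · have := min_le_right t ρ; linarith
  obtain ⟨ξ, hξs, hξ0, hξ1, hξl, hξz, hξe⟩ := hcut x₀ r0 hr0
  have hξ2 : ContDiff ℝ 2 ξ := contDiff_infty.1 hξs 2
  obtain ⟨M, hM0, hM⟩ : ∃ M : ℝ, 0 ≤ M ∧ ∀ x, r0 ≤ dist x x₀ → dist x x₀ ≤ 3 / 2 * r0 → G x ≤ M := by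
    have hc : IsCompact (closedBall x₀ (3 / 2 * r0) \ ball x₀ r0) :=
      (isCompact_closedBall _ _).diff isOpen_ball
    have hs : closedBall x₀ (3 / 2 * r0) \ ball x₀ r0 ⊆ Ω \ {x₀} := fun x hx =>
      ⟨hr0Ω (closedBall_subset_closedBall (by linarith) hx.1), by
        rintro rfl; exact hx.2 (mem_ball_self hr0)⟩
    obtain ⟨M, hM⟩ := hc.exists_bound_of_continuousOn (hG.sol.1.mono hs)
    refine ⟨max M 0, le_max_right _ _, fun x h1 h2 => ?_⟩
    exact (le_abs_self _).trans ((hM x ⟨h2, by rw [mem_ball, not_lt]; exact h1⟩).trans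
      (le_max_left _ _))
  obtain ⟨Um, hUm0, hUm⟩ : ∃ Um : ℝ, 0 ≤ Um ∧ ∀ x ∈ closedBall x₀ (2 * r0), u x ≤ Um := by
    obtain ⟨M, hM⟩ := (isCompact_closedBall x₀ (2 * r0)).exists_bound_of_continuousOn
      (hu.sol.1.mono hr0Ω)
    exact ⟨max M 0, le_max_right _ _, fun x h1 => (le_abs_self _).trans ((hM x h1).trans
      (le_max_left _ _))⟩
  set E := Um * (M * (C₄ * (r0 ^ 2)⁻¹)) * volume.real (closedBall x₀ (2 * r0)) with hE
  have hE0 : 0 ≤ E := by positivity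
  set c0 := Real.exp (-(16 / 7 * k)) / (4 * C₃ ^ 2) * ((1 / (64 * Λ)) ^ N * ω) * (64 * Λ ^ 2) with hc0
  have hc00 : 0 < c0 := by positivity
  refine ⟨(E + 1) / c0 + 1, by
    have : 0 ≤ (E + 1) / c0 := by positivity
    linarith, fun R hR hRρ => ?_⟩
  have hRΛ : R ≤ Λ * R := by nlinarith
  have hRΛ2 : Λ * R ≤ Λ ^ 2 * R := by
    have := mul_le_mul_of_nonneg_left hRΛ L.g.pos.le
    linarith
  set A := y + R • e with hAdef
  have hAd : dist A y = R := by rw [hAdef, L.g.dist_shift, abs_of_pos hR]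
  have hHA : H A = R := by rw [hAdef, L.g.shift, L.Hy]; linarith
  set σ := R / (8 * Λ) with hσ
  have hσ0 : 0 < σ := by positivity
  have hσR : Λ * σ = R / 8 := by rw [hσ]; field_simp
  have hσΛ : σ ≤ Λ * σ := by nlinarith
  -- points near A
  have hnear : ∀ x ∈ closedBall A σ, x ∈ Ω ∧ R / 2 ≤ H x ∧ dist x y ≤ 2 * R ∧ x ∈ ball y ρ := by
    intro x hx
    rw [mem_closedBall] at hx
    have h1 := dist_triangle x A y
    have h2 := L.g.le A x
    rw [dist_comm] at h2
    have h3 : Λ * dist x A ≤ Λ * σ := by gcongr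
    have h4 : x ∈ ball y ρ := by rw [mem_ball]; linarith
    have h5 : R / 2 ≤ H x := by linarith
    exact ⟨(L.mem x h4).2 (by linarith), h5, by linarith, h4⟩
  have hAc : A ∈ closedBall A σ := mem_closedBall_self hσ0.le
  have hx0d := L.x0
  have hb' : ball y (10 * Λ * (2 * R)) ⊆ ball y ρ := ball_subset_ball (by linarith)
  have hGh : ∀ x ∈ closedBall A σ, ∀ x' ∈ closedBall A σ, G x ≤ C₃ * G x' := by
    intro x hx x' hx'
    obtain ⟨-, h1, h2, -⟩ := hnear x hx
    obtain ⟨-, h1', h2', -⟩ := hnear x' hx'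
    exact hhar H e L.g V G y (2 * R) (by positivity) ((hG.nsol L hV).mono hb') x x' h2 h2'
      (by linarith) (by linarith)
  have huh : ∀ x ∈ closedBall A σ, ∀ x' ∈ closedBall A σ, u x ≤ C₃ * u x' := by
    intro x hx x' hx'
    obtain ⟨-, h1, h2, -⟩ := hnear x hx
    obtain ⟨-, h1', h2', -⟩ := hnear x' hx'
    exact hhar H e L.g V u y (2 * R) (by positivity) ((hu.nsol L hV).mono hb') x x' h2 h2'
      (by linarith) (by linarith)
  have hx0far : ∀ x ∈ closedBall A σ, 2 * r0 ≤ dist x x₀ := by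
    intro x hx
    obtain ⟨-, -, h2, -⟩ := hnear x hx
    have := dist_triangle x₀ x y
    rw [dist_comm x₀ x] at this
    linarith
  have huA : 0 ≤ u A := hu.nn _ (hnear A hAc).1
  have hGA : 0 < G A := hG.pos _ ⟨(hnear A hAc).1, fun h => L.x0_notMem (h ▸ (hnear A hAc).2.2.2)⟩
  -- the peaked function
  set z := y + (-R) • e with hz
  have hzd : ∀ x ∈ Ω, 1 / (16 * Λ) * σ ≤ dist x z := by
    intro x hx
    have hs : 1 / (16 * Λ) * σ ≤ σ := by
      apply mul_le_of_le_one_left hσ0.le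
      rw [div_le_one (by positivity)]; linarith
    have hzy : dist z y = R := by rw [hz, L.g.dist_shift, abs_neg, abs_of_pos hR]
    by_cases hxb : x ∈ ball y ρ
    · have h1 := (L.mem x hxb).1 hx
      have h2 := L.g.le x z
      have h3 : H z = -R := by rw [hz, L.g.shift, L.Hy]; linarith
      by_contra hcon
      push Not at hcon
      have h4 : Λ * dist x z ≤ Λ * σ := by gcongr; linarith
      linarith
    · rw [mem_ball, not_lt] at hxb
      have := dist_triangle x z y
      linarith
  have hAz : dist A z ≤ σ / (1 / (16 * Λ)) := by
    have h1 : dist A z = 2 * R := by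
      have : A = z + (2 * R) • e := by rw [hAdef, hz, add_assoc, ← add_smul]; ring_nf
      rw [this, L.g.dist_shift, abs_of_pos (by positivity)]
    have h2 : σ / (1 / (16 * Λ)) = 2 * R := by rw [hσ]; field_simp; norm_num
    rw [h1, h2]
  obtain ⟨q, hqs, hqp, hqK⟩ := hpeak A z σ hσ0 hAz
  have hεσ : ε * σ ≤ σ / 4 := by nlinarith
  have hsub : closedBall A (ε * σ) ⊆ closedBall A σ := closedBall_subset_closedBall (by linarith)
  obtain ⟨p0, hp0m, hp0⟩ := (isCompact_closedBall A (ε * σ)).exists_isMinOn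
    ⟨A, mem_closedBall_self (by positivity)⟩ hqs.continuous.continuousOn
  have hqp0 : 0 < q p0 := (hqp p0 (hzd p0 (hnear p0 (hsub hp0m)).1)).1
  set lam := C₃ * G A / q p0 with hlam
  have hlam0 : 0 ≤ lam := by positivity
  have hbn : ∀ x ∈ closedBall A (ε * σ), G x ≤ lam * q x := by
    intro x hx
    have h1 : q p0 ≤ q x := hp0 hx
    calc G x ≤ C₃ * G A := hGh x (hsub hx) A hAc
      _ = lam * q p0 := by rw [hlam]; field_simp
      _ ≤ lam * q x := by gcongr
  have hbf : ∀ x ∈ closedBall A σ, σ / 2 ≤ dist x A → lam * q x ≤ G x / 2 := by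
    intro x hx hx2
    have h1 := hqK p0 x (hzd _ (hnear p0 (hsub hp0m)).1) (hzd _ (hnear x hx).1) hp0m hx2
    have h2 := hGh A hAc x hx
    have h3 : lam * (2 * C₃ ^ 2 * q x) ≤ C₃ * G A := by
      calc lam * (2 * C₃ ^ 2 * q x) ≤ lam * q p0 := by gcongr
        _ = C₃ * G A := by rw [hlam]; field_simp
    have h4 : C₃ * G A ≤ C₃ * (C₃ * G x) := by gcongr
    have h5 : C₃ ^ 2 * (2 * (lam * q x)) ≤ C₃ ^ 2 * G x := by linarith
    have := le_of_mul_le_mul_left h5 (by positivity)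
    linarith
  set b : ES N → ℝ := fun x => lam * q x + M * ξ x with hb
  have hq2 : ContDiff ℝ 2 q := contDiff_infty.1 hqs 2
  have hlapb : ∀ x, lap b x = lam * lap q x + M * lap ξ x := fun x => by
    rw [hb, lap_add (contDiff_const.mul hq2) (contDiff_const.mul hξ2), lap_const_mul _ hq2,
      lap_const_mul _ hξ2]
  have hbs : ContDiff ℝ (⊤ : ℕ∞) b := (contDiff_const.mul hqs).add (contDiff_const.mul hξs)
  set U := Ω \ closedBall x₀ r0 with hU
  have hUo : IsOpen U := L.opn.sdiff isClosed_closedBall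
  have hUΩ : U ⊆ Ω := sdiff_subset
  have hU0 : U ⊆ Ω \ {x₀} := fun x hx => ⟨hx.1, by
    rintro rfl; exact hx.2 (mem_closedBall_self hr0.le)⟩
  have hq0 : ∀ x ∈ Ω, 0 ≤ lam * q x := fun x hx => mul_nonneg hlam0 (hqp x (hzd x hx)).1.le
  have hb0 : ∀ x ∈ U, 0 ≤ b x := fun x hx => add_nonneg (hq0 x (hUΩ hx)) (mul_nonneg hM0 (hξ0 x))
  set δ := G A / (12 * C₃) with hδd
  have hδ : 0 < δ := by positivity
  have hW : IsCompact {x | x ∈ U ∧ δ / 2 ≤ G x - b x} := by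
    refine compact_superlevel (w := fun x => G x - b x) hUo (hbd.subset hUΩ)
      ((hG.sol.1.mono hU0).sub hbs.continuous.continuousOn) fun ζ hζ => ?_
    rw [hUo.frontier_eq] at hζ
    have hζR : r0 ≤ dist ζ x₀ := by
      have h1 : U ⊆ {x | r0 ≤ dist x x₀} := fun x hx => by
        have := hx.2
        rw [mem_closedBall, not_le] at this
        exact this.le
      exact closure_minimal h1
        (isClosed_le continuous_const (continuous_id.dist continuous_const)) hζ.1
    rcases lt_or_ge (dist ζ x₀) (3 / 2 * r0) with h | h
    · rw [eventually_nhdsWithin_iff]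
      filter_upwards [isOpen_ball.mem_nhds (show ζ ∈ ball x₀ (3 / 2 * r0) from h)] with x hx hxU
      have h2 := hxU.2
      rw [mem_closedBall, not_le] at h2
      rw [mem_ball] at hx
      have := hM x h2.le hx.le
      have h3 := hq0 x hxU.1
      simp only [hb]
      rw [hξ1 x hx.le]
      linarith
    · have hζΩ : ζ ∉ Ω := fun h' => hζ.2 ⟨h', by rw [mem_closedBall]; linarith⟩
      have hζf : ζ ∈ frontier Ω := by
        rw [L.opn.frontier_eq]
        exact ⟨closure_mono hUΩ hζ.1, hζΩ⟩
      have h1 := hG.van ζ hζf (δ / 2) (by positivity)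
      rw [eventually_nhdsWithin_iff] at h1 ⊢
      filter_upwards [h1] with x hx hxU
      have h2 := hx hxU.1
      have := hb0 x hxU
      linarith
  set W := {x | x ∈ U ∧ δ / 2 ≤ G x - b x} with hWd
  have hWΩ : W ⊆ Ω := fun x hx => hUΩ hx.1
  set χ := phi k A σ with hχ
  have hχs : ContDiff ℝ (⊤ : ℕ∞) χ := phi_contDiff k A σ
  have hχ2 : ContDiff ℝ 2 χ := contDiff_infty.1 hχs 2
  have hχ0 : ∀ x, 0 ≤ χ x := phi_nonneg k A σ
  have hχ1 : ∀ x, χ x ≤ 1 := fun x => Fk_le_one hk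
  set m := u A / C₃ with hm
  have hm0 : 0 ≤ m := by positivity
  set p : ES N → ℝ := fun x => u x - m * χ x with hp
  have hp0' : ∀ x ∈ Ω, 0 ≤ p x := by
    intro x hx
    simp only [hp]
    by_cases hxA : x ∈ closedBall A σ
    · have h1 := huh A hAc x hxA
      have h2 : m ≤ u x := by rw [hm, div_le_iff₀ (by positivity)]; linarith
      have h3 := mul_le_mul_of_nonneg_left (hχ1 x) hm0
      linarith
    · rw [hχ, phi_zero hk A hσ0 hxA]
      have := hu.nn x hx
      linarith
  have hpc : ContinuousOn p Ω := hu.sol.1.sub (continuousOn_const.mul hχs.continuous.continuousOn)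
  obtain ⟨f, hft, hf0, hfW, hfl, hfi⟩ := kato hUo hV.meas (fun x hx => hV.V0 x (hUΩ hx))
    (fun K hK => hV.bdd K (hK.trans hUΩ)) (hG.sol.mono hU0) hbs hb0 hδ
    hWd hW ((hpc.mono hWΩ).integrableOn_compact hW) (fun x hx => hp0' x (hWΩ hx)) one_pos
  have hftΩ : IsTestFun Ω f := hft.mono hUΩ
  -- the integral identity
  have i1 := hftΩ.integrable_lap hu.sol.1
  have i2 := hV.integrable Subset.rfl hftΩ hu.sol.1
  have i3 := hftΩ.integrable_lap (hχs.continuous.continuousOn (s := Ω))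
  have i4 := hV.integrable Subset.rfl hftΩ (hχs.continuous.continuousOn (s := Ω))
  have i5 : Integrable fun x => lap χ x * f x :=
    integrable_mul_compact hft.2.1 (lap_continuous hχ2).continuousOn hft.1.continuous.continuousOn
      fun x hx => image_eq_zero_of_notMem_tsupport hx
  have e1 : ∫ x, p x * (lap f x - V x * f x) = - (m * ∫ x, f x * (lap χ x - V x * χ x)) := by
    have ea : ∀ x, p x * (lap f x - V x * f x) =
        (u x * lap f x - V x * u x * f x) - m * (χ x * lap f x - V x * χ x * f x) := fun x => by
      simp only [hp]; ring
    have eb : ∀ x, f x * (lap χ x - V x * χ x) = lap χ x * f x - V x * χ x * f x := fun x => by ring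
    simp_rw [ea, eb]
    have j1 : Integrable (fun x => u x * lap f x - V x * u x * f x) := i1.sub i2
    have j2 : Integrable (fun x => χ x * lap f x - V x * χ x * f x) := i3.sub i4
    rw [integral_sub j1 (j2.const_mul m), integral_sub i1 i2, integral_const_mul,
      integral_sub i3 i4, integral_sub i5 i4, hu.sol.2 f hftΩ, integral_lap hχ2 hftΩ.c2 hftΩ.2.1]
    ring
  rw [e1] at hfi
  have h2 : ∫ x in W, p x * max (lap b x) 0 ≤ E := by
    refine int_bound hW.measurableSet (by positivity) (fun x hx => mul_nonneg (hp0' x (hWΩ hx))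
      (le_max_right _ _)) (fun x hx hxb => ?_) fun x hx hxb => ?_
    · have g1 : p x ≤ Um := by
        have := hUm x hxb
        have := mul_nonneg hm0 (hχ0 x)
        simp only [hp]; linarith
      have g2 : max (lap b x) 0 ≤ M * (C₄ * (r0 ^ 2)⁻¹) := by
        refine max_le ?_ (by positivity)
        rw [hlapb]
        have g3 := mul_nonpos_of_nonneg_of_nonpos hlam0 (hqp x (hzd x (hWΩ hx))).2
        have g4 := mul_le_mul_of_nonneg_left ((le_abs_self _).trans (hξl x)) hM0
        linarith
      exact mul_le_mul g1 g2 (le_max_right _ _) hUm0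
    · rw [hlapb, hξz x hxb, mul_zero, add_zero, max_eq_right, mul_zero]
      exact mul_nonpos_of_nonneg_of_nonpos hlam0 (hqp x (hzd x (hWΩ hx))).2
  -- lower bound of the left side
  have hsup : ∀ x, 0 ≤ f x * (lap χ x - V x * χ x) ∧ (x ∈ W → (σ ^ 2)⁻¹ * χ x * f x ≤
      f x * (lap χ x - V x * χ x)) := by
    intro x
    by_cases hxW : x ∈ W
    · have hd : ε * σ ≤ dist x A := by
        by_contra hcon
        push Not at hcon
        have h3 := hbn x hcon.le
        have h4 := hxW.2
        have h5 := mul_nonneg hM0 (hξ0 x)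
        simp only [hb] at h4
        linarith
      have h3 := hchi A x σ (V x) hσ0 hd (fun hxA => by
        obtain ⟨-, g1, -, g3⟩ := hnear x hxA
        have g4 := (hu.nsol L hV).VA x (by linarith) g3
        have g5 := hV.V0 x (hWΩ hxW)
        refine le_trans ?_ g4
        have : σ ≤ H x := by linarith
        gcongr)
      have h4 := mul_le_mul_of_nonneg_left h3 (hf0 x)
      have h5 : 0 ≤ f x * ((σ ^ 2)⁻¹ * phi k A σ x) := 
        mul_nonneg (hf0 x) (mul_nonneg (by positivity) (hχ0 x))
      exact ⟨h5.trans h4, fun _ => by linarith⟩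
    · rw [hfW x hxW]; simp
  set B := G A / (4 * C₃) * ((σ ^ 2)⁻¹ * Real.exp (-(16 / 7 * k))) with hB
  have hB0 : 0 < B := by positivity
  have hlow : B * ((σ / 8) ^ N * ω) ≤ ∫ x, f x * (lap χ x - V x * χ x) := by
    rw [← hvol (A + (5 / 8 * σ) • e) (σ / 8) (by positivity)]
    have : B * volume.real (closedBall (A + (5 / 8 * σ) • e) (σ / 8)) =
        ∫ x, (closedBall (A + (5 / 8 * σ) • e) (σ / 8)).indicator (fun _ => B) x := by
      rw [integral_indicator measurableSet_closedBall, setIntegral_const, smul_eq_mul, mul_comm]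
    rw [this]
    refine integral_mono ((integrable_indicator_iff measurableSet_closedBall).2
      (integrableOn_const (isCompact_closedBall _ _).measure_lt_top.ne))
      ((i5.sub i4).congr (Eventually.of_forall fun x => by
        simp only [Pi.sub_apply]; ring)) fun x => ?_
    by_cases hx : x ∈ closedBall (A + (5 / 8 * σ) • e) (σ / 8)
    · simp only [indicator_of_mem hx]
      rw [mem_closedBall] at hx
      have d0 : dist (A + (5 / 8 * σ) • e) A = 5 / 8 * σ := by
        rw [L.g.dist_shift, abs_of_pos (by positivity)]
      have d1 := dist_triangle x (A + (5 / 8 * σ) • e) A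
      have d2 := dist_triangle (A + (5 / 8 * σ) • e) x A
      rw [dist_comm _ x] at d2
      have hxA : x ∈ closedBall A σ := by rw [mem_closedBall]; linarith
      have hxU : x ∈ U := ⟨(hnear x hxA).1, by
        rw [mem_closedBall, not_le]; have := hx0far x hxA; linarith⟩
      have g1 := hfl x hxU
      have g2 := hbf x hxA (by linarith)
      have g3 := hGh A hAc x hxA
      have g4 : G A / C₃ ≤ G x := by rw [div_le_iff₀ (by positivity)]; linarith
      have g5 : b x = lam * q x := by simp only [hb]; rw [hξe x (hx0far x hxA)]; ring
      have g6 : δ = G A / C₃ / 12 := by rw [hδd]; field_simp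
      have g7 : G A / (4 * C₃) = G A / C₃ / 4 := by field_simp
      have g8 : G A / (4 * C₃) ≤ f x := by rw [g7]; linarith
      have hfpos : 0 < f x := lt_of_lt_of_le (by positivity) g8
      have hxW : x ∈ W := by
        by_contra hcon
        rw [hfW x hcon] at hfpos
        exact lt_irrefl _ hfpos
      have g9 : Real.exp (-(16 / 7 * k)) ≤ χ x := by
        have hs : ‖x - A‖ ^ 2 * (σ ^ 2)⁻¹ ≤ 9 / 16 := by
          rw [← div_eq_mul_inv, div_le_iff₀ (by positivity), ← dist_eq_norm]
          have := pow_le_pow_left₀ dist_nonneg (show dist x A ≤ 3 / 4 * σ by linarith) 2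
          linarith
        rw [hχ]
        unfold phi
        rw [Fk_eq hk (by linarith)]
        apply Real.exp_le_exp.2
        apply neg_le_neg
        rw [div_le_iff₀ (by linarith)]
        nlinarith
      refine le_trans ?_ ((hsup x).2 hxW)
      rw [hB, mul_comm ((σ ^ 2)⁻¹ * χ x)]
      gcongr
    · simp only [indicator_of_notMem hx]
      exact (hsup x).1
  have h3 : m * (B * ((σ / 8) ^ N * ω)) ≤ E + 1 := by
    have := mul_le_mul_of_nonneg_left hlow hm0
    linarith
  have h4 : m * (B * ((σ / 8) ^ N * ω)) = c0 * (R ^ N * (u A * G A)) / R ^ 2 := by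
    have hs : σ / 8 = R * (1 / (64 * Λ)) := by rw [hσ]; field_simp; norm_num
    have hs2 : (σ ^ 2)⁻¹ = 64 * Λ ^ 2 / R ^ 2 := by rw [hσ]; field_simp; norm_num
    rw [hm, hB, hc0, hs, hs2, mul_pow]
    field_simp
  rw [h4, div_le_iff₀ (by positivity)] at h3
  have h5 : R ^ N * (u A * G A) ≤ (E + 1) / c0 * R ^ 2 := by
    rw [div_mul_eq_mul_div, le_div_iff₀ hc00]; linarith
  have h6 : 0 < R ^ 2 := by positivity
  linarith

end

lemma LVHarmonic.div {N : ℕ} {Ω : Set (ES N)} {V u : ES N → ℝ} (h : LVHarmonic Ω V u) (D : ℝ) :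
    LVHarmonic Ω V fun x => D * u x := by
  refine ⟨continuousOn_const.mul h.1, ?_, ?_, fun φ hφ => ?_⟩
  · exact h.2.1.smul D
  · have := h.2.2.1.smul D
    refine this.congr ?_
    refine Eventually.of_forall fun x => ?_
    simp only [Pi.smul_apply, smul_eq_mul]; ring
  · have e1 : ∀ x, D * u x * lap φ x = D * (u x * lap φ x) := fun x => by ring
    have e2 : ∀ x, V x * (D * u x) * φ x = D * (V x * u x * φ x) := fun x => by ring
    simp_rw [e1, e2, integral_const_mul]
    rw [h.2.2.2 φ hφ]

/-- comparing values along the pseudo-normal with values along `e` -/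
lemma pseudo {N : ℕ} {Ω : Set (ES N)} {x₀ y : ES N} {Λ : ℝ} {H : ES N → ℝ} {e : ES N} {ρ : ℝ}
    (L : Loc Ω x₀ y Λ H e ρ) {a : ℝ} {ν : ES N} {η : ℝ} (hν : ν ≠ 0) (hη : 0 < η)
    (hcone : truncCone y ν η ⊆ Ω \ {x₀}) : ∃ C : ℝ, 1 ≤ C ∧ ∃ t₀ : ℝ, 0 < t₀ ∧
    ∀ t, 0 < t → t < t₀ → y + t • ν ∈ Ω ∧ ∀ V u, VC Ω a V → KT Ω V y u →
      u (y + t • ν) ≤ C * u (y + (t * ‖ν‖) • e) ∧ u (y + (t * ‖ν‖) • e) ≤ C * u (y + t • ν) := by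
  have hn : 0 < ‖ν‖ := norm_pos_iff.2 hν
  have hΛ := L.g.one_le
  have hΛ0 : 0 < Λ := by linarith
  have hρ := L.ρpos
  have hq : 0 < min (η / ‖ν‖) 1 := lt_min (by positivity) one_pos
  obtain ⟨C, hC, hh⟩ := harnackGraph N Λ (a * Λ ^ 2) (min (η / ‖ν‖) 1) hΛ hq
  refine ⟨C, hC, min η (min (ρ / (‖ν‖ + η)) (ρ / (10 * Λ * ‖ν‖))),
    lt_min hη (lt_min (by positivity) (by positivity)), fun t ht0 ht => ?_⟩
  have ht1 : t ≤ η := (ht.trans_le (min_le_left _ _)).le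
  have ht2 : t < ρ / (‖ν‖ + η) := ht.trans_le ((min_le_right _ _).trans (min_le_left _ _))
  have ht3 : t < ρ / (10 * Λ * ‖ν‖) := ht.trans_le ((min_le_right _ _).trans (min_le_right _ _))
  rw [lt_div_iff₀ (by positivity)] at ht2 ht3
  have hmem : y + t • ν ∈ Ω := (hcone ⟨t, 0, ht0, ht1, by simpa using hη.le, by simp⟩).1
  refine ⟨hmem, fun V u hV hu => ?_⟩
  have hp : y + t • (ν + (-η) • e) ∈ Ω := (hcone ⟨t, (-η) • e, ht0, ht1, by
    rw [norm_smul, L.g.norm_e]; simp [abs_of_pos hη], rfl⟩).1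
  have hpb : y + t • (ν + (-η) • e) ∈ ball y ρ := by
    rw [mem_ball, dist_eq_norm, add_sub_cancel_left, norm_smul, Real.norm_of_nonneg ht0.le]
    have h1 := norm_add_le ν ((-η) • e)
    rw [norm_smul (-η) e, L.g.norm_e, norm_neg, Real.norm_of_nonneg hη.le] at h1
    have h2 := mul_le_mul_of_nonneg_left h1 ht0.le
    linarith
  have hH : t * η ≤ H (y + t • ν) := by
    have h1 := (L.mem _ hpb).1 hp
    have h2 := L.g.shift (y + t • (ν + (-η) • e)) (t * η)
    have h3 : y + t • (ν + (-η) • e) + (t * η) • e = y + t • ν := by module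
    rw [h3] at h2
    linarith
  have hr : 0 < t * ‖ν‖ := by positivity
  have hns := (hu.nsol L hV).mono (ball_subset_ball (show 10 * Λ * (t * ‖ν‖) ≤ ρ by linarith))
  have m1 : y + t • ν ∈ closedBall y (t * ‖ν‖) := by
    rw [mem_closedBall, dist_eq_norm, add_sub_cancel_left, norm_smul, Real.norm_of_nonneg ht0.le]
  have m2 : y + (t * ‖ν‖) • e ∈ closedBall y (t * ‖ν‖) := by
    rw [mem_closedBall, L.g.dist_shift, abs_of_pos hr]
  have q1 : min (η / ‖ν‖) 1 * (t * ‖ν‖) ≤ H (y + t • ν) := by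
    refine le_trans (mul_le_mul_of_nonneg_right (min_le_left _ _) hr.le) ?_
    have : η / ‖ν‖ * (t * ‖ν‖) = t * η := by field_simp
    linarith
  have q2 : min (η / ‖ν‖) 1 * (t * ‖ν‖) ≤ H (y + (t * ‖ν‖) • e) := by
    refine le_trans (mul_le_mul_of_nonneg_right (min_le_right _ _) hr.le) ?_
    rw [L.g.shift, L.Hy]; linarith
  exact ⟨hh H e L.g V u y _ hr hns _ _ m1 m2 q1 q2, hh H e L.g V u y _ hr hns _ _ m2 m1 q2 q1⟩

lemma ev_small {c : ℝ} (hc : 0 < c) : ∀ᶠ t in 𝓝[>] (0:ℝ), 0 < t ∧ t < c :=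
  Ioo_mem_nhdsGT hc

set_option maxHeartbeats 1000000 in
/-- Proposition `equivdef`. Given `y ∈ ∂Ω` and a pseudo-normal
`ν` at `y`, the following are equivalent: (i) `K̃_y^V = 0` (`y ∈ Sing_V(Ω)`);
(ii) `limsup_{t↓0} K_y^V(y+tν)/K_y(y+tν) = +∞`; (iii) `lim_{t↓0} K_y^V(y+tν)/K_y(y+tν) = +∞`;
(iv) `lim_{Ω∋x→y} g_{x₀}^V(x)/g_{x₀}^0(x) = 0`. -/
theorem statement14 {N : ℕ} (hN : 2 ≤ N) (Ω : Set (ES N))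
    (hΩ : IsLipschitzDomain Ω) (hbd : Bornology.IsBounded Ω)
    (x₀ : ES N) (hx₀ : x₀ ∈ Ω) (a : ℝ) (ha : 0 < a)
    (V : ES N → ℝ) (hV : VClass Ω a V)
    (y : ES N) (hy : y ∈ frontier Ω)
    (ν : ES N) (η : ℝ) (hν : ν ≠ 0) (hη : 0 < η)
    (hcone : truncCone y ν η ⊆ Ω \ {x₀})
    (K KV h gV g0 : ES N → ℝ)
    (hK : IsMartinKernel Ω (fun _ => 0) x₀ y K)
    (hKV : IsMartinKernel Ω V x₀ y KV)
    (hgm : IsGreatestLVHarmMinorant Ω V K h)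
    (hgV : IsGreenFunction Ω V x₀ gV)
    (hg0 : IsGreenFunction Ω (fun _ => 0) x₀ g0) :
    List.TFAE
      [∀ x ∈ Ω, h x = 0,
       ∀ M : ℝ, ∃ᶠ t in 𝓝[>] (0:ℝ), M ≤ KV (y + t • ν) / K (y + t • ν),
       Tendsto (fun t : ℝ => KV (y + t • ν) / K (y + t • ν)) (𝓝[>] (0:ℝ)) atTop,
       Tendsto (fun x => gV x / g0 x) (𝓝[Ω] y) (𝓝 0)] := by
  have hN0 : 0 < N := by omega
  obtain ⟨Λ, H, e, ρ, L⟩ := exists_loc hΩ hx₀ hy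
  have hΛ := L.g.one_le
  have hΛ0 : 0 < Λ := by linarith
  have hρ := L.ρpos
  have hcV : VC Ω a V := VC.of_class hV L.opn L.y_notMem
  have hc0 : VC Ω a (fun _ => (0:ℝ)) := ⟨measurable_const, fun _ _ => le_rfl,
    fun x _ => by simpa using ha.le, fun _ _ _ => ⟨0, fun _ _ => by simp⟩⟩
  have kK := KT.of_martin hK
  have kV := KT.of_martin hKV
  have tV := GT.of_green L.opn hx₀ hcV hgV
  have t0 := GT.of_green L.opn hx₀ hc0 hg0
  have kh : KT Ω V y h := ⟨hgm.1.wsol, fun x hx => (hgm.2.1 x hx).1, fun z hz hzy ε hε => by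
    have h1 := kK.van z hz hzy ε hε
    rw [eventually_nhdsWithin_iff] at h1 ⊢
    filter_upwards [h1] with x hx hxΩ
    exact ((hgm.2.1 x hxΩ).2).trans_lt (hx hxΩ)⟩
  have hn : 0 < ‖ν‖ := norm_pos_iff.2 hν
  obtain ⟨C₂, hC₂, t₀, ht₀, hps⟩ := pseudo (a := a) L hν hη hcone
  have hC₂0 : 0 < C₂ := by linarith
  have hAd : ∀ R, 0 < R → dist (y + R • e) y = R := fun R hR => by
    rw [L.g.dist_shift, abs_of_pos hR]
  have hAΩ : ∀ R, 0 < R → R < ρ → y + R • e ∈ Ω \ {x₀} := fun R hR hRρ => by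
    have hb : y + R • e ∈ ball y ρ := by rw [mem_ball, hAd R hR]; exact hRρ
    refine ⟨(L.mem _ hb).2 (by rw [L.g.shift, L.Hy]; linarith), fun h => L.x0_notMem ?_⟩
    rw [mem_singleton_iff] at h
    rwa [h] at hb
  have hVV : ∀ x ∈ Ω, (fun _ : ES N => (0:ℝ)) x ≤ V x := fun x hx => hcV.V0 x hx
  -- a convenient smallness scale
  obtain ⟨c, hc, hcs⟩ : ∃ c : ℝ, 0 < c ∧ ∀ t, 0 < t → t < c → t < t₀ ∧ 100 * Λ * (t * ‖ν‖) ≤ ρ ∧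
      300 * Λ ^ 2 * (t * ‖ν‖) ≤ ρ ∧ 400 * Λ ^ 3 * (t * ‖ν‖) ≤ ρ ∧ t * ‖ν‖ < ρ := by
    refine ⟨min t₀ (ρ / (400 * Λ ^ 3 * ‖ν‖)), lt_min ht₀ (by positivity), fun t h1 h2 => ?_⟩
    have h3 := h2.trans_le (min_le_right _ _)
    rw [lt_div_iff₀ (by positivity)] at h3
    have hr : 0 < t * ‖ν‖ := by positivity
    have e1 : Λ ≤ Λ ^ 3 := le_self_pow₀ hΛ (by norm_num)
    have e2 : Λ ^ 2 ≤ Λ ^ 3 := pow_le_pow_right₀ hΛ (by norm_num)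
    have e3 : (1:ℝ) ≤ Λ ^ 3 := one_le_pow₀ hΛ
    have f1 := mul_le_mul_of_nonneg_right e1 hr.le
    have f2 := mul_le_mul_of_nonneg_right e2 hr.le
    have f3 := mul_le_mul_of_nonneg_right e3 hr.le
    have f0 : 0 ≤ Λ ^ 3 * (t * ‖ν‖) := by positivity
    refine ⟨h2.trans_le (min_le_left _ _), ?_, ?_, ?_, ?_⟩ <;> linarith
  -- upper and lower bounds of the ratio along `e`
  have hup : ∀ t, 0 < t → t < c → ∀ M, KV (y + t • ν) / K (y + t • ν) ≤ M → 
      KV (y + (t * ‖ν‖) • e) ≤ C₂ * C₂ * M * K (y + (t * ‖ν‖) • e) := by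
    intro t h1 h2 M h3
    obtain ⟨p1, p2⟩ := hps t h1 (hcs t h1 h2).1
    have hKp := hK.2.1 _ p1
    have hKVp := hKV.2.1 _ p1
    have hM : 0 < M := lt_of_lt_of_le (by positivity) h3
    rw [div_le_iff₀ hKp] at h3
    have q1 := (p2 _ _ hcV kV).2
    have q2 := (p2 _ _ hc0 kK).1
    calc KV (y + (t * ‖ν‖) • e) ≤ C₂ * KV (y + t • ν) := q1
      _ ≤ C₂ * (M * K (y + t • ν)) := by gcongr
      _ ≤ C₂ * (M * (C₂ * K (y + (t * ‖ν‖) • e))) := by gcongr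
      _ = _ := by ring
  have hlo : ∀ t, 0 < t → t < c → ∀ M, 0 ≤ M → M ≤ KV (y + t • ν) / K (y + t • ν) → 
      M * K (y + (t * ‖ν‖) • e) ≤ C₂ * C₂ * KV (y + (t * ‖ν‖) • e) := by
    intro t h1 h2 M hM h3
    obtain ⟨p1, p2⟩ := hps t h1 (hcs t h1 h2).1
    have hKp := hK.2.1 _ p1
    rw [le_div_iff₀ hKp] at h3
    have q1 := (p2 _ _ hcV kV).1
    have q2 := (p2 _ _ hc0 kK).2
    calc M * K (y + (t * ‖ν‖) • e) ≤ M * (C₂ * K (y + t • ν)) := by gcongr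
      _ = C₂ * (M * K (y + t • ν)) := by ring
      _ ≤ C₂ * KV (y + t • ν) := by gcongr
      _ ≤ C₂ * (C₂ * KV (y + (t * ‖ν‖) • e)) := by gcongr
      _ = _ := by ring
  have hconv : ∀ t, 0 < t → t < c → ∀ M, 0 ≤ M →
      M * (C₂ * C₂) * K (y + (t * ‖ν‖) • e) ≤ KV (y + (t * ‖ν‖) • e) →
      M ≤ KV (y + t • ν) / K (y + t • ν) := by
    intro t h1 h2 M hM h3
    by_contra hcon
    push Not at hcon
    have h4 := hup t h1 h2 _ le_rfl
    have hr : 0 < t * ‖ν‖ := by positivity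
    have hKA := hK.2.1 _ (hAΩ _ hr (hcs t h1 h2).2.2.2.2).1
    have h5 : C₂ * C₂ * (KV (y + t • ν) / K (y + t • ν)) * K (y + (t * ‖ν‖) • e) <
        C₂ * C₂ * M * K (y + (t * ‖ν‖) • e) := by gcongr
    linarith
  tfae_have 3 → 2 := fun h3 M => (h3.eventually_ge_atTop M).frequently
  tfae_have 2 → 1 := by
    intro h2 x hx
    obtain ⟨C, hC, hout⟩ := outerComp hN0 hbd L hcV hcV (fun _ _ => le_rfl) kh kV
    by_contra hne
    have hpos : 0 < h x := lt_of_le_of_ne (kh.nn x hx) (Ne.symm hne)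
    have hKVx := hKV.2.1 x hx
    have hd : 0 < dist x y := dist_pos.2 fun hxy => L.y_notMem (hxy ▸ hx)
    obtain ⟨t, hM, ⟨t1, t2⟩, -, t3⟩ := ((h2 ((C₂ * C₂ * (C * KV x) + 1) / h x)).and_eventually
      ((ev_small hc).and (ev_small (show 0 < dist x y / ‖ν‖ by positivity)))).exists
    rw [lt_div_iff₀ hn] at t3
    have hr : 0 < t * ‖ν‖ := by positivity
    have hA := (hAΩ _ hr (hcs t t1 t2).2.2.2.2).1
    have hKA := hK.2.1 _ hA
    have hKVA := hKV.2.1 _ hA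
    have g1 := hout _ hr (hcs t t1 t2).2.1 x hx t3
    have g2 := hlo t t1 t2 _ (by positivity) hM
    have g3 := (hgm.2.1 _ hA).2
    rw [div_mul_eq_mul_div, div_le_iff₀ hpos] at g2
    have g4 : h x * KV (y + (t * ‖ν‖) • e) ≤ C * (KV x * K (y + (t * ‖ν‖) • e)) :=
      g1.trans (by gcongr)
    have g5 := mul_le_mul_of_nonneg_left g4 (show 0 ≤ C₂ * C₂ by positivity)
    linarith
  tfae_have 1 → 3 := by
    intro h1
    rw [Filter.tendsto_atTop]
    intro M
    by_contra hcon
    rw [not_eventually] at hcon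
    obtain ⟨C, hC, hout⟩ := outerComp hN0 hbd L hcV hc0 hVV kV kK
    have hC0 : 0 < C := by linarith
    have hD : ∀ x ∈ Ω, KV x ≤ (C * (C₂ * C₂ * |M|) + 1) * K x := by
      intro x hx
      have hd : 0 < dist x y := dist_pos.2 fun hxy => L.y_notMem (hxy ▸ hx)
      obtain ⟨t, hM, ⟨t1, t2⟩, -, t3⟩ := (hcon.and_eventually
        ((ev_small hc).and (ev_small (show 0 < dist x y / ‖ν‖ by positivity)))).exists
      rw [lt_div_iff₀ hn] at t3
      rw [not_le] at hM
      have hr : 0 < t * ‖ν‖ := by positivity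
      have hA := (hAΩ _ hr (hcs t t1 t2).2.2.2.2).1
      have hKA := hK.2.1 _ hA
      have hKx := hK.2.1 x hx
      have g1 := hout _ hr (hcs t t1 t2).2.1 x hx t3
      have g2 := hup t t1 t2 |M| (hM.le.trans (le_abs_self M))
      have g3 : KV x * K (y + (t * ‖ν‖) • e) ≤
          C * (K x * (C₂ * C₂ * |M| * K (y + (t * ‖ν‖) • e))) := g1.trans (by gcongr)
      have g4 : KV x * K (y + (t * ‖ν‖) • e) ≤
          (C * (C₂ * C₂ * |M|) * K x) * K (y + (t * ‖ν‖) • e) := by linarith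
      have := le_of_mul_le_mul_right g4 hKA
      linarith
    have hDp : 0 < C * (C₂ * C₂ * |M|) + 1 := by positivity
    have := hgm.2.2 _ (hKV.1.div (C * (C₂ * C₂ * |M|) + 1)⁻¹) (fun x hx => by
      have := hKV.2.1 x hx
      refine ⟨by positivity, ?_⟩
      rw [inv_mul_le_iff₀ hDp]
      exact hD x hx) x₀ hx₀
    rw [h1 x₀ hx₀, hKV.2.2.1, mul_one] at this
    have := inv_pos.2 hDp
    linarith
  tfae_have 4 → 3 := by
    intro h4
    obtain ⟨C, hC, hlow⟩ := lowerProd hN0 hbd hx₀ L ha.le hcV kV tV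
    obtain ⟨C', hC', hupp⟩ := upperProd hN hbd hx₀ L ha.le hc0 kK t0
    have hC0 : 0 < C := by linarith
    have hC'0 : 0 < C' := by linarith
    rw [Filter.tendsto_atTop]
    intro M
    set ε := ((|M| + 1) * (C₂ * C₂) * (C' * C))⁻¹ with hε
    have hε0 : 0 < ε := by positivity
    have h5 := h4.eventually (Iio_mem_nhds hε0)
    rw [eventually_nhdsWithin_iff, Metric.eventually_nhds_iff] at h5
    obtain ⟨d, hd, h5⟩ := h5
    filter_upwards [ev_small hc, ev_small (show 0 < d / ‖ν‖ by positivity)] with t ⟨t1, t2⟩ ⟨_, t3⟩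
    rw [lt_div_iff₀ hn] at t3
    have hr : 0 < t * ‖ν‖ := by positivity
    have hA := hAΩ _ hr (hcs t t1 t2).2.2.2.2
    have hKVA := hKV.2.1 _ hA.1
    have hgA := t0.pos _ hA
    have g1 := h5 (by rw [hAd _ hr]; exact t3) hA.1
    rw [div_lt_iff₀ hgA] at g1
    have g2 := hlow _ hr (hcs t t1 t2).2.2.1
    have g3 := hupp _ hr (hcs t t1 t2).2.2.1
    rw [hKV.2.2.1, one_mul] at g2
    have hRN : 0 < (t * ‖ν‖) ^ N := by positivity
    refine (le_abs_self M).trans ((lt_add_one _).le.trans (hconv t t1 t2 _ (by positivity) ?_))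
    generalize y + (t * ‖ν‖) • e = A at *
    generalize t * ‖ν‖ = R at *
    have g4 : R ^ N * (K A * g0 A) ≤ R ^ N * (C' * C * (KV A * gV A)) := by
      refine (g3.trans (mul_le_mul_of_nonneg_left g2 hC'0.le)).trans_eq (by ring)
    have g5 := le_of_mul_le_mul_left g4 hRN
    have g6 : C' * C * (KV A * gV A) ≤ C' * C * (KV A * (ε * g0 A)) := by gcongr
    have g7 : K A * g0 A ≤ (C' * C * ε * KV A) * g0 A := by linarith
    have g8 := le_of_mul_le_mul_right g7 hgA
    have g9 := mul_le_mul_of_nonneg_left g8 (show 0 ≤ (|M| + 1) * (C₂ * C₂) by positivity)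
    refine g9.trans_eq ?_
    rw [hε]
    have : |M| + 1 ≠ 0 := by positivity
    field_simp
  tfae_have 3 → 4 := by
    intro h3
    obtain ⟨C, hC, hlow⟩ := lowerProd hN0 hbd hx₀ L ha.le hc0 kK t0
    obtain ⟨C', hC', hupp⟩ := upperProd hN hbd hx₀ L ha.le hcV kV tV
    obtain ⟨B, hB, hbhp⟩ := bhp N hN0 Λ (a * Λ ^ 2) hΛ
    have hC0 : 0 < C := by linarith
    have hC'0 : 0 < C' := by linarith
    have hB0 : 0 < B := by linarith
    rw [Metric.tendsto_nhds]
    intro ε hε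
    set M := 2 * (B * (C₂ * C₂) * (C' * C)) / ε with hM
    have hM0 : 0 < M := by positivity
    obtain ⟨t, hMt, t1, t2⟩ := ((h3.eventually_ge_atTop M).and (ev_small hc)).exists
    have hr : 0 < t * ‖ν‖ := by positivity
    obtain ⟨-, -, s2, s3, s4⟩ := hcs t t1 t2
    have hA := hAΩ _ hr s4
    have hKA := hK.2.1 _ hA.1
    have hgA := t0.pos _ hA
    have hgVA := tV.pos _ hA
    have g1 := hlow _ hr s2
    have g2 := hupp _ hr s2
    rw [hK.2.2.1, one_mul] at g1
    have g3 := hlo t t1 t2 M hM0.le hMt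
    have hbb : ball y (400 * Λ ^ 3 * (t * ‖ν‖)) ⊆ ball y ρ := ball_subset_ball s3
    have hb := hbhp H e L.g V (fun _ => 0) gV g0 y _ hr L.Hy ((tV.nsol L hcV).mono hbb)
      ((t0.nsol L hc0).mono hbb) (fun x h1 h2 => hVV x ((L.mem x (hbb h2)).2 h1))
      ((tV.vanish L).mono hbb)
    have hRN : 0 < (t * ‖ν‖) ^ N := by positivity
    rw [eventually_nhdsWithin_iff]
    filter_upwards [ball_mem_nhds y hr] with x hxb hxΩ
    have hxρ : x ∈ ball y ρ := ball_subset_ball s4.le hxb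
    have hxx : x ∈ Ω \ {x₀} := ⟨hxΩ, fun h => L.x0_notMem (h ▸ hxρ)⟩
    have p0 := t0.pos x hxx
    have pV := tV.pos x hxx
    have g4 := hb x ((L.mem x hxρ).1 hxΩ) hxb
    rw [Real.dist_eq, sub_zero, abs_of_pos (by positivity), div_lt_iff₀ p0]
    generalize y + (t * ‖ν‖) • e = A at *
    generalize t * ‖ν‖ = R at *
    have g5 : R ^ N * (KV A * gV A) ≤ R ^ N * (C' * C * (K A * g0 A)) := by
      refine (g2.trans (mul_le_mul_of_nonneg_left g1 hC'0.le)).trans_eq (by ring)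
    have g6 := le_of_mul_le_mul_left g5 hRN
    have g7 : (M * gV A) * K A ≤ (C₂ * C₂ * (C' * C) * g0 A) * K A := by
      have := mul_le_mul_of_nonneg_left g6 (show 0 ≤ C₂ * C₂ by positivity)
      have := mul_le_mul_of_nonneg_right g3 hgVA.le
      linarith
    have g8 := le_of_mul_le_mul_right g7 hKA
    have g9 : M * (gV x * g0 A) ≤ (B * (C₂ * C₂) * (C' * C) * g0 x) * g0 A := by
      have := mul_le_mul_of_nonneg_left g4 hM0.le
      have := mul_le_mul_of_nonneg_left g8 (show 0 ≤ B * g0 x by positivity)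
      linarith
    have g10 : (M * gV x) * g0 A ≤ (B * (C₂ * C₂) * (C' * C) * g0 x) * g0 A := by linarith
    have g11 := le_of_mul_le_mul_right g10 hgA
    rw [hM, div_mul_eq_mul_div, div_le_iff₀ hε] at g11
    have hD : 0 < B * (C₂ * C₂) * (C' * C) := by positivity
    generalize B * (C₂ * C₂) * (C' * C) = D at *
    have g12 : D * (2 * gV x) ≤ D * (ε * g0 x) := by linarith
    have := le_of_mul_le_mul_left g12 hD
    linarith
  tfae_finish
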